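/- arXiv:1210.7426 — 5 statements merged into one kernel-verified Lean document; each statement's English description precedes it below -/
import Mathlib

section
/- (Reversed-flow identity) Let p be a driving function from the Carathéodory class, C¹ on 𝔻̄ for each t and continuous in t with p, p' bounded. Let f(z,t) be a solution of the Löwner–Kufarev PDE ∂f/∂t = -z·(∂f/∂z)·p(z,t) with f(z,0) = z and each f(·,t) univalent on 𝔻. Fix s ∈ [0,T) and let h(ζ,t) be the solution of the time-reversed Cauchy problem dh/dt = -h·p(h, s-t), h(ζ,0) = ζ, for ζ ∈ 𝔻 and 0 ≤ t ≤ s. Then h(ζ,s) = f(ζ,s) for every ζ ∈ 𝔻. -/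
open MeasureTheory Metric Set Filter Topology
open scoped ENNReal

theorem setLIntegral_image_eq_of_hasDerivAt {G G' : ℂ → ℂ} {s : Set ℂ} (hs : MeasurableSet s)
    (hG : ∀ z ∈ s, HasDerivAt G (G' z) z) (hinj : InjOn G s) (g : ℂ → ℝ≥0∞) :
    ∫⁻ w in G '' s, g w = ∫⁻ z in s, ENNReal.ofReal (‖G' z‖ ^ 2) * g (G z) := by
  rw [lintegral_image_eq_lintegral_abs_det_fderiv_mul volume hs
    (fun z hz => ((hG z hz).hasFDerivAt.restrictScalars ℝ).hasFDerivWithinAt) hinj]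
  refine lintegral_congr fun z => ?_
  congr 2
  simp [ContinuousLinearMap.det, LinearMap.det_restrictScalars, Algebra.norm_complex_apply, Complex.normSq_eq_norm_sq]

theorem setLIntegral_annulus_inv_norm_sq_le {a b : ℝ} (ha : 0 < a) (hab : a ≤ b) :
    ∫⁻ w in {w : ℂ | ‖w‖ ∈ Icc a b}, ENNReal.ofReal (‖w‖ ^ 2)⁻¹ ≤
      ENNReal.ofReal (2 * Real.pi * Real.log (b / a)) := by
  have hm : MeasurableSet {w : ℂ | ‖w‖ ∈ Icc a b} := measurable_norm measurableSet_Icc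
  have hint : IntervalIntegrable (fun x : ℝ => x⁻¹) volume a b :=
    intervalIntegrable_inv_iff.2 (Or.inr (by
      rw [uIcc_of_le hab]; exact fun h => absurd h.1 (not_le.2 ha)))
  rw [← lintegral_indicator hm, ← Complex.lintegral_comp_polarCoord_symm]
  calc _ ≤ ∫⁻ p : ℝ × ℝ in polarCoord.target,
        (Icc a b).indicator (fun x => ENNReal.ofReal x⁻¹) p.1 * 1 := by
        refine setLIntegral_mono' polarCoord.open_target.measurableSet fun p hp => ?_
        have hp0 : 0 < p.1 := hp.1
        have hn : ‖Complex.polarCoord.symm p‖ = p.1 := by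
          rw [Complex.norm_polarCoord_symm, abs_of_pos hp0]
        have hiff : Complex.polarCoord.symm p ∈ {w : ℂ | ‖w‖ ∈ Icc a b} ↔ p.1 ∈ Icc a b := by
          rw [mem_ofPred_eq, hn]
        by_cases h : p.1 ∈ Icc a b
        · rw [indicator_of_mem (hiff.2 h), indicator_of_mem h, hn, smul_eq_mul,
            ← ENNReal.ofReal_mul hp0.le, mul_one]
          apply le_of_eq
          congr 1
          field_simp
        · rw [indicator_of_notMem (fun h' => h (hiff.1 h'))]
          simp
    _ = (∫⁻ x in Ioi 0, (Icc a b).indicator (fun x => ENNReal.ofReal x⁻¹) x) *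
          ∫⁻ θ : ℝ in Ioo (-Real.pi) Real.pi, 1 := by
        rw [polarCoord_target, Measure.volume_eq_prod, ← Measure.prod_restrict]
        exact lintegral_prod_mul
          ((ENNReal.measurable_ofReal.comp measurable_inv).indicator measurableSet_Icc).aemeasurable
          aemeasurable_const
    _ ≤ (∫⁻ x in Icc a b, ENNReal.ofReal x⁻¹) * ENNReal.ofReal (2 * Real.pi) := by
        refine mul_le_mul' ?_ ?_
        · rw [← lintegral_indicator measurableSet_Icc]
          exact setLIntegral_le_lintegral _ _
        · rw [setLIntegral_one, Real.volume_Ioo]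
          apply le_of_eq
          congr 1
          ring
    _ = _ := by
        rw [← ofReal_integral_eq_lintegral_ofReal
          ((intervalIntegrable_iff_integrableOn_Icc_of_le hab).1 hint)
          ((ae_restrict_iff' measurableSet_Icc).2 (ae_of_all _ fun x hx =>
            inv_nonneg.2 (ha.le.trans hx.1))), integral_Icc_eq_integral_Ioc,
          ← intervalIntegral.integral_of_le hab, integral_inv_of_pos ha (ha.trans_le hab),
          ← ENNReal.ofReal_mul (Real.log_nonneg ((one_le_div ha).2 hab)), mul_comm]

theorem ofReal_mul_enorm_center_le_setLIntegral_ball {F : ℂ → ℂ} {c : ℂ} {r : ℝ} (hr : 0 < r)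
    (hF : DifferentiableOn ℂ F (ball c r)) :
    ENNReal.ofReal (Real.pi * r ^ 2) * ‖F c‖ₑ ≤ ∫⁻ z in ball c r, ‖F z‖ₑ := by
  have hcirc : ∀ ρ ∈ Ioo 0 r, ENNReal.ofReal (2 * Real.pi) * ‖F c‖ₑ ≤
      ∫⁻ θ in Ioo (-Real.pi) Real.pi, ‖F (circleMap c ρ θ)‖ₑ := by
    intro ρ hρ
    have hd : DiffContOnCl ℂ F (ball c |ρ|) := by
      rw [abs_of_pos hρ.1]
      exact hF.diffContOnCl_ball (closedBall_subset_ball hρ.2)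
    have := hd.circleAverage
    rw [Real.circleAverage_eq_integral_add (-Real.pi)] at this
    rw [intervalIntegral.integral_comp_add_right (fun θ => F (circleMap c ρ θ))] at this
    have h2 : (∫ θ in (-Real.pi)..Real.pi, F (circleMap c ρ θ)) = (2 * Real.pi : ℝ) • F c := by
      rw [← this, smul_smul, mul_inv_cancel₀ (by positivity), one_smul]
      congr 1 <;> ring
    have h3 : ENNReal.ofReal (2 * Real.pi) * ‖F c‖ₑ = ‖(2 * Real.pi : ℝ) • F c‖ₑ := by
      rw [enorm_smul, Real.enorm_of_nonneg (by positivity)]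
    rw [h3, ← h2, intervalIntegral.integral_of_le (by linarith [Real.pi_pos]),
      ← restrict_Ioo_eq_restrict_Ioc]
    exact enorm_integral_le_lintegral_enorm _
  have hmeas : MeasurableSet (ball c r) := measurableSet_ball
  have hmem : ∀ p : ℝ × ℝ, p.1 ∈ Ioo 0 r → circleMap c p.1 p.2 ∈ ball c r := by
    intro p hp
    simpa [circleMap, abs_of_pos hp.1] using hp.2
  have hcont : ContinuousOn (fun p : ℝ × ℝ => ENNReal.ofReal p.1 * ‖F (circleMap c p.1 p.2)‖ₑ)
      (Ioo 0 r ×ˢ Ioo (-Real.pi) Real.pi) := by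
    have hc : Continuous fun p : ℝ × ℝ => circleMap c p.1 p.2 := by
      unfold circleMap
      fun_prop
    have hF' := hF.continuousOn.comp
      (hc.continuousOn (s := Ioo 0 r ×ˢ Ioo (-Real.pi) Real.pi)) fun p hp => hmem p hp.1
    exact fun p hp => ENNReal.Tendsto.mul
      ((ENNReal.continuous_ofReal.comp continuous_fst).continuousWithinAt)
      (Or.inr enorm_ne_top) (hF' p hp).enorm (Or.inr ENNReal.ofReal_ne_top)
  calc ENNReal.ofReal (Real.pi * r ^ 2) * ‖F c‖ₑ
      = ∫⁻ ρ in Ioo 0 r, ENNReal.ofReal ρ * (ENNReal.ofReal (2 * Real.pi) * ‖F c‖ₑ) := by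
        rw [lintegral_mul_const _ ENNReal.measurable_ofReal, ← mul_assoc]
        congr 1
        rw [← ofReal_integral_eq_lintegral_ofReal, ← integral_Ioc_eq_integral_Ioo,
          ← intervalIntegral.integral_of_le hr.le, integral_id,
          ← ENNReal.ofReal_mul (by nlinarith)]
        · congr 1
          ring
        · exact (intervalIntegrable_iff_integrableOn_Ioo_of_le hr.le).1
            intervalIntegral.intervalIntegrable_id
        · exact (ae_restrict_iff' measurableSet_Ioo).2 (ae_of_all _ fun x hx => hx.1.le)
    _ ≤ ∫⁻ ρ in Ioo 0 r, ∫⁻ θ in Ioo (-Real.pi) Real.pi,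
          ENNReal.ofReal ρ * ‖F (circleMap c ρ θ)‖ₑ := by
        refine setLIntegral_mono' measurableSet_Ioo fun ρ hρ => ?_
        rw [lintegral_const_mul' _ _ ENNReal.ofReal_ne_top]
        gcongr
        exact hcirc ρ hρ
    _ = ∫⁻ p : ℝ × ℝ in Ioo 0 r ×ˢ Ioo (-Real.pi) Real.pi,
          ENNReal.ofReal p.1 * ‖F (circleMap c p.1 p.2)‖ₑ := by
        rw [Measure.volume_eq_prod, setLIntegral_prod _
          (hcont.aemeasurable (measurableSet_Ioo.prod measurableSet_Ioo))]
    _ ≤ ∫⁻ p : ℝ × ℝ in polarCoord.target, ENNReal.ofReal p.1 •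
          (ball c r).indicator (fun z => ‖F z‖ₑ) (c + Complex.polarCoord.symm p) := by
        rw [polarCoord_target]
        refine (setLIntegral_mono' (measurableSet_Ioo.prod measurableSet_Ioo) fun p hp => ?_).trans
          (lintegral_mono_set (prod_mono Ioo_subset_Ioi_self subset_rfl))
        have hc : c + Complex.polarCoord.symm p = circleMap c p.1 p.2 := by
          rw [Complex.polarCoord_symm_apply, circleMap, Complex.exp_mul_I]
          push_cast
          rfl
        rw [hc, indicator_of_mem (hmem p hp.1), smul_eq_mul]
    _ = _ := by
        rw [Complex.lintegral_comp_polarCoord_symm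
          (fun z => (ball c r).indicator (fun z => ‖F z‖ₑ) (c + z)),
          lintegral_add_left_eq_self, lintegral_indicator hmeas]

theorem norm_le_norm_mul_exp_of_norm_deriv_le {G : ℂ → ℂ} {s : Set ℂ} {K : ℝ}
    (hs : Convex ℝ s) (hG : ∀ z ∈ s, DifferentiableAt ℂ G z)
    (hK : ∀ z ∈ s, ‖deriv G z‖ ≤ K * ‖G z‖) {y z : ℂ} (hy : y ∈ s) (hz : z ∈ s) :
    ‖G z‖ ≤ ‖G y‖ * Real.exp (K * ‖z - y‖) := by
  have hmem : ∀ t ∈ Icc (0 : ℝ) 1, y + t * (z - y) ∈ s := fun t ht => by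
    simpa using hs.add_smul_sub_mem hy hz ht
  have hd : ∀ t ∈ Icc (0 : ℝ) 1, HasDerivAt (fun t : ℝ => G (y + t * (z - y)))
      (deriv G (y + t * (z - y)) * (z - y)) t := fun t ht => by
    have h1 : HasDerivAt (fun t : ℝ => y + (t : ℂ) * (z - y)) (z - y) t := by
      simpa using ((Complex.ofRealCLM.hasDerivAt (x := t)).mul_const (z - y)).const_add y
    exact (hG _ (hmem t ht)).hasDerivAt.comp t h1
  have := norm_le_gronwallBound_of_norm_deriv_right_le (δ := ‖G y‖) (K := K * ‖z - y‖) (ε := 0)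
    (fun t ht => (hd t ht).continuousAt.continuousWithinAt)
    (fun t ht => (hd t (Ico_subset_Icc_self ht)).hasDerivWithinAt) (by simp)
    (fun t ht => by
      rw [norm_mul, add_zero, mul_right_comm]
      exact mul_le_mul_of_nonneg_right (hK _ (hmem t (Ico_subset_Icc_self ht))) (norm_nonneg _))
    1 (right_mem_Icc.2 zero_le_one)
  simpa [gronwallBound_ε0] using this

/-- At a point where `(r - dist z x) * ‖G' / G‖` is maximal, comparing the logarithmic area of the
image of a disc with the mean value property of `(G' / G) ^ 2` bounds the maximum. -/
theorem norm_deriv_mul_le_of_injOn_of_lt {G : ℂ → ℂ} {x : ℂ} {r R : ℝ} (hr : 0 < r) (hrR : r < R)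
    (hG : DifferentiableOn ℂ G (ball x R)) (hinj : InjOn G (ball x R))
    (hne : ∀ z ∈ ball x R, G z ≠ 0) : ‖deriv G x‖ * r ≤ 16 * ‖G x‖ := by
  have hsub : closedBall x r ⊆ ball x R := closedBall_subset_ball hrR
  have hdiff : ∀ z ∈ ball x R, DifferentiableAt ℂ G z := fun z hz =>
    hG.differentiableAt (isOpen_ball.mem_nhds hz)
  set L : ℂ → ℂ := fun z => deriv G z / G z with hL
  have hLd : DifferentiableOn ℂ L (ball x R) := (hG.deriv isOpen_ball).div hG hne
  obtain ⟨z₁, hz₁, hmax⟩ := (isCompact_closedBall x r).exists_isMaxOn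
    ⟨x, mem_closedBall_self hr.le⟩ (f := fun z => (r - dist z x) * ‖L z‖)
    ((continuousOn_const.sub (continuous_id.dist continuous_const).continuousOn).mul
      (hLd.continuousOn.mono hsub).norm)
  set m := (r - dist z₁ x) * ‖L z₁‖ with hm
  have hmle : ∀ z ∈ closedBall x r, (r - dist z x) * ‖L z‖ ≤ m := fun z hz => hmax hz
  have hderiv : ∀ z ∈ ball x R, ‖deriv G z‖ = ‖L z‖ * ‖G z‖ := fun z hz => by
    rw [hL, norm_div, div_mul_cancel₀ _ (norm_ne_zero_iff.2 (hne z hz))]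
  have hxR : x ∈ ball x R := mem_ball_self (hr.trans hrR)
  suffices hm16 : m ≤ 16 by
    have := hmle x (mem_closedBall_self hr.le)
    rw [dist_self, sub_zero] at this
    rw [hderiv x hxR]
    nlinarith [norm_nonneg (G x)]
  by_contra! hcon
  have hdist : dist z₁ x ≤ r := hz₁
  have hLpos : 0 < ‖L z₁‖ := by
    refine (norm_nonneg _).lt_of_ne fun h => ?_
    rw [hm, ← h] at hcon
    linarith
  have hD : 0 < r - dist z₁ x := by
    by_contra! h
    nlinarith
  set D := r - dist z₁ x with hDdef
  set B := ball z₁ (D / 2)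
  have hBsub : B ⊆ ball x R := fun z hz => by
    have := dist_triangle z z₁ x
    have hz' : dist z z₁ < D / 2 := hz
    rw [mem_ball]
    linarith
  have hLB : ∀ z ∈ B, ‖L z‖ ≤ 2 * m / D := fun z hz => by
    have := dist_triangle z z₁ x
    have hz' : dist z z₁ < D / 2 := hz
    have h1 : D / 2 ≤ r - dist z x := by linarith
    have h2 := hmle z (by rw [mem_closedBall]; linarith)
    rw [le_div_iff₀ hD]
    nlinarith [norm_nonneg (L z)]
  have hz₁B : z₁ ∈ B := mem_ball_self (half_pos hD)
  have hgrow : ∀ y ∈ B, ∀ z ∈ B, dist z y ≤ D / 2 → ‖G z‖ ≤ ‖G y‖ * Real.exp m := by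
    intro y hy z hz hyz
    refine (norm_le_norm_mul_exp_of_norm_deriv_le (convex_ball z₁ (D / 2))
      (fun z hz => hdiff z (hBsub hz)) (K := 2 * m / D) (fun z hz => ?_) hy hz).trans ?_
    · rw [hderiv z (hBsub hz)]
      exact mul_le_mul_of_nonneg_right (hLB z hz) (norm_nonneg _)
    · gcongr
      rw [← dist_eq_norm]
      calc 2 * m / D * dist z y ≤ 2 * m / D * (D / 2) := by
            have : 0 ≤ 2 * m / D := by positivity
            gcongr
        _ = m := by field_simp
  have hG₁ : 0 < ‖G z₁‖ := norm_pos_iff.2 (hne _ (hBsub hz₁B))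
  have himage : G '' B ⊆ {w : ℂ | ‖w‖ ∈ Icc (‖G z₁‖ * Real.exp (-m)) (‖G z₁‖ * Real.exp m)} := by
    rintro _ ⟨z, hz, rfl⟩
    have hz' : dist z z₁ ≤ D / 2 := (mem_ball.1 hz).le
    refine ⟨?_, hgrow _ hz₁B z hz hz'⟩
    rw [Real.exp_neg, ← div_eq_mul_inv, div_le_iff₀ (Real.exp_pos m)]
    exact hgrow z hz z₁ hz₁B (by rwa [dist_comm])
  have harea : ENNReal.ofReal (Real.pi * (D / 2) ^ 2) * ‖L z₁ ^ 2‖ₑ ≤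
      ENNReal.ofReal (2 * Real.pi * (2 * m)) :=
    calc _ ≤ ∫⁻ z in B, ‖L z ^ 2‖ₑ :=
          ofReal_mul_enorm_center_le_setLIntegral_ball (F := fun z => L z ^ 2) (half_pos hD)
            ((hLd.mono hBsub).pow 2)
      _ = ∫⁻ z in B, ENNReal.ofReal (‖deriv G z‖ ^ 2) * ENNReal.ofReal (‖G z‖ ^ 2)⁻¹ := by
          refine lintegral_congr fun z => ?_
          rw [← ENNReal.ofReal_mul (by positivity), ← ofReal_norm, norm_pow, norm_div, div_pow,
            div_eq_mul_inv]
      _ = ∫⁻ w in G '' B, ENNReal.ofReal (‖w‖ ^ 2)⁻¹ :=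
          (setLIntegral_image_eq_of_hasDerivAt measurableSet_ball
            (fun z hz => (hdiff z (hBsub hz)).hasDerivAt) (hinj.mono hBsub) (fun w => ENNReal.ofReal (‖w‖ ^ 2)⁻¹)).symm
      _ ≤ _ := lintegral_mono_set himage
      _ ≤ _ := setLIntegral_annulus_inv_norm_sq_le (by positivity) (by gcongr; linarith)
      _ = _ := by
          rw [mul_div_mul_left _ _ hG₁.ne', ← Real.exp_sub, Real.log_exp]
          congr 2
          ring
  rw [← ofReal_norm, ← ENNReal.ofReal_mul (by positivity),
    ENNReal.ofReal_le_ofReal_iff (by positivity), norm_pow] at harea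
  have h1 : Real.pi * (D / 2) ^ 2 * ‖L z₁‖ ^ 2 = Real.pi * (m ^ 2 / 4) := by
    rw [hm]
    ring
  rw [h1] at harea
  have h2 : m ^ 2 / 4 ≤ 4 * m := le_of_mul_le_mul_left (by linarith) Real.pi_pos
  nlinarith

/-- The logarithmic derivative of a nonvanishing univalent function on a disc is bounded at the
centre. -/
theorem norm_deriv_mul_le_of_injOn {G : ℂ → ℂ} {x : ℂ} {R : ℝ} (hR : 0 < R)
    (hG : DifferentiableOn ℂ G (ball x R)) (hinj : InjOn G (ball x R))
    (hne : ∀ z ∈ ball x R, G z ≠ 0) : ‖deriv G x‖ * R ≤ 16 * ‖G x‖ := by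
  have ht : Tendsto (fun r => ‖deriv G x‖ * r) (𝓝[<] R) (𝓝 (‖deriv G x‖ * R)) :=
    (tendsto_id.mono_left nhdsWithin_le_nhds).const_mul _
  refine le_of_tendsto ht ?_
  filter_upwards [Ioo_mem_nhdsLT hR] with r hr
  exact norm_deriv_mul_le_of_injOn_of_lt hr.1 hr.2 hG hinj hne

theorem norm_le_of_injOn_ball {G : ℂ → ℂ} {x z : ℂ} {R : ℝ}
    (hG : DifferentiableOn ℂ G (ball x R)) (hinj : InjOn G (ball x R))
    (hne : ∀ z ∈ ball x R, G z ≠ 0) (hz : z ∈ ball x (R / 2)) :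
    ‖G z‖ ≤ ‖G x‖ * Real.exp 16 := by
  have hR : 0 < R / 2 := pos_of_mem_ball hz
  have hsub : ∀ y ∈ ball x (R / 2), ball y (R / 2) ⊆ ball x R := fun y hy =>
    ball_subset_ball' (by linarith [mem_ball.1 hy])
  refine (norm_le_norm_mul_exp_of_norm_deriv_le (convex_ball x (R / 2)) (fun y hy =>
    hG.differentiableAt (isOpen_ball.mem_nhds (hsub y hy (mem_ball_self hR))))
    (K := 16 / (R / 2)) (fun y hy => ?_) (mem_ball_self hR) hz).trans ?_
  · have := norm_deriv_mul_le_of_injOn hR (hG.mono (hsub y hy)) (hinj.mono (hsub y hy))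
      fun z hz => hne z (hsub y hy hz)
    rw [div_mul_eq_mul_div, le_div_iff₀ hR]
    exact this
  · gcongr
    rw [div_mul_eq_mul_div, div_le_iff₀ hR]
    gcongr
    exact (mem_ball_iff_norm.1 hz).le

theorem exists_eventually_norm_le_of_injOn {F : ℂ → ℝ → ℂ} {U : Set ℂ} {S : Set ℝ} {τ : ℝ} {z₀ : ℂ}
    (hU : IsOpen U) (hz₀ : z₀ ∈ U) (hF : ∀ t ∈ S, DifferentiableOn ℂ (fun z => F z t) U)
    (hinj : ∀ t ∈ S, InjOn (fun z => F z t) U)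
    (hcont : ∀ z ∈ U, ContinuousWithinAt (F z) S τ) :
    ∃ r > 0, ball z₀ r ⊆ U ∧ ∃ C, ∀ᶠ t in 𝓝[S] τ, ∀ z ∈ ball z₀ r, ‖F z t‖ ≤ C := by
  obtain ⟨R, hR, hRU⟩ := Metric.isOpen_iff.1 hU z₀ hz₀
  have hydist : dist (z₀ + (R / 2 : ℝ)) z₀ = R / 2 := by
    rw [dist_eq_norm, add_sub_cancel_left, Complex.norm_real, Real.norm_of_nonneg (half_pos hR).le]
  set y : ℂ := z₀ + (R / 2 : ℝ)
  have hyU : y ∈ U := hRU (by rw [mem_ball, hydist]; exact half_lt_self hR)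
  have hsub : ball z₀ (R / 2) ⊆ U := (ball_subset_ball (half_le_self hR.le)).trans hRU
  have hy : y ∉ ball z₀ (R / 2) := by rw [mem_ball, hydist]; exact lt_irrefl _
  refine ⟨R / 2 / 2, by positivity, (ball_subset_ball (half_le_self (by positivity))).trans hsub,
    (‖F z₀ τ - F y τ‖ + 1) * Real.exp 16 + (‖F y τ‖ + 1), ?_⟩
  have h1 : ∀ᶠ t in 𝓝[S] τ, ‖F z₀ t - F y t‖ < ‖F z₀ τ - F y τ‖ + 1 :=
    ((hcont z₀ hz₀).sub (hcont y hyU)).norm.eventually_lt_const (lt_add_one _)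
  have h2 : ∀ᶠ t in 𝓝[S] τ, ‖F y t‖ < ‖F y τ‖ + 1 :=
    (hcont y hyU).norm.eventually_lt_const (lt_add_one _)
  filter_upwards [h1, h2, self_mem_nhdsWithin] with t ht1 ht2 htS z hz
  have h3 := norm_le_of_injOn_ball (G := fun z => F z t - F y t) (((hF t htS).mono hsub).sub_const _)
    (fun a ha b hb hab => hinj t htS (hsub ha) (hsub hb) (sub_left_injective hab))
    (fun a ha h0 => hy (hinj t htS (hsub ha) hyU (sub_eq_zero.1 h0) ▸ ha)) hz
  calc ‖F z t‖ ≤ ‖F z t - F y t‖ + ‖F y t‖ := norm_le_norm_sub_add _ _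
    _ ≤ ‖F z₀ t - F y t‖ * Real.exp 16 + ‖F y t‖ := by gcongr
    _ ≤ _ := by gcongr

theorem norm_dslope_sub_deriv_le {G : ℂ → ℂ} {c w : ℂ} {r C : ℝ} (hw : w ∈ ball c r)
    (hG : DifferentiableOn ℂ G (ball c r)) (hC : ∀ z ∈ ball c r, ‖G z‖ ≤ C) :
    ‖dslope G c w - deriv G c‖ ≤ 2 * (2 * C / r) / r * ‖w - c‖ := by
  have hr : 0 < r := pos_of_mem_ball hw
  have hc : c ∈ ball c r := mem_ball_self hr
  have hmaps : ∀ {H : ℂ → ℂ} {K : ℝ}, (∀ z ∈ ball c r, ‖H z‖ ≤ K) →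
      MapsTo H (ball c r) (closedBall (H c) (2 * K)) := fun hK z hz => by
    rw [mem_closedBall, dist_eq_norm]
    exact (norm_sub_le _ _).trans (by linarith [hK z hz, hK c hc])
  have hG' : DifferentiableOn ℂ (dslope G c) (ball c r) :=
    (Complex.differentiableOn_dslope (ball_mem_nhds c hr)).2 hG
  have h1 : ∀ z ∈ ball c r, ‖dslope G c z‖ ≤ 2 * C / r := fun z hz =>
    Complex.norm_dslope_le_div_of_mapsTo_ball hG (hmaps hC) hz
  have h2 := Complex.norm_dslope_le_div_of_mapsTo_ball hG' (hmaps h1) hw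
  rw [← dslope_same G c, ← sub_smul_dslope (dslope G c) c w, smul_eq_mul, norm_mul, mul_comm]
  gcongr

theorem tendsto_dslope_nhds_prod {F : ℂ → ℝ → ℂ} {S : Set ℝ} {τ r C : ℝ} {z₀ : ℂ} (hτ : τ ∈ S)
    (hr : 0 < r) (hF : ∀ t ∈ S, DifferentiableOn ℂ (fun z => F z t) (ball z₀ r))
    (hC : ∀ᶠ t in 𝓝[S] τ, ∀ z ∈ ball z₀ r, ‖F z t‖ ≤ C)
    (hcont : ∀ z ∈ ball z₀ r, ContinuousWithinAt (F z) S τ) :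
    Tendsto (fun q : ℂ × ℝ => dslope (fun z => F z q.2) z₀ q.1) (𝓝 z₀ ×ˢ 𝓝[S] τ)
      (𝓝 (deriv (fun z => F z τ) z₀)) := by
  set K := 2 * (2 * C / r) / r
  have hlim : Tendsto (fun w => K * ‖w - z₀‖) (𝓝 z₀) (𝓝 0) := by
    have : Continuous fun w => K * ‖w - z₀‖ := by fun_prop
    simpa using this.tendsto z₀
  rw [Metric.tendsto_nhds]
  intro ε hε
  have hball : ∀ᶠ w in 𝓝 z₀, w ∈ ball z₀ r := ball_mem_nhds z₀ hr
  have hsmall := hball.and (hlim.eventually_lt_const (show 0 < ε / 4 by positivity))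
  obtain ⟨w₁, ⟨hw₁r, hw₁⟩, hne⟩ :=
    ((hsmall.filter_mono nhdsWithin_le_nhds).and (self_mem_nhdsWithin (s := {z₀}ᶜ))).exists
  have hne : w₁ ≠ z₀ := hne
  have hslope : ∀ᶠ t in 𝓝[S] τ,
      dist (dslope (fun z => F z t) z₀ w₁) (dslope (fun z => F z τ) z₀ w₁) < ε / 4 := by
    have : ContinuousWithinAt (fun t => dslope (fun z => F z t) z₀ w₁) S τ := by
      simp only [dslope_of_ne _ hne, slope_def_module]
      exact ContinuousWithinAt.const_smul
        ((hcont w₁ hw₁r).sub (hcont z₀ (mem_ball_self hr))) (w₁ - z₀)⁻¹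
    exact Metric.tendsto_nhds.1 this _ (by positivity)
  have hCτ := hC.self_of_nhdsWithin hτ
  filter_upwards [hsmall.prod_mk (hslope.and (hC.and self_mem_nhdsWithin))] with
    ⟨w, t⟩ ⟨⟨hwr, hw⟩, htslope, htC, htS⟩
  have e1 := norm_dslope_sub_deriv_le hwr (hF t htS) htC
  have e2 := norm_dslope_sub_deriv_le hw₁r (hF t htS) htC
  have e3 := norm_dslope_sub_deriv_le hw₁r (hF τ hτ) hCτ
  rw [← dist_eq_norm] at e1 e2 e3
  rw [dist_comm] at e2
  have t1 := dist_triangle4 (dslope (fun z => F z t) z₀ w) (deriv (fun z => F z t) z₀)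
    (dslope (fun z => F z t) z₀ w₁) (dslope (fun z => F z τ) z₀ w₁)
  have t2 := dist_triangle (dslope (fun z => F z t) z₀ w) (dslope (fun z => F z τ) z₀ w₁)
    (deriv (fun z => F z τ) z₀)
  dsimp only at *
  linarith

/-- Chain rule along a path for a function that is univalent in the first variable and
differentiable in the second one; no joint regularity is assumed. -/
theorem hasDerivWithinAt_comp_of_injOn {F : ℂ → ℝ → ℂ} {U : Set ℂ} {S I : Set ℝ} {t : ℝ}
    {w : ℝ → ℂ} {σ : ℝ → ℝ} {w' d : ℂ} (hU : IsOpen U) (hw : w t ∈ U) (ht : t ∈ I)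
    (hF : ∀ τ ∈ S, DifferentiableOn ℂ (fun z => F z τ) U)
    (hinj : ∀ τ ∈ S, InjOn (fun z => F z τ) U)
    (hcont : ∀ z ∈ U, ContinuousWithinAt (F z) S (σ t))
    (hσ : ContinuousWithinAt σ I t) (hσS : MapsTo σ I S) (hw' : HasDerivWithinAt w w' I t)
    (hd : HasDerivWithinAt (fun u => F (w t) (σ u)) d I t) :
    HasDerivWithinAt (fun u => F (w u) (σ u)) (w' * deriv (fun z => F z (σ t)) (w t) + d) I t := by
  obtain ⟨r, hr, hrU, C, hC⟩ := exists_eventually_norm_le_of_injOn hU hw hF hinj hcont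
  have hlim := tendsto_dslope_nhds_prod (hσS ht) hr (fun τ hτ => (hF τ hτ).mono hrU) hC
    fun z hz => hcont z (hrU hz)
  have hpath : Tendsto (fun u => (w u, σ u)) (𝓝[I] t) (𝓝 (w t) ×ˢ 𝓝[S] (σ t)) :=
    hw'.continuousWithinAt.tendsto.prodMk (tendsto_nhdsWithin_of_tendsto_nhds_of_eventually_within _ hσ
      (eventually_nhdsWithin_of_forall hσS))
  have hsplit : ∀ u, F (w u) (σ u) =
      (w u - w t) * dslope (fun z => F z (σ u)) (w t) (w u) + F (w t) (σ u) := fun u => by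
    have := sub_smul_dslope (fun z => F z (σ u)) (w t) (w u)
    rw [smul_eq_mul] at this
    rw [this, sub_add_cancel]
  simp_rw [hsplit]
  refine HasDerivWithinAt.add ?_ hd
  rw [hasDerivWithinAt_iff_tendsto_slope] at hw' ⊢
  have := hw'.mul ((hlim.comp hpath).mono_left (nhdsWithin_mono t sdiff_subset))
  refine this.congr fun u => ?_
  simp [slope_def_module, mul_assoc]

/- STATEMENT 4 (Reversed-flow identity): If `f` solves the Löwner–Kufarev PDE
`∂f/∂t = -z·(∂f/∂z)·p(z,t)`, `f(z,0) = z`, with univalent `f(·,t)`, and for a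
fixed `s ∈ [0,T)` the function `h(ζ,t)` solves the time-reversed Cauchy problem
`dh/dt = -h·p(h, s-t)`, `h(ζ,0) = ζ`, then `h(ζ,s) = f(ζ,s)` for every ζ ∈ 𝔻. -/
theorem loewner_kufarev_reversed_flow_identity
    (T : ℝ) (hT : 0 < T) (p p' : ℂ → ℝ → ℂ)
    -- Carathéodory class driving function
    (hp_hol : ∀ t ∈ Set.Ico (0:ℝ) T,
      DifferentiableOn ℂ (fun z => p z t) (Metric.ball (0:ℂ) 1))
    (hp_cont : ∀ t ∈ Set.Ico (0:ℝ) T,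
      ContinuousOn (fun z => p z t) (Metric.closedBall (0:ℂ) 1))
    (hp_one : ∀ t ∈ Set.Ico (0:ℝ) T, p 0 t = 1)
    (hp_re : ∀ t ∈ Set.Ico (0:ℝ) T, ∀ z ∈ Metric.ball (0:ℂ) 1, 0 < (p z t).re)
    -- p(·,t) is C¹ on 𝔻̄, continuous in t, with p, p' bounded on 𝔻̄ × [0,T)
    (hp' : ∀ t ∈ Set.Ico (0:ℝ) T, ∀ z ∈ Metric.ball (0:ℂ) 1,
      HasDerivAt (fun x => p x t) (p' z t) z)
    (hp'_cont : ∀ t ∈ Set.Ico (0:ℝ) T,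
      ContinuousOn (fun z => p' z t) (Metric.closedBall (0:ℂ) 1))
    (hp_t : ∀ z ∈ Metric.closedBall (0:ℂ) 1, ContinuousOn (fun t => p z t) (Set.Ico 0 T))
    (M M' : ℝ)
    (hp_bdd : ∀ z ∈ Metric.closedBall (0:ℂ) 1, ∀ t ∈ Set.Ico (0:ℝ) T, ‖p z t‖ ≤ M)
    (hp'_bdd : ∀ z ∈ Metric.closedBall (0:ℂ) 1, ∀ t ∈ Set.Ico (0:ℝ) T, ‖p' z t‖ ≤ M')
    -- f solves the Löwner–Kufarev PDE, with spatial derivative fz,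
    -- f(z,0) = z, each f(·,t) univalent (injective holomorphic) on 𝔻
    (f fz : ℂ → ℝ → ℂ)
    (hf_init : ∀ z ∈ Metric.ball (0:ℂ) 1, f z 0 = z)
    (hf_hol : ∀ t ∈ Set.Ico (0:ℝ) T,
      DifferentiableOn ℂ (fun z => f z t) (Metric.ball (0:ℂ) 1))
    (hf_inj : ∀ t ∈ Set.Ico (0:ℝ) T,
      Set.InjOn (fun z => f z t) (Metric.ball (0:ℂ) 1))
    (hfz : ∀ t ∈ Set.Ico (0:ℝ) T, ∀ z ∈ Metric.ball (0:ℂ) 1,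
      HasDerivAt (fun x => f x t) (fz z t) z)
    (hf_pde : ∀ z ∈ Metric.ball (0:ℂ) 1, ∀ t ∈ Set.Ico (0:ℝ) T,
      HasDerivWithinAt (fun u => f z u) (-(z * fz z t * p z t)) (Set.Ico 0 T) t)
    -- fixed time s and the time-reversed flow h
    (s : ℝ) (hs : s ∈ Set.Ico (0:ℝ) T)
    (h : ℂ → ℝ → ℂ)
    (hh_init : ∀ ζ ∈ Metric.ball (0:ℂ) 1, h ζ 0 = ζ)
    (hh_mem : ∀ ζ ∈ Metric.ball (0:ℂ) 1, ∀ t ∈ Set.Icc (0:ℝ) s,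
      h ζ t ∈ Metric.ball (0:ℂ) 1)
    (hh_ode : ∀ ζ ∈ Metric.ball (0:ℂ) 1, ∀ t ∈ Set.Icc (0:ℝ) s,
      HasDerivWithinAt (h ζ) (-(h ζ t * p (h ζ t) (s - t))) (Set.Icc 0 s) t) :
    ∀ ζ ∈ Metric.ball (0:ℂ) 1, h ζ s = f ζ s := by
  intro ζ hζ
  have hsub : MapsTo (fun u => s - u) (Icc 0 s) (Ico 0 T) := fun u hu =>
    ⟨sub_nonneg.2 hu.2, (sub_le_self s hu.1).trans_lt hs.2⟩
  have hderiv : ∀ t ∈ Icc 0 s, HasDerivWithinAt (fun u => f (h ζ u) (s - u)) 0 (Icc 0 s) t := by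
    intro t ht
    have hmem := hh_mem ζ hζ t ht
    have hd : HasDerivWithinAt (fun u => f (h ζ t) (s - u))
        (h ζ t * fz (h ζ t) (s - t) * p (h ζ t) (s - t)) (Icc 0 s) t := by
      simpa [Function.comp_def] using (hf_pde _ hmem _ (hsub ht)).scomp t
        ((hasDerivWithinAt_id t (Icc 0 s)).const_sub s) hsub
    convert hasDerivWithinAt_comp_of_injOn isOpen_ball hmem ht hf_hol hf_inj
      (fun z hz => (hf_pde z hz _ (hsub ht)).continuousWithinAt)
      (continuous_const.sub continuous_id).continuousWithinAt hsub (hh_ode ζ hζ t ht) hd using 1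
    rw [(hfz _ (hsub ht) _ hmem).deriv]
    ring
  have hconst := constant_of_has_deriv_right_zero
    (fun t ht => (hderiv t ht).continuousWithinAt)
    (fun t ht => (hderiv t (Ico_subset_Icc_self ht)).mono_of_mem_nhdsWithin
      (Icc_mem_nhdsGE_of_mem ht)) s (right_mem_Icc.2 hs.1)
  simpa [hh_init ζ hζ, hf_init _ (hh_mem ζ hζ s (right_mem_Icc.2 hs.1))] using hconst
end

section
/- Let p be a driving function from the Carathéodory class, C¹ on 𝔻̄ for each t, continuous in t, with p and p' = ∂p/∂z bounded on 𝔻̄ × [0,T). Fix s ∈ [0,T) and let h(ζ,t) solve dh/dt = -h·p(h, s-t), h(ζ,0) = ζ, ζ ∈ 𝔻, 0 ≤ t ≤ s; let f(ζ,s) = h(ζ,s) and f' = ∂f/∂ζ. Then for every ζ ∈ 𝔻, arg(ζ·f'(ζ,s)/f(ζ,s)) = -Im ∫₀ˢ h(ζ,t)·p'(h(ζ,t), s-t) dt, where arg denotes the continuous branch with value 0 at ζ = 0 (equivalently, Im log(ζ f'(ζ,s)/f(ζ,s)) for the branch of log equal to 0 at 1). -/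
section

open Set Filter Topology Complex

/-- If `f z t` is jointly continuous and holomorphic in `z`, then its complex derivative is jointly
continuous. -/
theorem continuousOn_uncurry_of_hasDerivAt {U : Set ℂ} (hU : IsOpen U) {S : Set ℝ}
    {f f' : ℂ → ℝ → ℂ} (hf : ContinuousOn (Function.uncurry f) (U ×ˢ S))
    (hf' : ∀ t ∈ S, ∀ z ∈ U, HasDerivAt (fun x => f x t) (f' z t) z) :
    ContinuousOn (Function.uncurry f') (U ×ˢ S) := by
  rintro ⟨z₀, t₀⟩ ⟨hz₀, ht₀⟩
  have hdiff : ∀ t ∈ S, DifferentiableOn ℂ (fun x => f x t) U := fun t ht z hz =>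
    (hf' t ht z hz).differentiableAt.differentiableWithinAt
  have hfc : ContinuousOn (fun x => f x t₀) U := (hdiff t₀ ht₀).continuousOn
  have hlim : TendstoLocallyUniformlyOn (fun t x => f x t) (fun x => f x t₀) (𝓝[S] t₀) U := by
    rw [hU.tendstoLocallyUniformlyOn_iff_forall_tendsto]
    intro z hz
    have h₁ : Tendsto (fun y : ℝ × ℂ => f y.2 t₀) (𝓝[S] t₀ ×ˢ 𝓝 z) (𝓝 (f z t₀)) :=
      (hfc.continuousAt (hU.mem_nhds hz)).tendsto.comp tendsto_snd
    have h₂ : Tendsto (fun y : ℝ × ℂ => f y.2 y.1) (𝓝[S] t₀ ×ˢ 𝓝 z) (𝓝 (f z t₀)) := by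
      have h₃ := hf (z, t₀) ⟨hz, ht₀⟩
      rw [ContinuousWithinAt, nhdsWithin_prod_eq, hU.nhdsWithin_eq hz] at h₃
      exact h₃.comp tendsto_prod_swap
    exact (h₁.prodMk_nhds h₂).mono_right (nhds_le_uniformity _)
  have hlim' := hlim.deriv (eventually_mem_nhdsWithin.mono hdiff) hU
  have h₁ : Tendsto (fun y : ℝ × ℂ => deriv (fun x => f x t₀) y.2) (𝓝[S] t₀ ×ˢ 𝓝 z₀)
      (𝓝 (deriv (fun x => f x t₀) z₀)) :=
    ((((hdiff t₀ ht₀).deriv hU).continuousOn).continuousAt (hU.mem_nhds hz₀)).tendsto.comp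
      tendsto_snd
  rw [hU.tendstoLocallyUniformlyOn_iff_forall_tendsto] at hlim'
  have h₂ := Uniform.tendsto_congr (hlim' z₀ hz₀) |>.1 h₁
  rw [ContinuousWithinAt, nhdsWithin_prod_eq, hU.nhdsWithin_eq hz₀]
  have h₃ := h₂.comp (tendsto_prod_swap (f := 𝓝 z₀) (g := 𝓝[S] t₀))
  rw [(hf' t₀ ht₀ z₀ hz₀).deriv] at h₃
  refine h₃.congr' ?_
  filter_upwards [prod_mem_prod (hU.mem_nhds hz₀) self_mem_nhdsWithin] with y hy
  exact (hf' y.2 hy.2 y.1 hy.1).deriv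

/-- Interchange of the time derivative and the complex derivative: if `f z t` is holomorphic in `z`
and its time derivative `k z t` is jointly continuous and holomorphic in `z`, then the complex
derivative `f'` of `f` has time derivative the complex derivative `k'` of `k`. -/
theorem hasDerivWithinAt_of_hasDerivAt_comm {U : Set ℂ} (hU : IsOpen U) {S : Set ℝ}
    (hS : Convex ℝ S) {f k f' k' : ℂ → ℝ → ℂ}
    (hf : ∀ z ∈ U, ∀ t ∈ S, HasDerivWithinAt (f z) (k z t) S t)
    (hk : ContinuousOn (Function.uncurry k) (U ×ˢ S))
    (hf' : ∀ t ∈ S, ∀ z ∈ U, HasDerivAt (fun x => f x t) (f' z t) z)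
    (hk' : ∀ t ∈ S, ∀ z ∈ U, HasDerivAt (fun x => k x t) (k' z t) z)
    {z₀ : ℂ} (hz₀ : z₀ ∈ U) {t₀ : ℝ} (ht₀ : t₀ ∈ S) :
    HasDerivWithinAt (f' z₀) (k' z₀ t₀) S t₀ := by
  have hquot : ∀ t ∈ S, ∀ z ∈ U, HasDerivAt (fun x => slope (f x) t₀ t)
      (slope (f' z) t₀ t) z := fun t ht z hz =>
    ((hf' t ht z hz).sub (hf' t₀ ht₀ z hz)).const_smul ((t - t₀)⁻¹)
  have hlim : TendstoLocallyUniformlyOn (fun t x => slope (f x) t₀ t) (fun x => k x t₀)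
      (𝓝[S \ {t₀}] t₀) U := by
    rw [Metric.tendstoLocallyUniformlyOn_iff]
    intro ε hε z hz
    have hev : ∀ᶠ y : ℂ × ℝ in 𝓝 z ×ˢ 𝓝[S] t₀, dist (k y.1 y.2) (k z t₀) < ε / 4 := by
      have h₃ := hk (z, t₀) ⟨hz, ht₀⟩
      rw [ContinuousWithinAt, nhdsWithin_prod_eq, hU.nhdsWithin_eq hz] at h₃
      exact h₃ (Metric.ball_mem_nhds _ (by positivity))
    obtain ⟨A, hA, B, hB, hAB⟩ := mem_prod_iff.1 hev
    obtain ⟨δ, hδ, hδB⟩ := Metric.mem_nhdsWithin_iff.1 hB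
    refine ⟨A ∩ U, mem_nhdsWithin_of_mem_nhds (inter_mem hA (hU.mem_nhds hz)), ?_⟩
    have hball : Metric.ball t₀ δ ∈ 𝓝[S \ {t₀}] t₀ :=
      mem_nhdsWithin_of_mem_nhds (Metric.ball_mem_nhds _ hδ)
    filter_upwards [hball, self_mem_nhdsWithin] with t htδ htS y hy
    have hne : t - t₀ ≠ 0 := sub_ne_zero.2 htS.2
    have hmem₀ : t₀ ∈ Metric.ball t₀ δ ∩ S := ⟨Metric.mem_ball_self hδ, ht₀⟩
    have hmv : ‖(f y t - t • k y t₀) - (f y t₀ - t₀ • k y t₀)‖ ≤ ε / 2 * ‖t - t₀‖ := by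
      refine ((convex_ball t₀ δ).inter hS).norm_image_sub_le_of_norm_hasDerivWithin_le
        (f := fun τ => f y τ - τ • k y t₀) (f' := fun τ => k y τ - k y t₀) ?_ ?_ hmem₀
        ⟨htδ, htS.1⟩
      · intro τ hτ
        have h₄ := (hasDerivWithinAt_id τ (Metric.ball t₀ δ ∩ S)).smul_const (k y t₀)
        exact (((hf y hy.2 τ hτ.2).mono inter_subset_right).sub h₄).congr_deriv (by rw [one_smul])
      · intro τ hτ
        have h₅ : dist (k y τ) (k z t₀) < ε / 4 := hAB (a := (y, τ)) ⟨hy.1, hδB hτ⟩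
        have h₆ : dist (k y t₀) (k z t₀) < ε / 4 := hAB (a := (y, t₀)) ⟨hy.1, hδB hmem₀⟩
        rw [← dist_eq_norm]
        linarith [dist_triangle_right (k y τ) (k y t₀) (k z t₀)]
    have heq : slope (f y) t₀ t - k y t₀
        = (t - t₀)⁻¹ • ((f y t - t • k y t₀) - (f y t₀ - t₀ • k y t₀)) := by
      have h₇ : (f y t - t • k y t₀) - (f y t₀ - t₀ • k y t₀)
          = (f y t - f y t₀) - (t - t₀) • k y t₀ := by
        rw [sub_smul]; ring
      rw [h₇, smul_sub, inv_smul_smul₀ hne, slope, vsub_eq_sub]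
    rw [dist_comm, dist_eq_norm, heq, norm_smul, norm_inv]
    have hpos : 0 < ‖t - t₀‖ := norm_pos_iff.2 hne
    calc ‖t - t₀‖⁻¹ * _ ≤ ‖t - t₀‖⁻¹ * (ε / 2 * ‖t - t₀‖) := by gcongr
      _ = ε / 2 := by field_simp
      _ < ε := half_lt_self hε
  have hS_ev : ∀ᶠ t in 𝓝[S \ {t₀}] t₀, t ∈ S :=
    eventually_mem_nhdsWithin.mono fun _ ht => ht.1
  have hlim' := (hlim.deriv (hS_ev.mono fun t ht z hz =>
    (hquot t ht z hz).differentiableAt.differentiableWithinAt) hU).tendsto_at hz₀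
  rw [(hk' t₀ ht₀ z₀ hz₀).deriv] at hlim'
  rw [hasDerivWithinAt_iff_tendsto_slope]
  exact hlim'.congr' (hS_ev.mono fun t ht => (hquot t ht z₀ hz₀).deriv)

/-- Solution formula for the scalar linear equation `y' = -y g` on `[0, s]`. -/
theorem eq_mul_exp_neg_integral {s : ℝ} (hs : 0 ≤ s) {y g : ℝ → ℂ} (hg : ContinuousOn g (Icc 0 s))
    (hy : ∀ t ∈ Icc 0 s, HasDerivWithinAt y (-(y t * g t)) (Icc 0 s) t) :
    y s = y 0 * exp (-∫ t in (0 : ℝ)..s, g t) := by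
  set G : ℝ → ℂ := IccExtend hs (domRestrict (Icc 0 s) g)
  have hG : Continuous G := (continuousOn_iff_continuous_domRestrict.1 hg).Icc_extend'
  have hGg : ∀ t ∈ Icc 0 s, G t = g t := fun t ht => IccExtend_of_mem hs _ ht
  have hI : ∫ t in (0 : ℝ)..s, g t = ∫ t in (0 : ℝ)..s, G t :=
    intervalIntegral.integral_congr fun t ht => (hGg t (by rwa [uIcc_of_le hs] at ht)).symm
  have hderiv : ∀ t ∈ Icc 0 s,
      HasDerivWithinAt (fun u => y u * exp (∫ τ in (0 : ℝ)..u, G τ)) 0 (Icc 0 s) t := by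
    intro t ht
    have h₁ := ((hG.integral_hasStrictDerivAt 0 t).hasDerivAt.cexp).hasDerivWithinAt (s := Icc 0 s)
    refine ((hy t ht).mul h₁).congr_deriv ?_
    rw [hGg t ht]
    ring
  have hconst := (convex_Icc 0 s).norm_image_sub_le_of_norm_hasDerivWithin_le (C := 0) hderiv
    (fun _ _ => by simp) (left_mem_Icc.2 hs) (right_mem_Icc.2 hs)
  rw [zero_mul, norm_le_zero_iff, sub_eq_zero] at hconst
  simp only [intervalIntegral.integral_same, exp_zero, mul_one] at hconst
  rw [hI, exp_neg, ← hconst, mul_inv_cancel_right₀ (exp_ne_zero _)]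

/-- Two continuous logarithms of the same function on a preconnected set which agree at a point
agree everywhere. -/
theorem eqOn_of_exp_eq {X : Type*} [TopologicalSpace X] {U : Set X} (hU : IsPreconnected U)
    {f g : X → ℂ} (hf : ContinuousOn f U) (hg : ContinuousOn g U)
    (hexp : ∀ x ∈ U, exp (f x) = exp (g x)) {x₀ : X} (hx₀ : x₀ ∈ U) (h₀ : f x₀ = g x₀) :
    EqOn f g U := by
  intro x hx
  have hT : IsDiscrete (AddSubgroup.zmultiples (2 * Real.pi) : Set ℝ) :=
    SetLike.isDiscrete_iff_discreteTopology.2 inferInstance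
  have hdiff : ∀ y ∈ U, ∃ n : ℤ, f y = g y + n * (2 * Real.pi * I) := fun y hy =>
    exp_eq_exp_iff_exists_int.1 (hexp y hy)
  have hmaps : MapsTo (fun y => (f y - g y).im) U (AddSubgroup.zmultiples (2 * Real.pi)) := by
    intro y hy
    obtain ⟨n, hn⟩ := hdiff y hy
    exact ⟨n, by simp [hn]⟩
  have him := hU.constant_of_mapsTo hT
    (continuous_im.comp_continuousOn (hf.sub hg)) hmaps hx hx₀
  obtain ⟨n, hn⟩ := hdiff x hx
  apply Complex.ext
  · simp [hn]
  · simpa [h₀, sub_eq_zero] using him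

end

/- STATEMENT 6: For the time-reversed flow `h(ζ,t)` (solving
`dh/dt = -h·p(h,s-t)`, `h(ζ,0) = ζ`) whose value at time `s` is
`f(ζ,s) = h(ζ,s)`, the continuous branch of `arg(ζ·f'(ζ,s)/f(ζ,s))`
vanishing at ζ = 0 satisfies
`arg(ζ·f'(ζ,s)/f(ζ,s)) = -Im ∫₀ˢ h(ζ,t)·p'(h(ζ,t), s-t) dt`. -/
theorem loewner_kufarev_arg_identity
    (T : ℝ) (hT : 0 < T) (p p' : ℂ → ℝ → ℂ)
    -- Carathéodory class driving function
    (hp_hol : ∀ t ∈ Set.Ico (0:ℝ) T,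
      DifferentiableOn ℂ (fun z => p z t) (Metric.ball (0:ℂ) 1))
    (hp_cont : ∀ t ∈ Set.Ico (0:ℝ) T,
      ContinuousOn (fun z => p z t) (Metric.closedBall (0:ℂ) 1))
    (hp_one : ∀ t ∈ Set.Ico (0:ℝ) T, p 0 t = 1)
    (hp_re : ∀ t ∈ Set.Ico (0:ℝ) T, ∀ z ∈ Metric.ball (0:ℂ) 1, 0 < (p z t).re)
    -- p(·,t) is C¹ on 𝔻̄, continuous in t, with p, p' bounded on 𝔻̄ × [0,T)
    (hp' : ∀ t ∈ Set.Ico (0:ℝ) T, ∀ z ∈ Metric.ball (0:ℂ) 1,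
      HasDerivAt (fun x => p x t) (p' z t) z)
    (hp'_cont : ∀ t ∈ Set.Ico (0:ℝ) T,
      ContinuousOn (fun z => p' z t) (Metric.closedBall (0:ℂ) 1))
    (hp_t : ∀ z ∈ Metric.closedBall (0:ℂ) 1, ContinuousOn (fun t => p z t) (Set.Ico 0 T))
    (M M' : ℝ)
    (hp_bdd : ∀ z ∈ Metric.closedBall (0:ℂ) 1, ∀ t ∈ Set.Ico (0:ℝ) T, ‖p z t‖ ≤ M)
    (hp'_bdd : ∀ z ∈ Metric.closedBall (0:ℂ) 1, ∀ t ∈ Set.Ico (0:ℝ) T, ‖p' z t‖ ≤ M')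
    -- fixed time s and the time-reversed flow h, holomorphic in ζ with
    -- spatial derivative hd; f(ζ,s) = h(ζ,s), f'(ζ,s) = hd(ζ,s)
    (s : ℝ) (hs : s ∈ Set.Ico (0:ℝ) T)
    (h hd : ℂ → ℝ → ℂ)
    (hh_init : ∀ ζ ∈ Metric.ball (0:ℂ) 1, h ζ 0 = ζ)
    (hh_mem : ∀ ζ ∈ Metric.ball (0:ℂ) 1, ∀ t ∈ Set.Icc (0:ℝ) s,
      h ζ t ∈ Metric.ball (0:ℂ) 1)
    (hh_ode : ∀ ζ ∈ Metric.ball (0:ℂ) 1, ∀ t ∈ Set.Icc (0:ℝ) s,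
      HasDerivWithinAt (h ζ) (-(h ζ t * p (h ζ t) (s - t))) (Set.Icc 0 s) t)
    (hhd : ∀ t ∈ Set.Icc (0:ℝ) s, ∀ ζ ∈ Metric.ball (0:ℂ) 1,
      HasDerivAt (fun x => h x t) (hd ζ t) ζ)
    -- L is the continuous branch of log(ζ·f'(ζ,s)/f(ζ,s)) with L(0) = 0,
    -- whose imaginary part is the continuous branch of arg vanishing at 0
    (L : ℂ → ℂ)
    (hL_cont : ContinuousOn L (Metric.ball (0:ℂ) 1))
    (hL_zero : L 0 = 0)
    (hL_exp : ∀ ζ ∈ Metric.ball (0:ℂ) 1, ζ ≠ 0 →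
      Complex.exp (L ζ) = ζ * hd ζ s / h ζ s) :
    ∀ ζ ∈ Metric.ball (0:ℂ) 1,
      (L ζ).im = -(∫ t in (0:ℝ)..s, h ζ t * p' (h ζ t) (s - t)).im := by
  have hs0 : (0 : ℝ) ≤ s := hs.1
  set U : Set ℂ := Metric.ball (0 : ℂ) 1 with hUdef
  set S : Set ℝ := Set.Icc (0 : ℝ) s with hSdef
  have hU : IsOpen U := Metric.isOpen_ball
  have h0U : (0 : ℂ) ∈ U := Metric.mem_ball_self one_pos
  have hUc : U ⊆ Metric.closedBall (0 : ℂ) 1 := Metric.ball_subset_closedBall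
  have hrev : ∀ t ∈ S, s - t ∈ Set.Ico (0 : ℝ) T := fun t ht =>
    ⟨sub_nonneg.2 ht.2, by linarith [ht.1, hs.2]⟩
  have hp_joint : ContinuousOn (Function.uncurry p) (U ×ˢ Set.Ico (0 : ℝ) T) := by
    refine continuousOn_prod_of_continuousOn_lipschitzOnWith _ M'.toNNReal
      (fun z hz => hp_t z (hUc hz)) fun t ht => ?_
    refine (convex_ball (0 : ℂ) 1).lipschitzOnWith_of_nnnorm_hasDerivWithin_le
      (f' := fun z => p' z t) (fun z hz => (hp' t ht z hz).hasDerivWithinAt) fun z hz => ?_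
    exact NNReal.le_toNNReal_of_coe_le (hp'_bdd z (hUc hz) t ht)
  have hp'_joint : ContinuousOn (Function.uncurry p') (U ×ˢ Set.Ico (0 : ℝ) T) :=
    continuousOn_uncurry_of_hasDerivAt hU hp_joint hp'
  have hh_joint : ContinuousOn (Function.uncurry h) (U ×ˢ S) := by
    refine continuousOn_prod_of_continuousOn_lipschitzOnWith' _ M.toNNReal
      (fun ζ hζ => ?_) fun t ht ζ hζ => (hhd t ht ζ hζ).continuousAt.continuousWithinAt
    refine (convex_Icc 0 s).lipschitzOnWith_of_nnnorm_hasDerivWithin_le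
      (fun t ht => hh_ode ζ hζ t ht) fun t ht => NNReal.le_toNNReal_of_coe_le ?_
    have h₁ : ‖h ζ t‖ ≤ 1 := mem_closedBall_zero_iff.1 (hUc (hh_mem ζ hζ t ht))
    have h₂ := hp_bdd _ (hUc (hh_mem ζ hζ t ht)) _ (hrev t ht)
    rw [coe_nnnorm, norm_neg, norm_mul]
    nlinarith [norm_nonneg (p (h ζ t) (s - t))]
  have hpair : ContinuousOn (fun y : ℂ × ℝ => (h y.1 y.2, s - y.2)) (U ×ˢ S) :=
    hh_joint.prodMk (by fun_prop)
  have hpair_maps : Set.MapsTo (fun y : ℂ × ℝ => (h y.1 y.2, s - y.2)) (U ×ˢ S)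
      (U ×ˢ Set.Ico (0 : ℝ) T) := fun y hy => ⟨hh_mem _ hy.1 _ hy.2, hrev _ hy.2⟩
  have hpc : ContinuousOn (fun y : ℂ × ℝ => p (h y.1 y.2) (s - y.2)) (U ×ˢ S) :=
    hp_joint.comp hpair hpair_maps
  have hqc : ContinuousOn (fun y : ℂ × ℝ => h y.1 y.2 * p' (h y.1 y.2) (s - y.2)) (U ×ˢ S) :=
    hh_joint.mul (hp'_joint.comp hpair hpair_maps)
  have hsec : ∀ ζ ∈ U, Set.MapsTo (fun t : ℝ => (ζ, t)) S (U ×ˢ S) := fun ζ hζ t ht => ⟨hζ, ht⟩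
  have hpc_t : ∀ ζ ∈ U, ContinuousOn (fun t => p (h ζ t) (s - t)) S := fun ζ hζ =>
    hpc.comp (by fun_prop) (hsec ζ hζ)
  have hqc_t : ∀ ζ ∈ U, ContinuousOn (fun t => h ζ t * p' (h ζ t) (s - t)) S := fun ζ hζ =>
    hqc.comp (by fun_prop) (hsec ζ hζ)
  have hhd_ode : ∀ ζ ∈ U, ∀ t ∈ S, HasDerivWithinAt (hd ζ)
      (-(hd ζ t * (p (h ζ t) (s - t) + h ζ t * p' (h ζ t) (s - t)))) S t := by
    intro ζ hζ t ht
    refine hasDerivWithinAt_of_hasDerivAt_comm hU (convex_Icc 0 s)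
      (k' := fun ζ t => -(hd ζ t * (p (h ζ t) (s - t) + h ζ t * p' (h ζ t) (s - t))))
      hh_ode (hh_joint.mul hpc).neg hhd (fun τ hτ z hz => ?_) hζ ht
    have h₁ := (hp' _ (hrev τ hτ) _ (hh_mem z hz τ hτ)).comp z (hhd τ hτ z hz)
    refine ((hhd τ hτ z hz).mul h₁).neg.congr_deriv ?_
    simp only [Function.comp_apply]
    ring
  have hh_eq : ∀ ζ ∈ U, h ζ s = ζ * Complex.exp (-∫ t in (0 : ℝ)..s, p (h ζ t) (s - t)) :=
    fun ζ hζ => by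
      rw [eq_mul_exp_neg_integral hs0 (hpc_t ζ hζ) (hh_ode ζ hζ), hh_init ζ hζ]
  have hhd_init : ∀ ζ ∈ U, hd ζ 0 = 1 := fun ζ hζ =>
    (hhd 0 (Set.left_mem_Icc.2 hs0) ζ hζ).unique <| (hasDerivAt_id ζ).congr_of_eventuallyEq <|
      Filter.eventuallyEq_of_mem (hU.mem_nhds hζ) hh_init
  have hintegrable : ∀ {g : ℝ → ℂ}, ContinuousOn g S → IntervalIntegrable g MeasureTheory.volume 0 s :=
    fun hg => hg.intervalIntegrable_of_Icc hs0
  have hhd_eq : ∀ ζ ∈ U, hd ζ s = Complex.exp (-((∫ t in (0 : ℝ)..s, p (h ζ t) (s - t))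
      + ∫ t in (0 : ℝ)..s, h ζ t * p' (h ζ t) (s - t))) := fun ζ hζ => by
    rw [eq_mul_exp_neg_integral hs0 ((hpc_t ζ hζ).add (hqc_t ζ hζ)) (hhd_ode ζ hζ),
      hhd_init ζ hζ, one_mul]
    simp only [Pi.add_apply]
    rw [intervalIntegral.integral_add (hintegrable (hpc_t ζ hζ)) (hintegrable (hqc_t ζ hζ))]
  have hh_zero : ∀ t ∈ S, h 0 t = 0 := fun t ht => by
    have hsub : Set.Icc 0 t ⊆ S := Set.Icc_subset_Icc_right ht.2
    rw [eq_mul_exp_neg_integral ht.1 ((hpc_t 0 h0U).mono hsub)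
      (fun τ hτ => (hh_ode 0 h0U τ (hsub hτ)).mono hsub), hh_init 0 h0U, zero_mul]
  set J : ℂ → ℂ := fun ζ => -∫ t in (0 : ℝ)..s, h ζ t * p' (h ζ t) (s - t) with hJ
  have hJ_zero : J 0 = 0 := by
    have h₁ : ∫ t in (0 : ℝ)..s, h 0 t * p' (h 0 t) (s - t) = ∫ _ in (0 : ℝ)..s, (0 : ℂ) := by
      refine intervalIntegral.integral_congr fun t ht => ?_
      rw [Set.uIcc_of_le hs0] at ht
      simp [hh_zero t ht]
    simp [hJ, h₁]
  have hsub : Set.uIoc 0 s ⊆ S := by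
    rw [Set.uIoc_of_le hs0]
    exact Set.Ioc_subset_Icc_self
  have hJ_cont : ContinuousOn J U := by
    intro ζ₀ hζ₀
    refine (intervalIntegral.continuousWithinAt_of_dominated_interval (bound := fun _ => M')
      ?_ ?_ intervalIntegrable_const ?_).neg
    · filter_upwards [self_mem_nhdsWithin] with ζ hζ
      exact ((hqc_t ζ hζ).mono hsub).aestronglyMeasurable measurableSet_uIoc
    · filter_upwards [self_mem_nhdsWithin] with ζ hζ
      refine Filter.Eventually.of_forall fun t ht => ?_
      have h₀ := hh_mem ζ hζ t (hsub ht)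
      have h₁ : ‖h ζ t‖ ≤ 1 := mem_closedBall_zero_iff.1 (hUc h₀)
      have h₂ := hp'_bdd _ (hUc h₀) _ (hrev t (hsub ht))
      rw [norm_mul]
      nlinarith [norm_nonneg (p' (h ζ t) (s - t))]
    · refine Filter.Eventually.of_forall fun t ht => ?_
      exact (hqc.comp (f := fun ζ : ℂ => (ζ, t)) (s := U) (by fun_prop)
        fun ζ hζ => ⟨hζ, hsub ht⟩) ζ₀ hζ₀
  have hLJ : Set.EqOn L J U := by
    refine eqOn_of_exp_eq (convex_ball (0 : ℂ) 1).isPreconnected hL_cont hJ_cont (fun ζ hζ => ?_)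
      h0U (hL_zero.trans hJ_zero.symm)
    rcases eq_or_ne ζ 0 with rfl | hne
    · rw [hL_zero, hJ_zero]
    · rw [hL_exp ζ hζ hne, hh_eq ζ hζ, hhd_eq ζ hζ, neg_add, Complex.exp_add,
        mul_div_mul_left _ _ hne, mul_div_cancel_left₀ _ (Complex.exp_ne_zero _)]
  intro ζ hζ
  rw [hLJ hζ, hJ, Complex.neg_im]
end

section
/- (Lemma 3, quantitative form) Let p be a driving function from the Carathéodory class, C¹ on 𝔻̄ for each t, continuous in t, with p and p' = ∂p/∂z bounded on 𝔻̄ × [0,T), and let M' = sup |p'| on 𝔻̄ × [0,T). Let f(z,t) solve the Löwner–Kufarev PDE ∂f/∂t = -z·(∂f/∂z)·p(z,t), f(z,0) = z, each f(·,t) univalent on 𝔻. Then for every t ∈ [0,T) and every z ∈ 𝔻, |arg(z·f'(z,t)/f(z,t))| ≤ M'·t, where f' = ∂f/∂z and arg denotes the continuous branch vanishing at z = 0. In particular, for 0 < t < π/(2M') one has Re(z f'(z,t)/f(z,t)) > 0 on 𝔻. -/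
open Set Metric Filter Topology

/-- A family of holomorphic functions on `U`, pointwise continuous in the parameter `t ∈ J` and
locally bounded on `U` uniformly in `t`. -/
structure IsLocBddHolomorphicFamily (U : Set ℂ) (J : Set ℝ) (g : ℂ → ℝ → ℂ) : Prop where
  differentiableOn : ∀ t ∈ J, DifferentiableOn ℂ (fun z => g z t) U
  continuousOn : ∀ z ∈ U, ContinuousOn (g z) J
  locallyBounded : ∀ z ∈ U, ∃ K : ℝ, ∀ᶠ w in 𝓝 z, ∀ t ∈ J, ‖g w t‖ ≤ K

namespace IsLocBddHolomorphicFamily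

variable {U : Set ℂ} {J : Set ℝ} {g : ℂ → ℝ → ℂ}

theorem exists_norm_deriv_le (h : IsLocBddHolomorphicFamily U J g) (hU : IsOpen U) {z : ℂ}
    (hz : z ∈ U) : ∃ K : ℝ, 0 ≤ K ∧ ∃ ρ > 0, ball z ρ ⊆ U ∧
      ∀ w ∈ ball z ρ, ∀ t ∈ J, ‖deriv (fun x => g x t) w‖ ≤ K := by
  obtain ⟨K, hK⟩ := h.locallyBounded z hz
  obtain ⟨ρ, hρ, hball⟩ := Metric.eventually_nhds_iff_ball.1 (hK.and (hU.eventually_mem hz))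
  refine ⟨|K| / (ρ / 3), by positivity, ρ / 3, by positivity, fun w hw => (hball w
    (ball_subset_ball (by linarith) hw)).2, fun w hw t ht => ?_⟩
  have hsub : closedBall w (ρ / 3) ⊆ ball z ρ := by
    intro x hx
    rw [mem_closedBall] at hx
    rw [mem_ball] at hw ⊢
    linarith [dist_triangle x w z]
  refine Complex.norm_deriv_le_of_forall_mem_sphere_norm_le (by positivity) ?_ fun x hx =>
    ((hball x (hsub (sphere_subset_closedBall hx))).1 t ht).trans (le_abs_self K)
  refine DifferentiableOn.diffContOnCl ((h.differentiableOn t ht).mono fun x hx => ?_)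
  rw [closure_ball _ (by positivity)] at hx
  exact (hball x (hsub hx)).2

theorem exists_lipschitzOnWith (h : IsLocBddHolomorphicFamily U J g) (hU : IsOpen U) {z : ℂ}
    (hz : z ∈ U) : ∃ K : NNReal, ∃ ρ > 0, ball z ρ ⊆ U ∧
      ∀ t ∈ J, LipschitzOnWith K (fun x => g x t) (ball z ρ) := by
  obtain ⟨K, hK0, ρ, hρ, hsub, hb⟩ := h.exists_norm_deriv_le hU hz
  refine ⟨⟨K, hK0⟩, ρ, hρ, hsub, fun t ht =>
    (convex_ball z ρ).lipschitzOnWith_of_nnnorm_deriv_le (fun x hx => ?_) fun x hx => hb x hx t ht⟩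
  exact (h.differentiableOn t ht).differentiableAt (hU.mem_nhds (hsub hx))

theorem continuousOn_uncurry (h : IsLocBddHolomorphicFamily U J g) (hU : IsOpen U) :
    ContinuousOn (fun x : ℂ × ℝ => g x.1 x.2) (U ×ˢ J) := by
  rintro ⟨z, t⟩ ⟨hz, ht⟩
  obtain ⟨K, ρ, hρ, hsub, hL⟩ := h.exists_lipschitzOnWith hU hz
  have hc := continuousOn_prod_of_continuousOn_lipschitzOnWith (fun x : ℂ × ℝ => g x.1 x.2)
    (s := ball z ρ) (t := J) K (fun a ha => h.continuousOn a (hsub ha)) hL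
  refine (hc (z, t) ⟨mem_ball_self hρ, ht⟩).mono_of_mem_nhdsWithin ?_
  rw [nhdsWithin_prod_eq]
  exact prod_mem_prod (mem_nhdsWithin_of_mem_nhds (ball_mem_nhds z hρ)) self_mem_nhdsWithin

theorem tendstoLocallyUniformlyOn (h : IsLocBddHolomorphicFamily U J g) (hU : IsOpen U) {t₀ : ℝ}
    (ht₀ : t₀ ∈ J) :
    TendstoLocallyUniformlyOn (fun t z => g z t) (fun z => g z t₀) (𝓝[J] t₀) U := by
  rw [Metric.tendstoLocallyUniformlyOn_iff]
  intro ε hε z hz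
  have hc := h.continuousOn_uncurry hU (z, t₀) ⟨hz, ht₀⟩
  have h1 := (Metric.tendsto_nhds.1 hc) (ε / 2) (by positivity)
  rw [nhdsWithin_prod_eq] at h1
  obtain ⟨pa, ha, pb, hb, hab⟩ := eventually_prod_iff.1 h1
  refine ⟨_, ha, hb.mono fun t htb w hw => ?_⟩
  have e1 := hab hw htb
  have e2 := hab hw (hb.self_of_nhdsWithin ht₀)
  simp only at e1 e2
  rw [dist_comm] at e1
  linarith [dist_triangle (g w t₀) (g z t₀) (g w t)]

theorem deriv_family (h : IsLocBddHolomorphicFamily U J g) (hU : IsOpen U) :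
    IsLocBddHolomorphicFamily U J (fun z t => deriv (fun x => g x t) z) where
  differentiableOn t ht := (h.differentiableOn t ht).deriv hU
  continuousOn z hz t₀ ht₀ :=
    ((h.tendstoLocallyUniformlyOn hU ht₀).deriv
      (eventually_nhdsWithin_of_forall h.differentiableOn) hU).tendsto_at hz
  locallyBounded z hz := by
    obtain ⟨K, -, ρ, hρ, -, hb⟩ := h.exists_norm_deriv_le hU hz
    exact ⟨K, Metric.eventually_nhds_iff_ball.2 ⟨ρ, hρ, hb⟩⟩

theorem hasDerivAt_deriv (h : IsLocBddHolomorphicFamily U J g) (hU : IsOpen U) (hJ : Convex ℝ J)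
    {γ : ℂ → ℝ → ℂ} (hγ : ∀ z ∈ U, ∀ t ∈ J, HasDerivWithinAt (g z) (γ z t) J t)
    (hγb : ∀ z ∈ U, ∃ K : ℝ, ∀ᶠ w in 𝓝 z, ∀ t ∈ J, ‖γ w t‖ ≤ K) {t₀ : ℝ} (ht₀ : J ∈ 𝓝 t₀)
    (hγd : DifferentiableOn ℂ (fun z => γ z t₀) U) {z : ℂ} (hz : z ∈ U) :
    HasDerivAt (fun t => deriv (fun x => g x t) z) (deriv (fun x => γ x t₀) z) t₀ := by
  have ht : t₀ ∈ J := mem_of_mem_nhds ht₀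
  have hat : ∀ w ∈ U, HasDerivAt (g w) (γ w t₀) t₀ := fun w hw =>
    (hγ w hw t₀ ht).hasDerivAt ht₀
  have hself : ∀ w ∈ U, dslope (g w) t₀ t₀ = γ w t₀ := fun w hw => by
    rw [dslope_same, (hat w hw).deriv]
  have hne : ∀ t, t ≠ t₀ → (fun w => dslope (g w) t₀ t) =
      fun w => ((t - t₀)⁻¹ : ℝ) • (g w t - g w t₀) := fun t htt => by
    ext w
    rw [dslope_of_ne _ htt, slope_def_module]
  have hD : IsLocBddHolomorphicFamily U J (fun w t => dslope (g w) t₀ t) := by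
    refine ⟨fun t htJ => ?_, fun w hw => ?_, fun w hw => ?_⟩
    · rcases eq_or_ne t t₀ with rfl | htt
      · exact hγd.congr hself
      · rw [hne t htt]
        exact ((h.differentiableOn t htJ).sub (h.differentiableOn t₀ ht)).const_smul
          ((t - t₀)⁻¹ : ℝ)
    · exact (continuousOn_dslope ht₀).2 ⟨h.continuousOn w hw, (hat w hw).differentiableAt⟩
    · obtain ⟨K, hK⟩ := hγb w hw
      refine ⟨K, (hK.and (hU.eventually_mem hw)).mono fun x hx t htJ => ?_⟩
      rcases eq_or_ne t t₀ with rfl | htt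
      · rw [hself x hx.2]
        exact hx.1 t htJ
      · have := hJ.norm_image_sub_le_of_norm_hasDerivWithin_le (hγ x hx.2) hx.1 ht htJ
        rw [dslope_of_ne _ htt, slope_def_module, norm_smul, norm_inv, inv_mul_le_iff₀
          (norm_pos_iff.2 (sub_ne_zero.2 htt)), mul_comm]
        exact this
  have hcont := ((hD.deriv_family hU).continuousOn z hz).continuousAt ht₀
  rw [hasDerivAt_iff_tendsto_slope]
  have h0 : deriv (fun w => dslope (g w) t₀ t₀) z = deriv (fun x => γ x t₀) z :=
    Filter.EventuallyEq.deriv_eq ((hU.eventually_mem hz).mono hself)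
  have hlim := hcont.tendsto.mono_left (nhdsWithin_le_nhds (s := {t₀}ᶜ))
  rw [h0] at hlim
  refine hlim.congr' ?_
  filter_upwards [self_mem_nhdsWithin, mem_nhdsWithin_of_mem_nhds ht₀] with t htt htJ
  have hd : ∀ s ∈ J, DifferentiableAt ℂ (fun x => g x s) z := fun s hs =>
    (h.differentiableOn s hs).differentiableAt (hU.mem_nhds hz)
  rw [hne t htt, slope_def_module]
  exact (((hd t htJ).hasDerivAt.sub (hd t₀ ht).hasDerivAt).const_smul ((t - t₀)⁻¹ : ℝ)).deriv

end IsLocBddHolomorphicFamily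

theorem exists_log_of_ne_zero_on_ball {h : ℂ → ℂ} {R : ℝ} (hR : 0 < R)
    (hd : DifferentiableOn ℂ h (ball 0 R)) (h0 : ∀ z ∈ ball (0 : ℂ) R, h z ≠ 0) :
    ∃ k : ℂ → ℂ, DifferentiableOn ℂ k (ball 0 R) ∧ k 0 = 0 ∧
      ∀ z ∈ ball (0 : ℂ) R, h z = h 0 * Complex.exp (k z) := by
  have hmem : (0 : ℂ) ∈ ball (0 : ℂ) R := mem_ball_self hR
  obtain ⟨k, hk⟩ := ((hd.deriv isOpen_ball).div hd h0).isExactOn_ball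
  have hderiv : ∀ z ∈ ball (0 : ℂ) R,
      HasDerivAt (fun z => h z * Complex.exp (-(k z - k 0))) 0 z := fun z hz => by
    have h1 := (hd.differentiableAt (isOpen_ball.mem_nhds hz)).hasDerivAt
    have h2 := (((hk z hz).sub_const (k 0)).neg).cexp
    refine (h1.mul h2).congr_deriv ?_
    simp only [Pi.div_apply]
    field_simp [h0 z hz]
    ring
  refine ⟨fun z => k z - k 0, fun z hz =>
    ((hk z hz).sub_const (k 0)).differentiableAt.differentiableWithinAt, sub_self _, fun z hz => ?_⟩
  have hc := isOpen_ball.is_const_of_deriv_eq_zero (convex_ball (0 : ℂ) R).isPreconnected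
    (fun x hx => (hderiv x hx).differentiableAt.differentiableWithinAt)
    (fun x hx => (hderiv x hx).deriv) hz hmem
  simp only [sub_self, neg_zero, Complex.exp_zero, mul_one] at hc
  rw [← hc, mul_assoc, ← Complex.exp_add, neg_add_cancel, Complex.exp_zero, mul_one]

/-- Lower bound for a bounded holomorphic function without zeros on the unit disk. -/
theorem le_norm_of_ne_zero_of_norm_le {h : ℂ → ℂ} {c C r : ℝ} (hc : 0 < c)
    (hd : DifferentiableOn ℂ h (ball 0 1)) (h0 : ∀ z ∈ ball (0 : ℂ) 1, h z ≠ 0)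
    (hC : ∀ z ∈ ball (0 : ℂ) 1, ‖h z‖ ≤ C) (hch : c ≤ ‖h 0‖) {z : ℂ} (hr : r < 1)
    (hz : ‖z‖ ≤ r) :
    c * Real.exp (-(2 * (Real.log (C / c) + 1) * r / (1 - r))) ≤ ‖h z‖ := by
  have hmem : (0 : ℂ) ∈ ball (0 : ℂ) 1 := mem_ball_self one_pos
  have hz1 : z ∈ ball (0 : ℂ) 1 := mem_ball_zero_iff.2 (hz.trans_lt hr)
  have hcC : c ≤ C := hch.trans (hC 0 hmem)
  have hlog : 0 ≤ Real.log (C / c) := Real.log_nonneg ((one_le_div hc).2 hcC)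
  obtain ⟨k, hkd, hk0, hk⟩ := exists_log_of_ne_zero_on_ball one_pos hd h0
  have hre : MapsTo k (ball 0 1) {z | z.re ≤ Real.log (C / c) + 1} := fun w hw => by
    have h1 := hC w hw
    rw [hk w hw, norm_mul, Complex.norm_exp] at h1
    have h2 : Real.exp (k w).re ≤ C / c := by
      rw [le_div_iff₀ hc, mul_comm]
      exact (mul_le_mul_of_nonneg_right hch (Real.exp_pos _).le).trans h1
    have h3 := Real.log_le_log (Real.exp_pos _) h2
    rw [Real.log_exp] at h3
    exact h3.trans (by linarith)
  have hb := Complex.borelCaratheodory_zero (by linarith) hkd hre one_pos hz1 hk0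
  have hb2 : 2 * (Real.log (C / c) + 1) * ‖z‖ / (1 - ‖z‖) ≤
      2 * (Real.log (C / c) + 1) * r / (1 - r) := by
    gcongr
    exact mul_nonneg (by linarith) ((norm_nonneg z).trans hz)
  rw [hk z hz1, norm_mul, Complex.norm_exp]
  gcongr
  linarith [(abs_le.1 (Complex.abs_re_le_norm (k z))).1]

/-- Osgood's theorem: a pointwise bounded family of continuous functions is uniformly bounded near
some point of any given nonempty open set. -/
theorem exists_eventually_norm_le_of_pointwise_bounded {ι : Type*} {J : Set ι} {g : ℂ → ι → ℂ}
    {V W : Set ℂ} (hV : IsOpen V) (hVne : V.Nonempty) (hVW : closure V ⊆ W)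
    (hc : ∀ t ∈ J, ContinuousOn (fun z => g z t) W)
    (hb : ∀ z ∈ W, ∃ K : ℝ, ∀ t ∈ J, ‖g z t‖ ≤ K) :
    ∃ z ∈ V, ∃ K : ℝ, ∀ᶠ w in 𝓝 z, ∀ t ∈ J, ‖g w t‖ ≤ K := by
  let A : ℕ → Set ℂ := fun n => {z ∈ closure V | ∀ t ∈ J, ‖g z t‖ ≤ n} ∪ Vᶜ
  have hA : ∀ n, IsClosed (A n) := fun n => by
    refine IsClosed.union ?_ hV.isClosed_compl
    have : {z ∈ closure V | ∀ t ∈ J, ‖g z t‖ ≤ n} =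
        closure V ∩ ⋂ t ∈ J, (closure V ∩ (fun z => ‖g z t‖) ⁻¹' Iic (n : ℝ)) := by
      ext z
      simp only [mem_ofPred_eq, mem_inter_iff, mem_iInter, mem_preimage, mem_Iic]
      exact ⟨fun h => ⟨h.1, fun t ht => ⟨h.1, h.2 t ht⟩⟩, fun h => ⟨h.1, fun t ht => (h.2 t ht).2⟩⟩
    rw [this]
    exact isClosed_closure.inter (isClosed_biInter fun t ht =>
      ((hc t ht).mono hVW).norm.preimage_isClosed_of_isClosed isClosed_closure isClosed_Iic)
  have hU : ⋃ n, A n = univ := by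
    refine eq_univ_of_forall fun z => mem_iUnion.2 ?_
    by_cases hz : z ∈ V
    · obtain ⟨K, hK⟩ := hb z (hVW (subset_closure hz))
      obtain ⟨n, hn⟩ := exists_nat_ge K
      exact ⟨n, Or.inl ⟨subset_closure hz, fun t ht => (hK t ht).trans hn⟩⟩
    · exact ⟨0, Or.inr hz⟩
  obtain ⟨z, hz, hzV⟩ := (dense_iUnion_interior_of_closed hA hU).exists_mem_open hV hVne
  obtain ⟨n, hn⟩ := mem_iUnion.1 hz
  refine ⟨z, hzV, n, ?_⟩
  filter_upwards [isOpen_interior.mem_nhds hn, hV.mem_nhds hzV] with w hw hwV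
  exact (interior_subset hw).elim (fun h => h.2) fun h => absurd hwV h

/-- If an injective holomorphic function moves the circle of radius `ρ` around `z₀` away from its
value at `z₀`, then it does so for all points outside that circle. -/
theorem le_norm_sub_of_injOn {f : ℂ → ℂ} {U : Set ℂ} (hd : DifferentiableOn ℂ f U)
    (hinj : InjOn f U) {z₀ : ℂ} {ρ δ : ℝ} (hρ : 0 < ρ) (hsub : closedBall z₀ ρ ⊆ U)
    (hδ : ∀ z ∈ sphere z₀ ρ, δ ≤ ‖f z - f z₀‖) {z : ℂ} (hz : z ∈ U) (hzb : z ∉ closedBall z₀ ρ) :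
    δ / 2 ≤ ‖f z - f z₀‖ := by
  by_contra! hlt
  have hdc : DiffContOnCl ℂ f (ball z₀ ρ) :=
    DifferentiableOn.diffContOnCl (by rw [closure_ball _ hρ.ne']; exact hd.mono hsub)
  have hz₀ : z₀ ∈ U := hsub (mem_closedBall_self hρ.le)
  have hfreq : ∃ᶠ w in 𝓝 z₀, f w ≠ f z₀ := by
    have h1 : ∀ᶠ w in 𝓝[≠] z₀, f w ≠ f z₀ := by
      filter_upwards [self_mem_nhdsWithin,
        mem_nhdsWithin_of_mem_nhds (closedBall_mem_nhds z₀ hρ)] with w hw hwb heq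
      exact hw (hinj (hsub hwb) hz₀ heq)
    exact h1.frequently.filter_mono nhdsWithin_le_nhds
  obtain ⟨w, hw, hwz⟩ := hdc.ball_subset_image_closedBall hρ hδ hfreq
    (mem_ball_iff_norm.2 hlt)
  exact hzb (hinj (hsub hw) hz hwz ▸ hw)

/-- A family of injective holomorphic functions on the unit disk depending continuously on a
compact parameter for each fixed point is locally uniformly bounded. -/
theorem isLocBddHolomorphicFamily_of_injOn {g : ℂ → ℝ → ℂ} {J : Set ℝ} (hJ : IsCompact J)
    (hd : ∀ t ∈ J, DifferentiableOn ℂ (fun z => g z t) (ball 0 1))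
    (hinj : ∀ t ∈ J, InjOn (fun z => g z t) (ball 0 1))
    (hderiv : ∀ t ∈ J, ∀ z ∈ ball (0 : ℂ) 1, z ≠ 0 → deriv (fun x => g x t) z ≠ 0)
    (hc : ∀ z ∈ ball (0 : ℂ) 1, ContinuousOn (g z) J) :
    IsLocBddHolomorphicFamily (ball 0 1) J g := by
  have hmem : (0 : ℂ) ∈ ball (0 : ℂ) 1 := mem_ball_self one_pos
  obtain ⟨z₀, ⟨hz₀, hz₀ne⟩, K, hK⟩ := exists_eventually_norm_le_of_pointwise_bounded
    (g := g) (J := J) (V := ball 0 (1 / 2) \ {0}) (W := ball 0 1)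
    (isOpen_ball.sdiff isClosed_singleton)
    ⟨((1 / 4 : ℝ) : ℂ), by rw [mem_ball_zero_iff, Complex.norm_real]; norm_num, by simp⟩
    ((closure_mono sdiff_subset).trans (closure_ball_subset_closedBall.trans
      (closedBall_subset_ball (by norm_num))))
    (fun t ht => (hd t ht).continuousOn)
    (fun z hz => hJ.exists_bound_of_continuousOn (hc z hz))
  have hz₀1 : z₀ ∈ ball (0 : ℂ) 1 := ball_subset_ball (by norm_num) hz₀
  obtain ⟨ρ₁, hρ₁, hball⟩ := Metric.eventually_nhds_iff_ball.1
    (hK.and (isOpen_ball.eventually_mem hz₀))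
  have hfam : IsLocBddHolomorphicFamily (ball z₀ ρ₁) J g := by
    have hsub : ball z₀ ρ₁ ⊆ ball (0 : ℂ) 1 := fun w hw =>
      ball_subset_ball (by norm_num) (hball w hw).2
    refine ⟨fun t ht => (hd t ht).mono hsub, fun z hz => hc z (hsub hz), fun z hz => ⟨K, ?_⟩⟩
    filter_upwards [isOpen_ball.mem_nhds hz] with w hw using (hball w hw).1
  set ρ := ρ₁ / 2 with hρdef
  have hρ : 0 < ρ := by positivity
  have hsubρ : closedBall z₀ ρ ⊆ ball z₀ ρ₁ := closedBall_subset_ball (by linarith)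
  have hsub2 : closedBall z₀ ρ ⊆ ball (0 : ℂ) (1 / 2) := fun w hw => (hball w (hsubρ hw)).2
  have hsub1 : closedBall z₀ ρ ⊆ ball (0 : ℂ) 1 := hsub2.trans (ball_subset_ball (by norm_num))
  obtain ⟨δ, hδ, hδle⟩ : ∃ δ : ℝ, 0 < δ ∧ ∀ x ∈ sphere z₀ ρ ×ˢ J,
      δ ≤ ‖g x.1 x.2 - g z₀ x.2‖ := by
    refine ((isCompact_sphere z₀ ρ).prod hJ).exists_forall_le' ?_ fun x hx => ?_
    · refine (ContinuousOn.sub ?_ ?_).norm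
      · exact (hfam.continuousOn_uncurry isOpen_ball).mono
          (prod_mono (sphere_subset_closedBall.trans hsubρ) Subset.rfl)
      · exact (hc z₀ hz₀1).comp continuousOn_snd fun x hx => hx.2
    · refine norm_pos_iff.2 (sub_ne_zero.2 fun heq => ?_)
      have := hinj x.2 hx.2 (hsub1 (sphere_subset_closedBall hx.1)) hz₀1 heq
      exact hρ.ne' (by rw [← mem_sphere.1 hx.1, this, dist_self])
  obtain ⟨D, hD⟩ := hJ.exists_bound_of_continuousOn ((hc 0 hmem).sub (hc z₀ hz₀1))
  obtain ⟨K₀, hK₀⟩ := hJ.exists_bound_of_continuousOn (hc z₀ hz₀1)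
  have hs_ne : ∀ t ∈ J, ∀ z ∈ ball (0 : ℂ) 1, dslope (fun x => g x t) z₀ z ≠ 0 :=
    fun t ht z hz => by
      rcases eq_or_ne z z₀ with rfl | hne
      · rw [dslope_same]
        exact hderiv t ht z hz hz₀ne
      · rw [dslope_of_ne _ hne, slope_def_field]
        exact div_ne_zero (sub_ne_zero.2 fun heq => hne (hinj t ht hz hz₀1 heq))
          (sub_ne_zero.2 hne)
  have hs_diff : ∀ t ∈ J, DifferentiableOn ℂ (fun z => (dslope (fun x => g x t) z₀ z)⁻¹)
      (ball 0 1) := fun t ht =>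
    ((Complex.differentiableOn_dslope (isOpen_ball.mem_nhds hz₀1)).2 (hd t ht)).inv (hs_ne t ht)
  have hs_le : ∀ t ∈ J, ∀ z ∈ ball (0 : ℂ) 1,
      ‖(dslope (fun x => g x t) z₀ z)⁻¹‖ ≤ 2 / (δ / 2) := fun t ht z hz => by
    obtain ⟨R, hR, hR1⟩ := exists_between (max_lt (mem_ball_zero_iff.1 hz)
      (by norm_num : (1 / 2 : ℝ) < 1))
    obtain ⟨hzR, hR2⟩ := max_lt_iff.1 hR
    have hRpos : 0 < R := by linarith
    have hcl : closure (ball (0 : ℂ) R) ⊆ ball 0 1 := by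
      rw [closure_ball _ hRpos.ne']
      exact closedBall_subset_ball hR1
    refine Complex.norm_le_of_forall_mem_frontier_norm_le (U := ball 0 R) isBounded_ball
      ((hs_diff t ht).mono hcl).diffContOnCl (fun w hw => ?_)
      (subset_closure (mem_ball_zero_iff.2 hzR))
    rw [frontier_ball _ hRpos.ne', mem_sphere_zero_iff_norm] at hw
    have hw1 : w ∈ ball (0 : ℂ) 1 := mem_ball_zero_iff.2 (hw.trans_lt hR1)
    have hwb : w ∉ closedBall z₀ ρ := fun h => by
      have := mem_ball_zero_iff.1 (hsub2 h)
      linarith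
    have hne : w ≠ z₀ := fun h => hwb (h ▸ mem_closedBall_self hρ.le)
    have hlow := le_norm_sub_of_injOn (hd t ht) (hinj t ht) hρ hsub1
      (fun x hx => hδle (x, t) ⟨hx, ht⟩) hw1 hwb
    rw [dslope_of_ne _ hne, slope_def_field, inv_div, norm_div]
    have : ‖w - z₀‖ ≤ 2 := by
      linarith [norm_sub_le w z₀, mem_ball_zero_iff.1 hz₀1]
    gcongr
  have hD' : 0 < |D| + 1 := by positivity
  have hcpos : 0 < ‖z₀‖ / (|D| + 1) := div_pos (norm_pos_iff.2 hz₀ne) hD'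
  have hs_zero : ∀ t ∈ J, ‖z₀‖ / (|D| + 1) ≤ ‖(dslope (fun x => g x t) z₀ 0)⁻¹‖ :=
    fun t ht => by
      have hne : (0 : ℂ) ≠ z₀ := fun h => hz₀ne h.symm
      have h2 : 0 < ‖g 0 t - g z₀ t‖ :=
        norm_pos_iff.2 (sub_ne_zero.2 fun heq => hne (hinj t ht hmem hz₀1 heq))
      rw [dslope_of_ne _ hne, slope_def_field, inv_div, norm_div, zero_sub, norm_neg]
      gcongr
      exact ((hD t ht).trans (le_abs_self D)).trans (by linarith)
  refine ⟨hd, hc, fun z hz => ?_⟩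
  obtain ⟨r, hzr, hr⟩ := exists_between (mem_ball_zero_iff.1 hz)
  set m := ‖z₀‖ / (|D| + 1) *
    Real.exp (-(2 * (Real.log (2 / (δ / 2) / (‖z₀‖ / (|D| + 1))) + 1) * r / (1 - r)))
  have hmpos : 0 < m := mul_pos hcpos (Real.exp_pos _)
  refine ⟨2 / m + K₀, ?_⟩
  filter_upwards [isOpen_ball.mem_nhds (mem_ball_zero_iff.2 hzr)] with w hw t ht
  have hwr := mem_ball_zero_iff.1 hw
  have hw1 : w ∈ ball (0 : ℂ) 1 := mem_ball_zero_iff.2 (hwr.trans hr)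
  have hlow : m ≤ _ := le_norm_of_ne_zero_of_norm_le hcpos (hs_diff t ht)
    (fun x hx => inv_ne_zero (hs_ne t ht x hx)) (hs_le t ht) (hs_zero t ht) hr hwr.le
  rw [norm_inv] at hlow
  have hup : ‖dslope (fun x => g x t) z₀ w‖ ≤ m⁻¹ := by
    rw [le_inv_comm₀ (norm_pos_iff.2 (hs_ne t ht w hw1)) hmpos]
    exact hlow
  have hsub : g w t - g z₀ t = (w - z₀) * dslope (fun x => g x t) z₀ w := by
    simpa using (sub_smul_dslope (fun x => g x t) z₀ w).symm
  have : ‖g w t - g z₀ t‖ ≤ 2 / m := by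
    rw [hsub, norm_mul, div_eq_mul_inv]
    gcongr
    linarith [norm_sub_le w z₀, mem_ball_zero_iff.1 hz₀1]
  linarith [norm_le_norm_add_norm_sub (g z₀ t) (g w t), hK₀ t ht,
    norm_sub_norm_le (g w t) (g z₀ t)]

/-- A continuous logarithm of a differentiable function is differentiable. -/
theorem HasDerivAt.of_exp_eventuallyEq {𝕜 : Type*} [NontriviallyNormedField 𝕜] [NormedAlgebra 𝕜 ℂ]
    {l q : 𝕜 → ℂ} {q' : ℂ} {x : 𝕜} (hl : ContinuousAt l x)
    (hlq : ∀ᶠ y in 𝓝 x, Complex.exp (l y) = q y) (hq : HasDerivAt q q' x) :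
    HasDerivAt l (q' / q x) x := by
  have hqx : q x ≠ 0 := hlq.self_of_nhds ▸ Complex.exp_ne_zero _
  have him : ∀ᶠ y in 𝓝 x, |(l y - l x).im| < Real.pi := by
    have hcont : ContinuousAt (fun y => |(l y - l x).im|) x :=
      (Complex.continuous_im.continuousAt.comp (hl.sub continuousAt_const)).abs
    exact hcont.eventually_lt continuousAt_const (by simpa using Real.pi_pos)
  have heq : (fun y => l x + Complex.log (q y / q x)) =ᶠ[𝓝 x] l := by
    filter_upwards [him, hlq] with y hy hyq
    rw [← hyq, ← hlq.self_of_nhds, ← Complex.exp_sub,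
      Complex.log_exp (abs_lt.1 hy).1 (abs_lt.1 hy).2.le]
    ring
  have hlog : HasDerivAt Complex.log 1 (q x / q x) := by
    rw [div_self hqx]
    simpa using Complex.hasDerivAt_log Complex.one_mem_slitPlane
  refine HasDerivAt.congr_of_eventuallyEq (f' := q' / q x) ?_ heq.symm
  have h := (hlog.scomp x (hq.div_const (q x))).const_add (l x)
  rw [smul_eq_mul, mul_one] at h
  exact h

theorem HasDerivAt.nonpos_of_eventually_le {ψ : ℝ → ℝ} {d x : ℝ} (h : HasDerivAt ψ d x)
    (hle : ∀ᶠ u in 𝓝[>] x, ψ u ≤ ψ x) : d ≤ 0 := by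
  have ht := (hasDerivWithinAt_iff_tendsto_slope' (s := Ioi x) (by simp)).1 h.hasDerivWithinAt
  refine le_of_tendsto ht ?_
  filter_upwards [hle, self_mem_nhdsWithin] with u hu hux
  rw [slope_def_field]
  exact div_nonpos_of_nonpos_of_nonneg (sub_nonpos.2 hu) (sub_pos.2 hux).le

/-- The Borel-Carathéodory inequality, with a bound assumed only on the boundary circle. -/
theorem norm_le_of_norm_exp_le_on_sphere {k : ℂ → ℂ} {R B : ℝ} (hR : 0 < R) (hR1 : R < 1)
    (hB : 0 < B) (hk : DifferentiableOn ℂ k (ball 0 1)) (hk0 : k 0 = 0)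
    (hs : ∀ w ∈ sphere (0 : ℂ) R, ‖Complex.exp (k w)‖ ≤ Real.exp B) {z : ℂ} (hz : ‖z‖ < R) :
    ‖k z‖ ≤ 2 * B * ‖z‖ / (R - ‖z‖) := by
  have hcl : closure (ball (0 : ℂ) R) ⊆ ball 0 1 := by
    rw [closure_ball _ hR.ne']
    exact closedBall_subset_ball hR1
  refine Complex.borelCaratheodory_zero hB (hk.mono (subset_closure.trans hcl)) (fun w hw => ?_)
    hR (mem_ball_zero_iff.2 hz) hk0
  have := Complex.norm_le_of_forall_mem_frontier_norm_le (U := ball 0 R) isBounded_ball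
    (hk.cexp.mono hcl).diffContOnCl (fun x hx => hs x (by rwa [frontier_ball _ hR.ne'] at hx))
    (subset_closure hw)
  rwa [Complex.norm_exp, Real.exp_le_exp] at this

theorem isLocBddHolomorphicFamily_of_exp_eq {L : ℝ → ℂ → ℂ} {q : ℂ → ℝ → ℂ} {J : Set ℝ}
    (hJ : IsCompact J) (hLd : ∀ t ∈ J, DifferentiableOn ℂ (L t) (ball 0 1))
    (hL0 : ∀ t ∈ J, L t 0 = 0)
    (hexp : ∀ t ∈ J, ∀ z ∈ ball (0 : ℂ) 1, z ≠ 0 → Complex.exp (L t z) = q z t)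
    (hq : ContinuousOn (fun x : ℂ × ℝ => q x.1 x.2) ((ball 0 1 \ {0}) ×ˢ J)) :
    IsLocBddHolomorphicFamily (ball 0 1) J (fun z t => L t z) := by
  have hsph : ∀ R : ℝ, 0 < R → R < 1 → sphere (0 : ℂ) R ⊆ ball 0 1 \ {0} := fun R hR hR1 w hw => by
    rw [mem_sphere_zero_iff_norm] at hw
    exact ⟨mem_ball_zero_iff.2 (hw.trans_lt hR1), fun h => hR.ne' (by rw [← hw, h, norm_zero])⟩
  refine ⟨hLd, fun z hz t₀ ht₀ => ?_, fun z hz => ?_⟩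
  · obtain ⟨R, hzR, hR1⟩ := exists_between (mem_ball_zero_iff.1 hz)
    have hR : 0 < R := (norm_nonneg z).trans_lt hzR
    have key : ∀ B > 0, ∀ᶠ t in 𝓝[J] t₀, ‖L t z - L t₀ z‖ ≤ 2 * B * ‖z‖ / (R - ‖z‖) := by
      intro B hB
      have hev : ∀ᶠ t in 𝓝 t₀, ∀ w ∈ sphere (0 : ℂ) R, t ∈ J →
          ‖q w t / q w t₀‖ ≤ Real.exp B := by
        refine (isCompact_sphere (0 : ℂ) R).eventually_forall_of_forall_eventually fun w hw => ?_
        have hw' := hsph R hR hR1 hw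
        have hne : ∀ x ∈ ball (0 : ℂ) 1 \ {0}, q x t₀ ≠ 0 := fun x hx =>
          hexp t₀ ht₀ x hx.1 hx.2 ▸ Complex.exp_ne_zero _
        have hc : ContinuousOn (fun x : ℂ × ℝ => ‖q x.1 x.2 / q x.1 t₀‖)
            ((ball 0 1 \ {0}) ×ˢ J) :=
          (hq.div (hq.comp (f := fun x : ℂ × ℝ => (x.1, t₀)) (by fun_prop)
            fun x hx => ⟨hx.1, ht₀⟩) fun x hx => hne x.1 hx.1).norm
        have h1 : ∀ᶠ x in 𝓝[(ball 0 1 \ {0}) ×ˢ J] (w, t₀),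
            ‖q x.1 x.2 / q x.1 t₀‖ < Real.exp B := by
          refine (hc (w, t₀) ⟨hw', ht₀⟩).eventually_lt continuousWithinAt_const ?_
          simpa [div_self (hne w hw')] using hB
        have h2 : ∀ᶠ x : ℂ × ℝ in 𝓝 (w, t₀), x.1 ∈ ball (0 : ℂ) 1 \ {0} :=
          continuous_fst.continuousAt.eventually
            ((isOpen_ball.sdiff isClosed_singleton).mem_nhds hw')
        have h3 := (eventually_nhdsWithin_iff.1 h1).and h2
        rw [nhds_prod_eq] at h3 ⊢
        exact tendsto_prod_swap.eventually
          (h3.mono fun x hx hxJ => (hx.1 ⟨hx.2, hxJ⟩).le)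
      filter_upwards [nhdsWithin_le_nhds hev, self_mem_nhdsWithin] with t ht htJ
      refine norm_le_of_norm_exp_le_on_sphere (k := fun w => L t w - L t₀ w) hR hR1 hB
        ((hLd t htJ).sub (hLd t₀ ht₀)) (by simp [hL0 t htJ, hL0 t₀ ht₀]) (fun w hw => ?_) hzR
      have hw' := hsph R hR hR1 hw
      rw [Complex.exp_sub, hexp t htJ w hw'.1 hw'.2, hexp t₀ ht₀ w hw'.1 hw'.2]
      exact ht w hw htJ
    refine Metric.tendsto_nhds.2 fun ε hε => ?_
    have hRz : 0 < R - ‖z‖ := sub_pos.2 hzR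
    filter_upwards [key (ε * (R - ‖z‖) / 4) (by positivity)] with t ht
    rw [dist_eq_norm]
    refine ht.trans_lt ?_
    rw [div_lt_iff₀ hRz]
    nlinarith [mul_pos hε hRz, hzR.trans hR1, norm_nonneg z]
  · obtain ⟨r, hzr, hr1⟩ := exists_between (mem_ball_zero_iff.1 hz)
    obtain ⟨R, hrR, hR1⟩ := exists_between hr1
    have hR : 0 < R := ((norm_nonneg z).trans_lt hzr).trans hrR
    obtain ⟨C, hC⟩ := ((isCompact_sphere (0 : ℂ) R).prod hJ).exists_bound_of_continuousOn
      (hq.mono (prod_mono (hsph R hR hR1) Subset.rfl))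
    refine ⟨2 * (|C| + 1) * r / (R - r), ?_⟩
    filter_upwards [isOpen_ball.mem_nhds (mem_ball_zero_iff.2 hzr)] with w hw t ht
    have hwr := mem_ball_zero_iff.1 hw
    refine (norm_le_of_norm_exp_le_on_sphere hR hR1 (by positivity : 0 < |C| + 1) (hLd t ht)
      (hL0 t ht) (fun x hx => ?_) (hwr.trans hrR)).trans ?_
    · have hx' := hsph R hR hR1 hx
      rw [hexp t ht x hx'.1 hx'.2]
      have := Real.add_one_le_exp (|C| + 1)
      linarith [hC (x, t) ⟨hx, ht⟩, le_abs_self C]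
    · have := sub_pos.2 hrR
      have := (norm_nonneg z).trans hzr.le
      gcongr

theorem differentiableOn_of_exp_eq {l q : ℂ → ℂ} {U : Set ℂ} (hU : IsOpen U) {c : ℂ} (hcU : c ∈ U)
    (hl : ContinuousOn l U) (hlq : ∀ z ∈ U, z ≠ c → Complex.exp (l z) = q z)
    (hq : ∀ z ∈ U, z ≠ c → DifferentiableAt ℂ q z) : DifferentiableOn ℂ l U := by
  refine (Complex.differentiableOn_compl_singleton_and_continuousAt_iff (hU.mem_nhds hcU)).1
    ⟨fun z hz => ?_, hl.continuousAt (hU.mem_nhds hcU)⟩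
  refine (HasDerivAt.of_exp_eventuallyEq (hl.continuousAt (hU.mem_nhds hz.1)) ?_
    (hq z hz.1 hz.2).hasDerivAt).differentiableAt.differentiableWithinAt
  filter_upwards [hU.mem_nhds hz.1, isOpen_ne.mem_nhds hz.2] with w hw hwc using hlq w hw hwc

theorem IsLocBddHolomorphicFamily.congr {U : Set ℂ} {J : Set ℝ} {g g' : ℂ → ℝ → ℂ}
    (h : IsLocBddHolomorphicFamily U J g) (hU : IsOpen U)
    (heq : ∀ z ∈ U, ∀ t ∈ J, g' z t = g z t) : IsLocBddHolomorphicFamily U J g' where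
  differentiableOn t ht := (h.differentiableOn t ht).congr fun z hz => heq z hz t ht
  continuousOn z hz := (h.continuousOn z hz).congr fun t ht => heq z hz t ht
  locallyBounded z hz := by
    obtain ⟨K, hK⟩ := h.locallyBounded z hz
    exact ⟨K, (hK.and (hU.eventually_mem hz)).mono fun w hw t ht => heq w hw.2 t ht ▸ hw.1 t ht⟩

/-- A maximum principle for `∂ₜ L = -P z ∂_z L + E` with `0 ≤ Re P`. -/
theorem mul_im_le_of_transport {J : Set ℝ} {L : ℝ → ℂ → ℂ} {P E : ℂ → ℝ → ℂ} {t C σ : ℝ}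
    (hfam : IsLocBddHolomorphicFamily (ball 0 1) J (fun z s => L s z))
    (ht : 0 ≤ t) (hJ : Icc 0 t ⊆ J) (hC : 0 ≤ C) (hσ : |σ| = 1)
    (hL0 : ∀ s ∈ J, L s 0 = 0) (hinit : ∀ z ∈ ball (0 : ℂ) 1, (L 0 z).im = 0)
    (hP : ∀ s ∈ Icc 0 t, ∀ z ∈ ball (0 : ℂ) 1, 0 ≤ (P z s).re)
    (hE : ∀ s ∈ Icc 0 t, ∀ z ∈ ball (0 : ℂ) 1, ‖E z s‖ ≤ C)
    (hderiv : ∀ s ∈ Ioc 0 t, ∀ z ∈ ball (0 : ℂ) 1, z ≠ 0 →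
      HasDerivAt (fun u => L u z) (-(P z s * (z * deriv (L s) z)) + E z s) s)
    {z : ℂ} (hz : z ∈ ball (0 : ℂ) 1) : σ * (L t z).im ≤ C * t := by
  have key : ∀ ε > 0, σ * (L t z).im ≤ (C + ε) * t := by
    intro ε hε
    have hsub : closedBall (0 : ℂ) ‖z‖ ⊆ ball 0 1 :=
      closedBall_subset_ball (mem_ball_zero_iff.1 hz)
    have hcont : ContinuousOn (fun x : ℂ × ℝ => σ * (L x.2 x.1).im - (C + ε) * x.2)
        (closedBall (0 : ℂ) ‖z‖ ×ˢ Icc 0 t) := by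
      have h1 := (hfam.continuousOn_uncurry isOpen_ball).mono (prod_mono hsub hJ)
      exact ((Complex.continuous_im.comp_continuousOn h1).const_mul σ).sub (by fun_prop)
    obtain ⟨⟨w, s⟩, ⟨hw, hs⟩, hmax⟩ :=
      ((isCompact_closedBall (0 : ℂ) ‖z‖).prod isCompact_Icc).exists_isMaxOn
        ⟨(z, t), ⟨by simp, ⟨ht, le_rfl⟩⟩⟩ hcont
    rw [isMaxOn_iff] at hmax
    suffices σ * (L s w).im - (C + ε) * s ≤ 0 by
      have := hmax (z, t) ⟨by simp, ⟨ht, le_rfl⟩⟩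
      simp only at this
      linarith
    rcases hs.1.eq_or_lt with rfl | hspos
    · simp [hinit w (hsub hw)]
    rcases eq_or_ne w 0 with rfl | hw0
    · rw [hL0 s (hJ hs), Complex.zero_im]
      nlinarith
    exfalso
    have hL := hderiv s ⟨hspos, hs.2⟩ w (hsub hw) hw0
    have hLz : HasDerivAt (L s) (deriv (L s) w) w :=
      ((hfam.differentiableOn s (hJ hs)).differentiableAt
        (isOpen_ball.mem_nhds (hsub hw))).hasDerivAt
    have hspace : σ * (-(P w s * (w * deriv (L s) w))).im ≤ 0 := by
      have hcurve : HasDerivAt (fun u : ℝ => w * Complex.exp (-(P w s) * (u : ℂ)))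
          (-(P w s * w)) 0 := by
        have h1 : HasDerivAt (fun u : ℝ => -(P w s) * (u : ℂ)) (-(P w s)) 0 := by
          simpa using (Complex.ofRealCLM.hasDerivAt (x := (0 : ℝ))).const_mul (-(P w s))
        refine (h1.cexp.const_mul w).congr_deriv ?_
        simp [mul_comm]
      have hcomp : HasDerivAt (fun u : ℝ => L s (w * Complex.exp (-(P w s) * (u : ℂ))))
          (deriv (L s) w * -(P w s * w)) 0 :=
        HasDerivAt.comp (0 : ℝ) (h₂ := L s) (by simpa using hLz) hcurve
      have him := ((Complex.imCLM.hasFDerivAt.comp_hasDerivAt (0 : ℝ) hcomp).const_mul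
        σ).nonpos_of_eventually_le (by
          filter_upwards [self_mem_nhdsWithin] with u hu
          have hin : w * Complex.exp (-(P w s) * (u : ℂ)) ∈ closedBall (0 : ℂ) ‖z‖ := by
            rw [mem_closedBall_zero_iff] at hw ⊢
            rw [norm_mul, Complex.norm_exp]
            refine (mul_le_of_le_one_right (norm_nonneg w) (Real.exp_le_one_iff.2 ?_)).trans hw
            have := mul_nonneg (hP s hs w (hsub (mem_closedBall_zero_iff.2 hw))) (le_of_lt hu)
            simpa using this
          have := hmax (_, s) ⟨hin, hs⟩
          simp only at this
          simp only [Function.comp_apply, Complex.imCLM_apply, Complex.ofReal_zero, mul_zero,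
            Complex.exp_zero, mul_one]
          linarith)
      refine le_of_eq_of_le ?_ him
      rw [Complex.imCLM_apply]
      congr 2
      ring
    have htime : -(σ * (-(P w s * (w * deriv (L s) w)) + E w s).im - (C + ε)) ≤ 0 := by
      have h1 : HasDerivAt (fun u : ℝ => s - u) (-1) 0 := by
        simpa using (hasDerivAt_id (0 : ℝ)).const_sub s
      have h2 : HasDerivAt (fun u : ℝ => σ * (L u w).im - (C + ε) * u)
          (σ * (-(P w s * (w * deriv (L s) w)) + E w s).im - (C + ε)) s := by
        have h3 := (Complex.imCLM.hasFDerivAt.comp_hasDerivAt s hL).const_mul σ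
        have h4 := h3.sub ((hasDerivAt_id s).const_mul (C + ε))
        rw [mul_one] at h4
        exact h4
      rw [← sub_zero s] at h2
      have h4 := HasDerivAt.comp (0 : ℝ) (h₂ := fun u : ℝ => σ * (L u w).im - (C + ε) * u)
        h2 h1
      have h5 := h4.nonpos_of_eventually_le (by
        filter_upwards [Ioo_mem_nhdsGT hspos] with u hu
        have := hmax (w, s - u) ⟨hw, by linarith [hu.2], by linarith [hu.1, hs.2]⟩
        simpa using this)
      rw [sub_zero] at h5
      linarith
    have hEb : σ * (E w s).im ≤ C := by
      refine (le_abs_self _).trans ?_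
      rw [abs_mul, hσ, one_mul]
      exact (Complex.abs_im_le_norm _).trans (hE s hs w (hsub hw))
    rw [Complex.add_im, mul_add] at htime
    linarith
  refine le_of_forall_pos_le_add fun η hη => ?_
  have h1 := key (η / (t + 1)) (by positivity)
  have h2 : η / (t + 1) * t ≤ η := by
    rw [div_mul_eq_mul_div, div_le_iff₀ (by positivity)]
    nlinarith
  linarith

/- STATEMENT 7 (Lemma 3, quantitative form): For a Carathéodory driving
function `p`, C¹ on 𝔻̄, continuous in t, with `p`, `p'` bounded and
`M' = sup |p'|`, the solution `f` of the Löwner–Kufarev PDE satisfies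
`|arg(z·f'(z,t)/f(z,t))| ≤ M'·t` on 𝔻 (continuous branch vanishing at 0);
in particular `Re(z f'(z,t)/f(z,t)) > 0` on 𝔻 for `0 < t < π/(2M')`. -/
theorem loewner_kufarev_arg_bound
    (T : ℝ) (hT : 0 < T) (p p' : ℂ → ℝ → ℂ)
    -- Carathéodory class driving function
    (hp_hol : ∀ t ∈ Set.Ico (0:ℝ) T,
      DifferentiableOn ℂ (fun z => p z t) (Metric.ball (0:ℂ) 1))
    (hp_cont : ∀ t ∈ Set.Ico (0:ℝ) T,
      ContinuousOn (fun z => p z t) (Metric.closedBall (0:ℂ) 1))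
    (hp_one : ∀ t ∈ Set.Ico (0:ℝ) T, p 0 t = 1)
    (hp_re : ∀ t ∈ Set.Ico (0:ℝ) T, ∀ z ∈ Metric.ball (0:ℂ) 1, 0 < (p z t).re)
    -- p(·,t) is C¹ on 𝔻̄, continuous in t, with p bounded and M' = sup |p'|
    (hp' : ∀ t ∈ Set.Ico (0:ℝ) T, ∀ z ∈ Metric.ball (0:ℂ) 1,
      HasDerivAt (fun x => p x t) (p' z t) z)
    (hp'_cont : ∀ t ∈ Set.Ico (0:ℝ) T,
      ContinuousOn (fun z => p' z t) (Metric.closedBall (0:ℂ) 1))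
    (hp_t : ∀ z ∈ Metric.closedBall (0:ℂ) 1, ContinuousOn (fun t => p z t) (Set.Ico 0 T))
    (M M' : ℝ)
    (hp_bdd : ∀ z ∈ Metric.closedBall (0:ℂ) 1, ∀ t ∈ Set.Ico (0:ℝ) T, ‖p z t‖ ≤ M)
    (hM' : IsLUB {x : ℝ | ∃ z ∈ Metric.closedBall (0:ℂ) 1, ∃ t ∈ Set.Ico (0:ℝ) T,
      x = ‖p' z t‖} M')
    -- f solves the Löwner–Kufarev PDE, with spatial derivative fz,
    -- f(z,0) = z, each f(·,t) univalent (injective holomorphic) on 𝔻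
    (f fz : ℂ → ℝ → ℂ)
    (hf_init : ∀ z ∈ Metric.ball (0:ℂ) 1, f z 0 = z)
    (hf_hol : ∀ t ∈ Set.Ico (0:ℝ) T,
      DifferentiableOn ℂ (fun z => f z t) (Metric.ball (0:ℂ) 1))
    (hf_inj : ∀ t ∈ Set.Ico (0:ℝ) T,
      Set.InjOn (fun z => f z t) (Metric.ball (0:ℂ) 1))
    (hfz : ∀ t ∈ Set.Ico (0:ℝ) T, ∀ z ∈ Metric.ball (0:ℂ) 1,
      HasDerivAt (fun x => f x t) (fz z t) z)
    (hf_pde : ∀ z ∈ Metric.ball (0:ℂ) 1, ∀ t ∈ Set.Ico (0:ℝ) T,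
      HasDerivWithinAt (fun u => f z u) (-(z * fz z t * p z t)) (Set.Ico 0 T) t)
    -- L(t,·) is the continuous branch of log(z·f'(z,t)/f(z,t)) with L(t,0) = 0;
    -- its imaginary part is the continuous branch of arg vanishing at z = 0
    (L : ℝ → ℂ → ℂ)
    (hL_cont : ∀ t ∈ Set.Ico (0:ℝ) T, ContinuousOn (L t) (Metric.ball (0:ℂ) 1))
    (hL_zero : ∀ t ∈ Set.Ico (0:ℝ) T, L t 0 = 0)
    (hL_exp : ∀ t ∈ Set.Ico (0:ℝ) T, ∀ z ∈ Metric.ball (0:ℂ) 1, z ≠ 0 →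
      Complex.exp (L t z) = z * fz z t / f z t) :
    (∀ t ∈ Set.Ico (0:ℝ) T, ∀ z ∈ Metric.ball (0:ℂ) 1,
      |(L t z).im| ≤ M' * t) ∧
    (∀ t ∈ Set.Ico (0:ℝ) T, 0 < t → t < Real.pi / (2 * M') →
      ∀ z ∈ Metric.ball (0:ℂ) 1, z ≠ 0 → 0 < (z * fz z t / f z t).re) := by
  have h0T : (0 : ℝ) ∈ Set.Ico 0 T := ⟨le_rfl, hT⟩
  have hM'0 : 0 ≤ M' := (norm_nonneg _).trans (hM'.1 ⟨0, by simp, 0, h0T, rfl⟩)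
  have hM0 : 0 ≤ M := (norm_nonneg _).trans (hp_bdd 0 (by simp) 0 h0T)
  have hbound : ∀ t ∈ Set.Ico (0:ℝ) T, ∀ z ∈ Metric.ball (0:ℂ) 1, |(L t z).im| ≤ M' * t := by
    intro t ht z hz
    obtain ⟨b, htb, hbT⟩ := exists_between ht.2
    have hJT : Icc 0 b ⊆ Ico 0 T := fun s hs => ⟨hs.1, hs.2.trans_lt hbT⟩
    have htJ : Icc 0 t ⊆ Icc 0 b := Icc_subset_Icc_right htb.le
    have hnhds : ∀ s ∈ Ioc 0 t, Icc 0 b ∈ 𝓝 s := fun s hs =>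
      Icc_mem_nhds hs.1 (hs.2.trans_lt htb)
    have hq0 : ∀ s ∈ Ico 0 T, ∀ w ∈ ball (0 : ℂ) 1, w ≠ 0 → w * fz w s / f w s ≠ 0 :=
      fun s hs w hw hw0 => hL_exp s hs w hw hw0 ▸ Complex.exp_ne_zero _
    have hfz0 : ∀ s ∈ Ico 0 T, ∀ w ∈ ball (0 : ℂ) 1, w ≠ 0 → fz w s ≠ 0 :=
      fun s hs w hw hw0 h => hq0 s hs w hw hw0 (by simp [h])
    have hf0 : ∀ s ∈ Ico 0 T, ∀ w ∈ ball (0 : ℂ) 1, w ≠ 0 → f w s ≠ 0 :=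
      fun s hs w hw hw0 h => hq0 s hs w hw hw0 (by simp [h])
    have hfamf : IsLocBddHolomorphicFamily (ball 0 1) (Icc 0 b) f :=
      isLocBddHolomorphicFamily_of_injOn isCompact_Icc (fun s hs => hf_hol s (hJT hs))
        (fun s hs => hf_inj s (hJT hs))
        (fun s hs w hw hw0 => by
          rw [(hfz s (hJT hs) w hw).deriv]
          exact hfz0 s (hJT hs) w hw hw0)
        fun w hw s hs => ((hf_pde w hw s (hJT hs)).mono hJT).continuousWithinAt
    have hfamfz : IsLocBddHolomorphicFamily (ball 0 1) (Icc 0 b) fz :=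
      (hfamf.deriv_family isOpen_ball).congr isOpen_ball
        fun w hw s hs => (hfz s (hJT hs) w hw).deriv.symm
    have hfz_z : ∀ s ∈ Icc 0 b, ∀ w ∈ ball (0 : ℂ) 1,
        HasDerivAt (fun x => fz x s) (deriv (fun x => fz x s) w) w := fun s hs w hw =>
      ((hfamfz.differentiableOn s hs).differentiableAt (isOpen_ball.mem_nhds hw)).hasDerivAt
    have hfamL : IsLocBddHolomorphicFamily (ball 0 1) (Icc 0 b) (fun w s => L s w) := by
      refine isLocBddHolomorphicFamily_of_exp_eq (q := fun w s => w * fz w s / f w s)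
        isCompact_Icc (fun s hs => ?_) (fun s hs => hL_zero s (hJT hs))
        (fun s hs => hL_exp s (hJT hs)) ?_
      · exact differentiableOn_of_exp_eq isOpen_ball (by simp) (hL_cont s (hJT hs))
          (hL_exp s (hJT hs)) fun w hw hw0 => (differentiableAt_id.mul
            (hfz_z s hs w hw).differentiableAt).div (hfz s (hJT hs) w hw).differentiableAt
            (hf0 s (hJT hs) w hw hw0)
      · have hsub : (ball (0 : ℂ) 1 \ {0}) ×ˢ Icc 0 b ⊆ ball 0 1 ×ˢ Icc 0 b :=
          prod_mono sdiff_subset Subset.rfl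
        exact (continuousOn_fst.mul ((hfamfz.continuousOn_uncurry isOpen_ball).mono hsub)).div
          ((hfamf.continuousOn_uncurry isOpen_ball).mono hsub)
          fun x hx => hf0 x.2 (hJT hx.2) x.1 hx.1.1 hx.1.2
    have hγ_z : ∀ s ∈ Icc 0 b, ∀ w ∈ ball (0 : ℂ) 1,
        HasDerivAt (fun x => -(x * fz x s * p x s))
          (-((1 * fz w s + w * deriv (fun x => fz x s) w) * p w s + w * fz w s * p' w s)) w :=
      fun s hs w hw =>
        ((((hasDerivAt_id w).mul (hfz_z s hs w hw)).mul (hp' s (hJT hs) w hw)).neg)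
    have hfz_t : ∀ s ∈ Ioc 0 t, ∀ w ∈ ball (0 : ℂ) 1,
        HasDerivAt (fz w)
          (-((1 * fz w s + w * deriv (fun x => fz x s) w) * p w s + w * fz w s * p' w s)) s := by
      intro s hs w hw
      have hsJ := htJ ⟨hs.1.le, hs.2⟩
      have h := hfamf.hasDerivAt_deriv isOpen_ball (convex_Icc 0 b)
        (γ := fun x u => -(x * fz x u * p x u))
        (fun x hx u hu => (hf_pde x hx u (hJT hu)).mono hJT)
        (fun x hx => by
          obtain ⟨K, hK⟩ := hfamfz.locallyBounded x hx
          refine ⟨K * M, ?_⟩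
          filter_upwards [hK, isOpen_ball.mem_nhds hx] with y hy hyb u hu
          have hyb1 := (mem_ball_zero_iff.1 hyb).le
          have hp1 := hp_bdd y (ball_subset_closedBall hyb) u (hJT hu)
          have hy1 := hy u hu
          rw [norm_neg, norm_mul, norm_mul]
          refine mul_le_mul ?_ hp1 (norm_nonneg _) ((norm_nonneg _).trans hy1)
          exact (mul_le_of_le_one_left (norm_nonneg _) hyb1).trans hy1)
        (hnhds s hs)
        (fun x hx => (hγ_z s hsJ x hx).differentiableAt.differentiableWithinAt) hw
      rw [(hγ_z s hsJ w hw).deriv] at h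
      refine h.congr_of_eventuallyEq ?_
      filter_upwards [hnhds s hs] with u hu
      exact (hfz u (hJT hu) w hw).deriv.symm
    have hL_t : ∀ s ∈ Ioc 0 t, ∀ w ∈ ball (0 : ℂ) 1, w ≠ 0 →
        HasDerivAt (fun u => L u w)
          (-(p w s * (w * deriv (L s) w)) + -(w * p' w s)) s := by
      intro s hs w hw hw0
      have hsJ := htJ ⟨hs.1.le, hs.2⟩
      have hff := hf0 s (hJT hsJ) w hw hw0
      have hffz := hfz0 s (hJT hsJ) w hw hw0
      have hz' := HasDerivAt.of_exp_eventuallyEq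
        ((hL_cont s (hJT hsJ)).continuousAt (isOpen_ball.mem_nhds hw))
        (by
          filter_upwards [isOpen_ball.mem_nhds hw, isOpen_ne.mem_nhds hw0] with x hx hx0
          exact hL_exp s (hJT hsJ) x hx hx0)
        (((hasDerivAt_id w).mul (hfz_z s hsJ w hw)).div (hfz s (hJT hsJ) w hw) hff)
      have ht' := HasDerivAt.of_exp_eventuallyEq (l := fun u => L u w)
        ((hfamL.continuousOn w hw).continuousAt (hnhds s hs))
        (by
          filter_upwards [hnhds s hs] with u hu
          exact hL_exp u (hJT hu) w hw hw0)
        (((hfz_t s hs w hw).const_mul w).div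
          ((hf_pde w hw s (hJT hsJ)).hasDerivAt (mem_of_superset (hnhds s hs) hJT)) hff)
      refine ht'.congr_deriv ?_
      rw [hz'.deriv]
      simp only [Pi.mul_apply, Pi.div_apply, id]
      field_simp
      ring
    have hinit : ∀ w ∈ ball (0 : ℂ) 1, (L 0 w).im = 0 := by
      intro w hw
      obtain ⟨R, hwR, hR1⟩ := exists_between (mem_ball_zero_iff.1 hw)
      have hR : 0 < R := (norm_nonneg w).trans_lt hwR
      have hRw : 0 < R - ‖w‖ := sub_pos.2 hwR
      have hexp1 : ∀ x ∈ sphere (0 : ℂ) R, Complex.exp (L 0 x) = 1 := by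
        intro x hx
        rw [mem_sphere_zero_iff_norm] at hx
        have hx1 : x ∈ ball (0 : ℂ) 1 := mem_ball_zero_iff.2 (hx.trans_lt hR1)
        have hx0 : x ≠ 0 := norm_pos_iff.1 (hx ▸ hR)
        have h1 : fz x 0 = 1 := (hfz 0 h0T x hx1).unique
          ((hasDerivAt_id x).congr_of_eventuallyEq
            ((isOpen_ball.eventually_mem hx1).mono hf_init))
        rw [hL_exp 0 h0T x hx1 hx0, h1, hf_init x hx1, mul_one, div_self hx0]
      suffices ‖L 0 w‖ ≤ 0 by rw [norm_le_zero_iff.1 this, Complex.zero_im]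
      refine le_of_forall_pos_le_add fun ε hε => ?_
      refine (norm_le_of_norm_exp_le_on_sphere hR hR1
        (by positivity : 0 < ε * (R - ‖w‖) / 2)
        (hfamL.differentiableOn 0 (htJ ⟨le_rfl, ht.1⟩)) (hL_zero 0 h0T) (fun x hx => ?_)
        hwR).trans ?_
      · rw [hexp1 x hx, norm_one]
        exact Real.one_le_exp (by positivity)
      · rw [div_le_iff₀ hRw]
        nlinarith [mul_pos hε hRw, mem_ball_zero_iff.1 hw]
    have hE : ∀ s ∈ Icc 0 t, ∀ w ∈ ball (0 : ℂ) 1, ‖-(w * p' w s)‖ ≤ M' := by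
      intro s hs w hw
      rw [norm_neg, norm_mul]
      exact (mul_le_of_le_one_left (norm_nonneg _) (mem_ball_zero_iff.1 hw).le).trans
        (hM'.1 ⟨w, ball_subset_closedBall hw, s, hJT (htJ hs), rfl⟩)
    have hmain : ∀ σ : ℝ, |σ| = 1 → σ * (L t z).im ≤ M' * t := fun σ hσ =>
      mul_im_le_of_transport (E := fun w s => -(w * p' w s)) hfamL ht.1 htJ hM'0 hσ
        (fun s hs => hL_zero s (hJT hs)) hinit
        (fun s hs w hw => (hp_re s (hJT (htJ hs)) w hw).le) hE hL_t hz
    rw [abs_le]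
    have h1 := hmain 1 (by simp)
    have h2 := hmain (-1) (by simp)
    constructor <;> linarith
  refine ⟨hbound, fun t ht ht0 htM z hz hz0 => ?_⟩
  have hM'pos : 0 < M' := hM'0.lt_of_ne (by
    rintro rfl
    simp only [mul_zero, div_zero] at htM
    exact ht0.not_gt htM)
  have hlt : |(L t z).im| < Real.pi / 2 := by
    refine (hbound t ht z hz).trans_lt ?_
    rw [lt_div_iff₀ (by positivity)] at htM
    linarith
  rw [← hL_exp t ht z hz hz0, Complex.exp_re]
  exact mul_pos (Real.exp_pos _) (Real.cos_pos_of_mem_Ioo (abs_lt.1 hlt))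
end

section
/- (Lemma 3, geometric form) Let p be a driving function from the Carathéodory class, C¹ on 𝔻̄ for each t, continuous in t, with p and p' = ∂p/∂z bounded on 𝔻̄ × [0,T). Let f(z,t) solve the Löwner–Kufarev PDE ∂f/∂t = -z·(∂f/∂z)·p(z,t), f(z,0) = z, each f(·,t) univalent on 𝔻 with f(0,t) = 0. Then for all sufficiently small t > 0 the image domain Ω(t) = f(𝔻,t) is star-shaped with respect to the origin: for every w ∈ Ω(t) and every λ ∈ [0,1], λ·w ∈ Ω(t). -/
open Set Metric Filter Topology

lemma norm_deriv_sub_deriv_le_of_norm_deriv_le {g : ℂ → ℂ} {c : ℂ} {ρ A : ℝ} (hρ : 0 < ρ)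
    (hg : DifferentiableOn ℂ g (ball c ρ)) (hA : ∀ z ∈ ball c ρ, ‖deriv g z‖ ≤ A)
    {y : ℂ} (hy : y ∈ ball c (ρ / 2)) :
    ‖deriv g y - deriv g c‖ ≤ 4 * A / ρ * ‖y - c‖ := by
  have hg' : DifferentiableOn ℂ (deriv g) (ball c ρ) := hg.deriv isOpen_ball
  have hsub : ∀ x ∈ ball c (ρ / 2), closedBall x (ρ / 4) ⊆ ball c ρ := fun x hx =>
    closedBall_subset_ball' (by rw [mem_ball] at hx; linarith)
  refine (convex_ball c (ρ / 2)).norm_image_sub_le_of_norm_deriv_le (𝕜 := ℂ)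
    (fun x hx => hg'.differentiableAt (isOpen_ball.mem_nhds
      (hsub x hx (mem_closedBall_self (by positivity))))) (fun x hx => ?_)
    (mem_ball_self (by positivity)) hy
  refine (Complex.norm_deriv_le_of_forall_mem_sphere_norm_le (R := ρ / 4) (C := A) (by positivity)
    ((hg'.mono (hsub x hx)).diffContOnCl_ball subset_rfl)
    (fun z hz => hA z (hsub x hx (sphere_subset_closedBall hz)))).trans (le_of_eq ?_)
  field_simp

lemma norm_sub_sub_deriv_mul_le_of_norm_deriv_le {g : ℂ → ℂ} {c : ℂ} {ρ A : ℝ} (hρ : 0 < ρ)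
    (hg : DifferentiableOn ℂ g (ball c ρ)) (hA : ∀ z ∈ ball c ρ, ‖deriv g z‖ ≤ A)
    {y : ℂ} (hy : y ∈ ball c (ρ / 2)) :
    ‖g y - g c - deriv g c * (y - c)‖ ≤ 4 * A / ρ * ‖y - c‖ ^ 2 := by
  have hA0 : 0 ≤ A := (norm_nonneg _).trans (hA c (mem_ball_self hρ))
  have hsub : closedBall c ‖y - c‖ ⊆ ball c (ρ / 2) :=
    closedBall_subset_ball (by rwa [mem_ball, dist_eq_norm] at hy)
  have hd : ∀ x ∈ closedBall c ‖y - c‖,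
      HasDerivAt (fun x => g x - deriv g c * x) (deriv g x - deriv g c) x := fun x hx => by
    have h1 : x ∈ ball c ρ := ball_subset_ball (by linarith) (hsub hx)
    simpa using (hg.differentiableAt (isOpen_ball.mem_nhds h1)).hasDerivAt.fun_sub
      ((hasDerivAt_id x).const_mul (deriv g c))
  have := (convex_closedBall c ‖y - c‖).norm_image_sub_le_of_norm_hasDerivWithin_le (𝕜 := ℂ)
    (C := 4 * A / ρ * ‖y - c‖)
    (fun x hx => (hd x hx).hasDerivWithinAt) (fun x hx => ?_)
    (mem_closedBall_self (norm_nonneg _)) (y := y) (by simp [dist_eq_norm])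
  · calc _ = ‖g y - deriv g c * y - (g c - deriv g c * c)‖ := by congr 1; ring
      _ ≤ _ := this
      _ = _ := by ring
  · refine (norm_deriv_sub_deriv_le_of_norm_deriv_le hρ hg hA (hsub hx)).trans ?_
    rw [mem_closedBall, dist_eq_norm] at hx
    gcongr

/-- A weak form of **Bloch's theorem**: the image of a disc of radius `ρ` under a holomorphic map
contains a disc whose radius is comparable to `ρ` times the derivative at the centre. -/
lemma exists_ball_subset_image_ball {L : ℂ → ℂ} {c : ℂ} {ρ : ℝ} (hρ : 0 < ρ)
    (hL : DifferentiableOn ℂ L (ball c ρ)) (hne : deriv L c ≠ 0) :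
    ∃ a, ball a (ρ * ‖deriv L c‖ / 256) ⊆ L '' ball c ρ := by
  have hL' : DifferentiableOn ℂ (deriv L) (ball c ρ) := hL.deriv isOpen_ball
  have hR : closedBall c (ρ / 2) ⊆ ball c ρ := closedBall_subset_ball (by linarith)
  obtain ⟨a, ha, hmax⟩ := (isCompact_closedBall c (ρ / 2)).exists_isMaxOn
    (f := fun z => (ρ / 2 - ‖z - c‖) * ‖deriv L z‖) ⟨c, mem_closedBall_self (by positivity)⟩
    (by
      have := (hL'.continuousOn.mono hR).norm
      fun_prop)
  have hmc := hmax (mem_closedBall_self (x := c) (ε := ρ / 2) (by positivity))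
  simp only [mem_ofPred_eq, sub_self, norm_zero, sub_zero] at hmc
  have hc0 : 0 < ‖deriv L c‖ := norm_pos_iff.2 hne
  set B := ‖deriv L a‖ with hB
  set d := (ρ / 2 - ‖a - c‖) / 2 with hd
  have ha' : ‖a - c‖ ≤ ρ / 2 := by simpa [dist_eq_norm] using ha
  have hpos : 0 < (ρ / 2 - ‖a - c‖) * B := lt_of_lt_of_le (by positivity) hmc
  have hd0 : 0 < d := by
    have := pos_of_mul_pos_left hpos (norm_nonneg _)
    positivity
  have hB0 : 0 < B := pos_of_mul_pos_right hpos (by linarith)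
  have hsub : ball a d ⊆ closedBall c (ρ / 2) := fun z hz => by
    rw [mem_ball, dist_eq_norm] at hz
    rw [mem_closedBall, dist_eq_norm]
    have := norm_sub_le_norm_sub_add_norm_sub z a c
    linarith
  have hA : ∀ z ∈ ball a d, ‖deriv L z‖ ≤ 2 * B := fun z hz => by
    have h1 := hmax (hsub hz)
    simp only [mem_ofPred_eq] at h1
    rw [mem_ball, dist_eq_norm] at hz
    have h2 := norm_sub_le_norm_sub_add_norm_sub z a c
    have h3 : d * ‖deriv L z‖ ≤ d * (2 * B) :=
      calc d * ‖deriv L z‖ ≤ (ρ / 2 - ‖z - c‖) * ‖deriv L z‖ := by gcongr; linarith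
        _ ≤ _ := h1
        _ = d * (2 * B) := by rw [hd]; ring
    exact le_of_mul_le_mul_left h3 hd0
  have hLa : DifferentiableOn ℂ L (ball a d) := hL.mono (hsub.trans hR)
  have hcb : closedBall a (d / 16) ⊆ ball a d := closedBall_subset_ball (by linarith)
  have key : ∀ z ∈ sphere a (d / 16), B * d / 32 ≤ ‖L z - L a‖ := fun z hz => by
    have hz' : ‖z - a‖ = d / 16 := by simpa [dist_eq_norm] using hz
    have h1 := norm_sub_sub_deriv_mul_le_of_norm_deriv_le hd0 hLa hA (y := z)
      (by rw [mem_ball, dist_eq_norm]; linarith)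
    have h2 : ‖deriv L a * (z - a)‖ = B * (d / 16) := by rw [norm_mul, hz']
    have h3 := norm_sub_norm_le (deriv L a * (z - a)) (L z - L a)
    rw [norm_sub_rev (deriv L a * (z - a))] at h3
    rw [hz'] at h1
    have h4 : 4 * (2 * B) / d * (d / 16) ^ 2 = B * d / 32 := by field_simp; norm_num
    linarith
  refine ⟨L a, ?_⟩
  have hfr : ∃ᶠ z in 𝓝 a, L z ≠ L a := by
    intro h
    simp only [not_not] at h
    have : deriv L a = 0 := by
      rw [Filter.EventuallyEq.deriv_eq (f := fun _ => L a) h, deriv_const]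
    rw [hB, this, norm_zero] at hB0
    exact lt_irrefl _ hB0
  have := DiffContOnCl.ball_subset_image_closedBall
    ((hLa.mono hcb).diffContOnCl_ball subset_rfl) (by positivity) key hfr
  refine (ball_subset_ball ?_).trans (this.trans (image_mono ((hcb.trans hsub).trans hR)))
  have : (ρ / 2 - ‖a - c‖) = 2 * d := by rw [hd]; ring
  rw [this] at hmc
  linarith

/-- A zero-free univalent function on a disc has controlled logarithmic derivative at the centre. -/
lemma norm_deriv_le_of_injOn_of_ne_zero {f : ℂ → ℂ} {c : ℂ} {ρ : ℝ} (hρ : 0 < ρ)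
    (hf : DifferentiableOn ℂ f (ball c ρ)) (hinj : InjOn f (ball c ρ))
    (h0 : ∀ z ∈ ball c ρ, f z ≠ 0) :
    ‖deriv f c‖ ≤ 2048 / ρ * ‖f c‖ := by
  have hc : c ∈ ball c ρ := mem_ball_self hρ
  have hq : DifferentiableOn ℂ (fun z => deriv f z / f z) (ball c ρ) :=
    (hf.deriv isOpen_ball).div hf h0
  obtain ⟨L, hL⟩ := hq.isExactOn_ball
  have hconst : ∀ z ∈ ball c ρ, Complex.exp (-L z) * f z = Complex.exp (-L c) * f c := by
    intro z hz
    refine (convex_ball c ρ).is_const_of_fderivWithin_eq_zero (𝕜 := ℂ)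
      (f := fun z => Complex.exp (-L z) * f z) ?_ ?_ hz hc
    · intro x hx
      exact ((hL x hx).differentiableAt.neg.cexp.mul
        (hf.differentiableAt (isOpen_ball.mem_nhds hx))).differentiableWithinAt
    · intro x hx
      have h1 := (hL x hx).neg.cexp.mul (hf.differentiableAt (isOpen_ball.mem_nhds hx)).hasDerivAt
      have h2 : Complex.exp (-L x) * -(deriv f x / f x) * f x + Complex.exp (-L x) * deriv f x
          = 0 := by
        field_simp [h0 x hx]
        ring
      change HasDerivAt (fun z => Complex.exp (-L z) * f z)
        (Complex.exp (-L x) * -(deriv f x / f x) * f x + Complex.exp (-L x) * deriv f x) x at h1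
      rw [h2] at h1
      rw [fderivWithin_of_isOpen isOpen_ball hx]
      have := h1.hasFDerivAt.fderiv
      rw [this]; ext; simp
  have hdL : deriv L c = deriv f c / f c := (hL c hc).deriv
  have hfc : 0 < ‖f c‖ := norm_pos_iff.2 (h0 c hc)
  by_contra! hlt
  have hbig : 2048 < ρ * ‖deriv L c‖ := by
    rw [hdL, norm_div, ← mul_div_assoc, lt_div_iff₀ hfc]
    rw [div_mul_eq_mul_div, div_lt_iff₀ hρ] at hlt
    linarith
  have hne : deriv L c ≠ 0 := by
    intro h; rw [h] at hbig; norm_num at hbig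
  obtain ⟨a, ha⟩ := exists_ball_subset_image_ball hρ
    (fun z hz => (hL z hz).differentiableAt.differentiableWithinAt) hne
  obtain ⟨x, hx, hxa⟩ := ha (mem_ball_self (by linarith))
  obtain ⟨y, hy, hya⟩ := ha (show a + 2 * Real.pi * Complex.I ∈ _ by
    rw [mem_ball, dist_eq_norm, add_sub_cancel_left]
    have := Real.pi_lt_four
    simp [abs_of_pos Real.pi_pos]
    linarith)
  have hexp : Complex.exp (-L y) = Complex.exp (-L x) := by
    rw [hya, hxa, neg_add, Complex.exp_add, Complex.exp_neg (2 * _ * _), Complex.exp_two_pi_mul_I]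
    simp
  have hxy : f y = f x := by
    have := (hconst y hy).trans (hconst x hx).symm
    rw [hexp] at this
    exact mul_left_cancel₀ (Complex.exp_ne_zero _) this
  rw [hinj hy hx hxy, hxa] at hya
  have : (2 * Real.pi * Complex.I : ℂ) = 0 := by linear_combination -hya
  simp [Real.pi_ne_zero] at this

/-- Growth bound for univalent functions on the unit disc fixing the origin. -/
lemma norm_le_of_injOn_unitBall {f : ℂ → ℂ} {r : ℝ} (hr : 0 < r) (hr1 : r < 1)
    (hf : DifferentiableOn ℂ f (ball 0 1)) (hinj : InjOn f (ball 0 1)) (h0 : f 0 = 0)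
    {z : ℂ} (hz : ‖z‖ ≤ r) :
    ‖f z‖ ≤ ‖f r‖ * Real.exp (2048 / min r (1 - r) * r * (2 * Real.pi)) := by
  set ρ := min r (1 - r)
  have hρ : 0 < ρ := lt_min hr (by linarith)
  set E := Real.exp (2048 / ρ * r * (2 * Real.pi))
  have hcirc : ∀ θ : ℝ, circleMap 0 r θ ∈ ball (0 : ℂ) 1 := fun θ => by
    simpa [abs_of_pos hr] using hr1
  have hsph : ∀ w ∈ sphere (0 : ℂ) r, ‖deriv f w‖ ≤ 2048 / ρ * ‖f w‖ := by
    intro w hw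
    have hw' : ‖w‖ = r := by simpa using hw
    have hsub : ball w ρ ⊆ ball 0 1 := ball_subset_ball' (by
      rw [dist_zero_right, hw']; linarith [min_le_right r (1 - r)])
    refine norm_deriv_le_of_injOn_of_ne_zero hρ (hf.mono hsub) (hinj.mono hsub) ?_
    intro x hx hfx
    have : x = 0 := hinj (hsub hx) (mem_ball_self one_pos) (hfx.trans h0.symm)
    rw [this, mem_ball, dist_zero_left, hw'] at hx
    linarith [min_le_left r (1 - r)]
  have hF : ∀ θ : ℝ, HasDerivAt (fun θ => f (circleMap 0 r θ))
      (deriv f (circleMap 0 r θ) * (circleMap 0 r θ * Complex.I)) θ := fun θ =>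
    (hf.differentiableAt (isOpen_ball.mem_nhds (hcirc θ))).hasDerivAt.comp θ
      (hasDerivAt_circleMap 0 r θ)
  have hgr := norm_le_gronwallBound_of_norm_deriv_right_le (a := 0) (b := 2 * Real.pi)
    (δ := ‖f r‖) (K := 2048 / ρ * r) (ε := 0) (f := fun θ => f (circleMap 0 r θ))
    (fun θ _ => (hF θ).continuousAt.continuousWithinAt)
    (fun θ _ => (hF θ).hasDerivWithinAt) (by simp [circleMap]) (fun θ _ => by
      have := hsph (circleMap 0 r θ) (circleMap_mem_sphere 0 hr.le θ)
      have h2 : ‖circleMap 0 r θ‖ = r := by simp [abs_of_pos hr]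
      simp only [norm_mul, h2, Complex.norm_I, mul_one, add_zero]
      nlinarith)
  have hbd : ∀ w ∈ sphere (0 : ℂ) r, ‖f w‖ ≤ ‖f r‖ * E := by
    intro w hw
    have : w ∈ circleMap 0 r '' Ioc 0 (2 * Real.pi) := by
      rwa [image_circleMap_Ioc, abs_of_pos hr]
    obtain ⟨θ, hθ, rfl⟩ := this
    refine (hgr θ ⟨hθ.1.le, hθ.2⟩).trans ?_
    rw [gronwallBound_ε0]
    have h1 : θ - 0 ≤ 2 * Real.pi := by linarith [hθ.2]
    exact mul_le_mul_of_nonneg_left (Real.exp_le_exp.2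
      (mul_le_mul_of_nonneg_left h1 (by positivity))) (norm_nonneg _)
  have hcl : closedBall (0 : ℂ) r ⊆ ball 0 1 := closedBall_subset_ball hr1
  refine Complex.norm_le_of_forall_mem_frontier_norm_le (U := ball 0 r) isBounded_ball
    ((hf.mono hcl).diffContOnCl_ball subset_rfl) (fun w hw => hbd w ?_) ?_
  · rwa [frontier_ball _ hr.ne'] at hw
  · rw [closure_ball _ hr.ne']
    simpa using hz

lemma continuousOn_deriv_of_norm_deriv_le {f : ℂ → ℝ → ℂ} {c : ℂ} {ρ A : ℝ} {S : Set ℝ}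
    (hρ : 0 < ρ) (hf : ∀ u ∈ S, DifferentiableOn ℂ (fun z => f z u) (ball c ρ))
    (hA : ∀ u ∈ S, ∀ z ∈ ball c ρ, ‖deriv (fun z => f z u) z‖ ≤ A)
    (hcont : ∀ z ∈ ball c ρ, ContinuousOn (f z) S) :
    ContinuousOn (fun u => deriv (fun z => f z u) c) S := by
  refine continuousOn_of_uniform_approx_of_continuousOn fun U hU => ?_
  obtain ⟨ε, hε, hεU⟩ := Metric.mem_uniformity_dist.1 hU
  obtain ⟨k, hk0, hk⟩ : ∃ k : ℝ, 0 < k ∧ k < min (ρ / 2) (ε / (4 * |A| / ρ + 1)) :=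
    exists_between (lt_min (by positivity) (by positivity))
  have hk1 : k < ρ / 2 := hk.trans_le (min_le_left _ _)
  have hk2 : k * (4 * |A| / ρ + 1) < ε := by
    rw [← lt_div_iff₀ (by positivity)]; exact hk.trans_le (min_le_right _ _)
  have hmem : c + k ∈ ball c (ρ / 2) := by
    simpa [mem_ball, dist_eq_norm, abs_of_pos hk0] using hk1
  have hkne : (k : ℂ) ≠ 0 := by exact_mod_cast hk0.ne'
  refine ⟨fun u => (f (c + k) u - f c u) / k,
    ((hcont _ (ball_subset_ball (by linarith) hmem)).sub
      (hcont _ (mem_ball_self hρ))).div_const _, fun u hu => hεU ?_⟩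
  have h1 := norm_sub_sub_deriv_mul_le_of_norm_deriv_le hρ (hf u hu) (hA u hu) hmem
  have h2 : deriv (fun z => f z u) c - (f (c + k) u - f c u) / k
      = -((f (c + k) u - f c u - deriv (fun z => f z u) c * (c + k - c)) / k) := by
    field_simp; ring
  rw [dist_eq_norm, h2, norm_neg, norm_div, Complex.norm_real, Real.norm_eq_abs, abs_of_pos hk0,
    div_lt_iff₀ hk0]
  rw [add_sub_cancel_left, Complex.norm_real, Real.norm_eq_abs, abs_of_pos hk0] at h1
  rw [add_sub_cancel_left]
  have h3 : 4 * A / ρ * k ^ 2 ≤ 4 * |A| / ρ * k ^ 2 := by gcongr; exact le_abs_self A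
  nlinarith [mul_lt_mul_of_pos_right hk2 hk0, sq_nonneg k]

/-- Chain rule along a curve for a family that is holomorphic in space with locally bounded
derivative and differentiable in time at each fixed point. -/
lemma hasDerivWithinAt_apply_curve {f : ℂ → ℝ → ℂ} {ρ A s : ℝ} {S : Set ℝ} {ζ : ℝ → ℂ}
    {ζ' g : ℂ} (hρ : 0 < ρ) (hs : s ∈ S)
    (hf : ∀ u ∈ S, DifferentiableOn ℂ (fun z => f z u) (ball (ζ s) ρ))
    (hA : ∀ u ∈ S, ∀ z ∈ ball (ζ s) ρ, ‖deriv (fun z => f z u) z‖ ≤ A)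
    (hcont : ∀ z ∈ ball (ζ s) ρ, ContinuousOn (f z) S)
    (hg : HasDerivWithinAt (f (ζ s)) g S s) (hζ : HasDerivWithinAt ζ ζ' S s) :
    HasDerivWithinAt (fun u => f (ζ u) u) (deriv (fun z => f z s) (ζ s) * ζ' + g) S s := by
  have hfz : Tendsto (fun u => deriv (fun z => f z u) (ζ s) - deriv (fun z => f z s) (ζ s))
      (𝓝[S] s) (𝓝 0) := by
    have := (continuousOn_deriv_of_norm_deriv_le hρ hf hA hcont) s hs
    simpa using this.tendsto.sub_const (deriv (fun z => f z s) (ζ s))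
  have hζt : Tendsto (fun u => ζ u - ζ s) (𝓝[S] s) (𝓝 0) := by
    simpa using hζ.continuousWithinAt.tendsto.sub_const (ζ s)
  have hζO : (fun u => ζ u - ζ s) =O[𝓝[S] s] (fun u => u - s) := hζ.hasFDerivWithinAt.isBigO_sub
  have hlin : (fun u => (deriv (fun z => f z u) (ζ s) - deriv (fun z => f z s) (ζ s))
      * (ζ u - ζ s)) =o[𝓝[S] s] (fun u => u - s) := by
    simpa using ((Asymptotics.isLittleO_one_iff ℝ).2 hfz).mul_isBigO hζO
  have hsq : (fun u => (ζ u - ζ s) * (ζ u - ζ s)) =o[𝓝[S] s] (fun u => u - s) := by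
    simpa using ((Asymptotics.isLittleO_one_iff ℝ).2 hζt).mul_isBigO hζO
  have hrem : (fun u => f (ζ u) u - f (ζ s) u - deriv (fun z => f z u) (ζ s) * (ζ u - ζ s))
      =o[𝓝[S] s] (fun u => u - s) := by
    refine Asymptotics.IsBigO.trans_isLittleO (Asymptotics.IsBigO.of_bound (4 * A / ρ) ?_) hsq
    have hball : ∀ᶠ u in 𝓝[S] s, ζ u ∈ ball (ζ s) (ρ / 2) :=
      hζ.continuousWithinAt.tendsto (ball_mem_nhds _ (by positivity))
    filter_upwards [hball, self_mem_nhdsWithin] with u hu huS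
    have := norm_sub_sub_deriv_mul_le_of_norm_deriv_le hρ (hf u huS) (hA u huS) hu
    rwa [norm_mul, ← sq]
  rw [hasDerivWithinAt_iff_isLittleO] at hg hζ ⊢
  have hζm := hζ.const_mul_left (deriv (fun z => f z s) (ζ s))
  refine (((hrem.add hlin).add hζm).add hg).congr_left fun u => ?_
  simp only [Complex.real_smul]
  ring

/-- A univalent solution of the Löwner–Kufarev equation is constant along the characteristic curves
`ζ' = ζ p(ζ, s)`. -/
lemma loewnerKufarev_apply_characteristic {f p : ℂ → ℝ → ℂ} {ζ : ℝ → ℂ} {r t : ℝ}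
    (hr : 0 < r) (hr1 : r < 1) (ht : 0 < t)
    (hf : ∀ u ∈ Icc 0 t, DifferentiableOn ℂ (fun z => f z u) (ball 0 1))
    (hinj : ∀ u ∈ Icc 0 t, InjOn (fun z => f z u) (ball 0 1))
    (h0 : ∀ u ∈ Icc 0 t, f 0 u = 0)
    (hpde : ∀ z ∈ ball (0 : ℂ) 1, ∀ u ∈ Icc 0 t, HasDerivWithinAt (f z)
      (-(z * deriv (fun z => f z u) z * p z u)) (Icc 0 t) u)
    (hζr : ∀ s ∈ Icc 0 t, ‖ζ s‖ ≤ r)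
    (hζ : ∀ s ∈ Icc 0 t, HasDerivWithinAt ζ (ζ s * p (ζ s) s) (Icc 0 t) s) :
    f (ζ t) t = f (ζ 0) 0 := by
  have hcont : ∀ z ∈ ball (0 : ℂ) 1, ContinuousOn (f z) (Icc 0 t) := fun z hz u hu =>
    (hpde z hz u hu).continuousWithinAt
  set r₁ := (1 + r) / 2 with hr₁
  set ρ := (1 - r) / 4 with hρdef
  have hρ : 0 < ρ := by linarith
  obtain ⟨N₀, hN₀⟩ := isCompact_Icc.exists_bound_of_continuousOn
    (hcont r₁ (by
      rw [mem_ball_zero_iff, Complex.norm_real, Real.norm_eq_abs, abs_of_pos (by linarith)]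
      linarith))
  set N := N₀ * Real.exp (2048 / min r₁ (1 - r₁) * r₁ * (2 * Real.pi))
  have hN : ∀ u ∈ Icc 0 t, ∀ z : ℂ, ‖z‖ ≤ r₁ → ‖f z u‖ ≤ N := fun u hu z hz =>
    (norm_le_of_injOn_unitBall (by linarith) (by linarith) (hf u hu) (hinj u hu) (h0 u hu)
      hz).trans (mul_le_mul_of_nonneg_right (hN₀ u hu) (Real.exp_pos _).le)
  have hsub : ∀ s ∈ Icc 0 t, ball (ζ s) ρ ⊆ ball 0 1 := fun s hs =>
    ball_subset_ball' (by rw [dist_zero_right]; linarith [hζr s hs])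
  have hA : ∀ s ∈ Icc 0 t, ∀ u ∈ Icc 0 t, ∀ z ∈ ball (ζ s) ρ,
      ‖deriv (fun z => f z u) z‖ ≤ N / ρ := by
    intro s hs u hu z hz
    rw [mem_ball, dist_eq_norm] at hz
    have hzn : ‖z‖ ≤ r + ρ := by
      linarith [norm_le_norm_add_norm_sub (ζ s) z, hζr s hs, norm_sub_rev z (ζ s)]
    have hb : ∀ w ∈ closedBall z ρ, ‖w‖ ≤ r₁ := fun w hw => by
      rw [mem_closedBall, dist_eq_norm] at hw
      linarith [norm_le_norm_add_norm_sub z w, norm_sub_rev z w]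
    refine Complex.norm_deriv_le_of_forall_mem_sphere_norm_le hρ
      (((hf u hu).mono fun w hw => ?_).diffContOnCl_ball subset_rfl)
      fun w hw => hN u hu w (hb w (sphere_subset_closedBall hw))
    rw [mem_ball_zero_iff]
    linarith [hb w hw]
  have hd : ∀ s ∈ Icc 0 t, HasDerivWithinAt (fun u => f (ζ u) u) 0 (Icc 0 t) s := by
    intro s hs
    have := hasDerivWithinAt_apply_curve hρ hs (fun u hu => (hf u hu).mono (hsub s hs)) (hA s hs)
      (fun z hz => hcont z (hsub s hs hz)) (hpde _ (hsub s hs (mem_ball_self hρ)) s hs) (hζ s hs)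
    convert this using 1
    ring
  exact constant_of_derivWithin_zero (fun s hs => (hd s hs).differentiableWithinAt)
    (fun s hs => (hd s (Ico_subset_Icc_self hs)).derivWithin
      (uniqueDiffOn_Icc ht s (Ico_subset_Icc_self hs))) t (right_mem_Icc.2 ht.le)

/-- Solutions of an ODE with bounded, globally Lipschitz right-hand side exist on the whole
interval. -/
lemma exists_forall_hasDerivWithinAt_Icc_of_lipschitz_of_bounded {v : ℝ → ℂ → ℂ} {a b : ℝ}
    {L K : NNReal} {t₀ : ℝ} (ht₀ : t₀ ∈ Icc a b) (hK : ∀ s ∈ Icc a b, LipschitzWith K (v s))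
    (hcont : ∀ x, ContinuousOn (fun s => v s x) (Icc a b))
    (hL : ∀ s ∈ Icc a b, ∀ x, ‖v s x‖ ≤ L) (x : ℂ) :
    ∃ α : ℝ → ℂ, α t₀ = x ∧ ∀ s ∈ Icc a b, HasDerivWithinAt α (v s (α s)) (Icc a b) s := by
  have h : IsPicardLindelof v (⟨t₀, ht₀⟩ : Icc a b) x (L * (b - a).toNNReal) 0 L K :=
    { lipschitzOnWith := fun s hs => (hK s hs).lipschitzOnWith
      continuousOn := fun x _ => hcont x
      norm_le := fun s hs x _ => hL s hs x
      mul_max_le := by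
        have : a ≤ b := ht₀.1.trans ht₀.2
        rw [NNReal.coe_mul, Real.coe_toNNReal _ (by linarith), NNReal.coe_zero, sub_zero]
        gcongr
        exact max_le (by linarith [ht₀.1]) (by linarith [ht₀.2]) }
  exact h.exists_eq_forall_mem_Icc_hasDerivWithinAt₀

/-- The retraction of the plane onto the half-plane `Re z ≤ a`. -/
def clampRe (a : ℝ) (z : ℂ) : ℂ := ⟨min z.re a, z.im⟩

lemma clampRe_of_re_le {a : ℝ} {z : ℂ} (h : z.re ≤ a) : clampRe a z = z :=
  Complex.ext (min_eq_left h) rfl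

lemma norm_clampRe_sub_le (a : ℝ) (z w : ℂ) : ‖clampRe a z - clampRe a w‖ ≤ ‖z - w‖ := by
  rw [← sq_le_sq₀ (norm_nonneg _) (norm_nonneg _), ← Complex.normSq_eq_norm_sq,
    ← Complex.normSq_eq_norm_sq, Complex.normSq_apply, Complex.normSq_apply]
  have h : |min z.re a - min w.re a| ≤ |z.re - w.re| := by
    have := abs_min_sub_min_le_max z.re a w.re a
    simpa using this
  have := sq_le_sq.2 h
  simp only [clampRe, Complex.sub_re, Complex.sub_im]
  linarith

lemma norm_exp_sub_exp_le_of_re_nonpos {z w : ℂ} (hz : z.re ≤ 0) (hw : w.re ≤ 0) :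
    ‖Complex.exp z - Complex.exp w‖ ≤ ‖z - w‖ := by
  have := (convex_halfSpace_re_le 0).norm_image_sub_le_of_norm_hasDerivWithin_le (𝕜 := ℂ)
    (C := 1) (f := Complex.exp) (fun x _ => (Complex.hasDerivAt_exp x).hasDerivWithinAt)
    (fun x hx => by rw [Complex.norm_exp]; exact Real.exp_le_one_iff.2 hx) hw hz
  simpa using this

/-- Two solutions of a `K`-Lipschitz ODE whose initial difference is a nonnegative real number keep
the order of their real parts for small time. -/
lemma re_le_re_of_lipschitz_of_small_time {v : ℝ → ℂ → ℂ} {K : NNReal} {t : ℝ} {Z W : ℝ → ℂ}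
    (hK : ∀ s ∈ Icc 0 t, LipschitzWith K (v s)) (hsmall : 3 * K * t ≤ 1)
    (hZ : ∀ s ∈ Icc 0 t, HasDerivWithinAt Z (v s (Z s)) (Icc 0 t) s)
    (hW : ∀ s ∈ Icc 0 t, HasDerivWithinAt W (v s (W s)) (Icc 0 t) s)
    {d : ℝ} (hd : 0 ≤ d) (h0 : Z 0 - W 0 = d) {s : ℝ} (hs : s ∈ Icc 0 t) :
    (W s).re ≤ (Z s).re := by
  have hIci : ∀ {X : ℝ → ℂ}, (∀ s ∈ Icc 0 t, HasDerivWithinAt X (v s (X s)) (Icc 0 t) s) →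
      ∀ s ∈ Ico 0 t, HasDerivWithinAt X (v s (X s)) (Ici s) s := fun hX s hs =>
    ((hX s (Ico_subset_Icc_self hs)).mono (Icc_subset_Icc_left hs.1)).mono_of_mem_nhdsWithin
      (Icc_mem_nhdsGE hs.2)
  have hgr := dist_le_of_trajectories_ODE_of_mem (v := v) (K := K) (s := fun _ => univ) (δ := d)
    (fun s hs => (hK s (Ico_subset_Icc_self hs)).lipschitzOnWith)
    (fun s hs => (hZ s hs).continuousWithinAt) (hIci hZ) (fun _ _ => mem_univ _)
    (fun s hs => (hW s hs).continuousWithinAt) (hIci hW) (fun _ _ => mem_univ _)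
    (by rw [dist_eq_norm, h0, Complex.norm_real, Real.norm_eq_abs, abs_of_nonneg hd])
  have hKt : (K : ℝ) * t ≤ 1 / 3 := by linarith
  have hexp : Real.exp (1 / 3) ≤ 3 :=
    (Real.exp_le_exp.2 (by norm_num)).trans Real.exp_one_lt_three.le
  have hbound : ∀ s ∈ Ico 0 t, ‖v s (Z s) - v s (W s)‖ ≤ K * (d * 3) := fun s hs => by
    rw [← dist_eq_norm]
    refine ((hK s (Ico_subset_Icc_self hs)).dist_le_mul _ _).trans ?_
    gcongr
    refine (hgr s (Ico_subset_Icc_self hs)).trans ?_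
    gcongr
    refine (Real.exp_le_exp.2 ?_).trans hexp
    rw [sub_zero]
    exact (mul_le_mul_of_nonneg_left hs.2.le K.2).trans hKt
  have hdiff := norm_image_sub_le_of_norm_deriv_le_segment'
    (fun s hs => (hZ s hs).fun_sub (hW s hs)) hbound s hs
  rw [h0, sub_zero] at hdiff
  have hs3 : K * (d * 3) * s ≤ d := by
    have : 3 * K * s ≤ 1 := (mul_le_mul_of_nonneg_left hs.2 (by positivity)).trans hsmall
    nlinarith
  have hre := (Complex.abs_re_le_norm (Z s - W s - d)).trans (hdiff.trans hs3)
  simp only [Complex.sub_re, Complex.ofReal_re] at hre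
  linarith [(abs_le.1 hre).1]

/- STATEMENT 8 (Lemma 3, geometric form): Under the hypotheses on the
Carathéodory driving function `p` (C¹ on 𝔻̄, continuous in t, `p`, `p'`
bounded), for all sufficiently small t > 0 the image `Ω(t) = f(𝔻,t)` of the
Löwner–Kufarev solution is star-shaped with respect to the origin. -/
theorem loewner_kufarev_starlike_for_small_time
    (T : ℝ) (hT : 0 < T) (p p' : ℂ → ℝ → ℂ)
    -- Carathéodory class driving function
    (hp_hol : ∀ t ∈ Set.Ico (0:ℝ) T,
      DifferentiableOn ℂ (fun z => p z t) (Metric.ball (0:ℂ) 1))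
    (hp_cont : ∀ t ∈ Set.Ico (0:ℝ) T,
      ContinuousOn (fun z => p z t) (Metric.closedBall (0:ℂ) 1))
    (hp_one : ∀ t ∈ Set.Ico (0:ℝ) T, p 0 t = 1)
    (hp_re : ∀ t ∈ Set.Ico (0:ℝ) T, ∀ z ∈ Metric.ball (0:ℂ) 1, 0 < (p z t).re)
    -- p(·,t) is C¹ on 𝔻̄, continuous in t, with p, p' bounded on 𝔻̄ × [0,T)
    (hp' : ∀ t ∈ Set.Ico (0:ℝ) T, ∀ z ∈ Metric.ball (0:ℂ) 1,
      HasDerivAt (fun x => p x t) (p' z t) z)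
    (hp'_cont : ∀ t ∈ Set.Ico (0:ℝ) T,
      ContinuousOn (fun z => p' z t) (Metric.closedBall (0:ℂ) 1))
    (hp_t : ∀ z ∈ Metric.closedBall (0:ℂ) 1, ContinuousOn (fun t => p z t) (Set.Ico 0 T))
    (M M' : ℝ)
    (hp_bdd : ∀ z ∈ Metric.closedBall (0:ℂ) 1, ∀ t ∈ Set.Ico (0:ℝ) T, ‖p z t‖ ≤ M)
    (hp'_bdd : ∀ z ∈ Metric.closedBall (0:ℂ) 1, ∀ t ∈ Set.Ico (0:ℝ) T, ‖p' z t‖ ≤ M')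
    -- f solves the Löwner–Kufarev PDE, with spatial derivative fz,
    -- f(z,0) = z, f(0,t) = 0, each f(·,t) univalent on 𝔻
    (f fz : ℂ → ℝ → ℂ)
    (hf_init : ∀ z ∈ Metric.ball (0:ℂ) 1, f z 0 = z)
    (hf_zero : ∀ t ∈ Set.Ico (0:ℝ) T, f 0 t = 0)
    (hf_hol : ∀ t ∈ Set.Ico (0:ℝ) T,
      DifferentiableOn ℂ (fun z => f z t) (Metric.ball (0:ℂ) 1))
    (hf_inj : ∀ t ∈ Set.Ico (0:ℝ) T,
      Set.InjOn (fun z => f z t) (Metric.ball (0:ℂ) 1))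
    (hfz : ∀ t ∈ Set.Ico (0:ℝ) T, ∀ z ∈ Metric.ball (0:ℂ) 1,
      HasDerivAt (fun x => f x t) (fz z t) z)
    (hf_pde : ∀ z ∈ Metric.ball (0:ℂ) 1, ∀ t ∈ Set.Ico (0:ℝ) T,
      HasDerivWithinAt (fun u => f z u) (-(z * fz z t * p z t)) (Set.Ico 0 T) t) :
    ∃ t₀ > 0, ∀ t, 0 < t → t < t₀ → t < T →
      ∀ w ∈ (fun z => f z t) '' Metric.ball (0:ℂ) 1,
        ∀ l ∈ Set.Icc (0:ℝ) 1,
          (l : ℂ) * w ∈ (fun z => f z t) '' Metric.ball (0:ℂ) 1 := by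
  have hM0 : 0 ≤ M := (norm_nonneg _).trans
    (hp_bdd 0 (mem_closedBall_self zero_le_one) 0 (left_mem_Ico.2 hT))
  have hM'0 : 0 ≤ M' := (norm_nonneg _).trans
    (hp'_bdd 0 (mem_closedBall_self zero_le_one) 0 (left_mem_Ico.2 hT))
  refine ⟨1 / (3 * (M' + 1)), by positivity, ?_⟩
  rintro t ht htt htT _ ⟨z, hz, rfl⟩ l hl
  have hsmall : 3 * M' * t ≤ 1 := by
    rw [lt_div_iff₀ (by positivity)] at htt
    nlinarith
  have htmem : t ∈ Ico 0 T := ⟨ht.le, htT⟩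
  have hsub : Icc 0 t ⊆ Ico 0 T := fun s hs => ⟨hs.1, hs.2.trans_lt htT⟩
  have hzero : (0 : ℂ) ∈ (fun z => f z t) '' ball 0 1 :=
    ⟨0, mem_ball_self one_pos, hf_zero t htmem⟩
  rcases hl.1.eq_or_lt with rfl | hl0
  · simpa using hzero
  rcases eq_or_ne z 0 with rfl | hz0
  · simpa [hf_zero t htmem] using hzero
  set r := ‖z‖ with hrdef
  have hr : 0 < r := norm_pos_iff.2 hz0
  have hr1 : r < 1 := by simpa using hz
  have hlogr : Real.log r < 0 := Real.log_neg hr hr1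
  have hexp_norm : ∀ x : ℂ, x.re ≤ Real.log r → ‖Complex.exp x‖ ≤ r := fun x hx => by
    rw [Complex.norm_exp]
    exact (Real.exp_le_exp.2 hx).trans (Real.exp_log hr).le
  have hclamp : ∀ x : ℂ, (clampRe (Real.log r) x).re ≤ Real.log r := fun x => min_le_right _ _
  have hmem : ∀ x : ℂ, Complex.exp (clampRe (Real.log r) x) ∈ ball (0 : ℂ) 1 := fun x => by
    rw [mem_ball_zero_iff]
    exact (hexp_norm _ (hclamp x)).trans_lt hr1
  set v : ℝ → ℂ → ℂ := fun s x => p (Complex.exp (clampRe (Real.log r) x)) s with hv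
  have hlip : ∀ s ∈ Icc 0 t, LipschitzWith M'.toNNReal (v s) := fun s hs => by
    refine LipschitzWith.of_dist_le_mul fun x y => ?_
    rw [Real.coe_toNNReal _ hM'0, dist_eq_norm, dist_eq_norm]
    refine ((convex_ball (0 : ℂ) 1).norm_image_sub_le_of_norm_hasDerivWithin_le (𝕜 := ℂ)
      (fun w hw => (hp' s (hsub hs) w hw).hasDerivWithinAt)
      (fun w hw => hp'_bdd w (ball_subset_closedBall hw) s (hsub hs)) (hmem y) (hmem x)).trans ?_
    gcongr
    exact (norm_exp_sub_exp_le_of_re_nonpos ((hclamp x).trans hlogr.le)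
      ((hclamp y).trans hlogr.le)).trans (norm_clampRe_sub_le _ _ _)
  have hvcont : ∀ x, ContinuousOn (fun s => v s x) (Icc 0 t) := fun x =>
    (hp_t _ (ball_subset_closedBall (hmem x))).mono hsub
  have hvbdd : ∀ s ∈ Icc 0 t, ∀ x, ‖v s x‖ ≤ M.toNNReal := fun s hs x => by
    rw [Real.coe_toNNReal _ hM0]
    exact hp_bdd _ (ball_subset_closedBall (hmem x)) s (hsub hs)
  obtain ⟨Z, hZt, hZ⟩ := exists_forall_hasDerivWithinAt_Icc_of_lipschitz_of_bounded
    (right_mem_Icc.2 ht.le) hlip hvcont hvbdd (Complex.log z)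
  obtain ⟨W, hW0, hW⟩ := exists_forall_hasDerivWithinAt_Icc_of_lipschitz_of_bounded
    (left_mem_Icc.2 ht.le) hlip hvcont hvbdd (Z 0 + Real.log l)
  have hZmono : MonotoneOn (fun s => (Z s).re) (Icc 0 t) :=
    monotoneOn_of_hasDerivWithinAt_nonneg (convex_Icc 0 t)
      (Complex.continuous_re.comp_continuousOn fun s hs => (hZ s hs).continuousWithinAt)
      (f' := fun s => (v s (Z s)).re)
      (fun s hs => (Complex.reCLM.hasFDerivAt.comp_hasDerivWithinAt s
        (hZ s (interior_subset hs))).mono interior_subset)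
      (fun s hs => (hp_re s (hsub (interior_subset hs)) _ (hmem _)).le)
  have hZre : ∀ s ∈ Icc 0 t, (Z s).re ≤ Real.log r := fun s hs => by
    have := hZmono hs (right_mem_Icc.2 ht.le) hs.2
    simpa only [hZt, Complex.log_re] using this
  have hWre : ∀ s ∈ Icc 0 t, (W s).re ≤ Real.log r := fun s hs =>
    (re_le_re_of_lipschitz_of_small_time hlip (by rwa [Real.coe_toNNReal _ hM'0]) hZ hW
      (d := -Real.log l) (neg_nonneg.2 (Real.log_nonpos hl.1 hl.2)) (by rw [hW0]; push_cast; ring)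
      hs).trans (hZre s hs)
  have hconst : ∀ X : ℝ → ℂ, (∀ s ∈ Icc 0 t, (X s).re ≤ Real.log r) →
      (∀ s ∈ Icc 0 t, HasDerivWithinAt X (v s (X s)) (Icc 0 t) s) →
      f (Complex.exp (X t)) t = Complex.exp (X 0) := by
    intro X hXre hX
    have := loewnerKufarev_apply_characteristic (f := f) (p := p) (ζ := fun s => Complex.exp (X s))
      hr hr1 ht (fun u hu => hf_hol u (hsub hu)) (fun u hu => hf_inj u (hsub hu))
      (fun u hu => hf_zero u (hsub hu))
      (fun x hx u hu => by
        rw [(hfz u (hsub hu) x hx).deriv]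
        exact (hf_pde x hx u (hsub hu)).mono hsub)
      (fun s hs => hexp_norm _ (hXre s hs))
      (fun s hs => by
        have := (hX s hs).cexp
        simp only [hv] at this
        rwa [clampRe_of_re_le (hXre s hs)] at this)
    rw [this, hf_init]
    rw [mem_ball_zero_iff]
    exact (hexp_norm _ (hXre 0 (left_mem_Icc.2 ht.le))).trans_lt hr1
  have hfz_eq := hconst Z hZre hZ
  have hfW := hconst W hWre hW
  rw [hZt, Complex.exp_log hz0] at hfz_eq
  refine ⟨Complex.exp (W t), ?_, ?_⟩
  · rw [mem_ball_zero_iff]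
    exact (hexp_norm _ (hWre t (right_mem_Icc.2 ht.le))).trans_lt hr1
  · change f (Complex.exp (W t)) t = l * f z t
    rw [hfW, hW0, Complex.exp_add, hfz_eq, ← Complex.ofReal_exp, Real.exp_log hl0, mul_comm]
end

section
/- Let p be a driving function from the Carathéodory class, C² on 𝔻̄ for each t, continuous in t, with p, p' = ∂p/∂z, p'' = ∂²p/∂z² bounded on 𝔻̄ × [0,T). Fix s ∈ [0,T) and let h(ζ,t) solve dh/dt = -h·p(h, s-t), h(ζ,0) = ζ, ζ ∈ 𝔻, 0 ≤ t ≤ s, with h' = ∂h/∂ζ; let f(ζ,s) = h(ζ,s), f' = ∂f/∂ζ, f'' = ∂²f/∂ζ². Then for every ζ ∈ 𝔻, ζ·f''(ζ,s)/f'(ζ,s) = ζ·f'(ζ,s)/f(ζ,s) - 1 - ∫₀ˢ (ζ·h'(ζ,t)·p'(h(ζ,t), s-t) + ζ·h(ζ,t)·h'(ζ,t)·p''(h(ζ,t), s-t)) dt. -/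
section LoewnerFlow

open Set Filter Topology MeasureTheory

/-- A solution of the scalar linear equation `y' = -a y`, with `a` continuous, is given by the
exponential of the primitive of `-a`. -/
theorem eq_mul_exp_neg_integral_of_hasDerivAt {b : ℝ} (hb : 0 ≤ b) {y a : ℝ → ℂ}
    (hy : ContinuousOn y (Icc 0 b)) (ha : ContinuousOn a (Icc 0 b))
    (h : ∀ t ∈ Ioo 0 b, HasDerivAt y (-(a t * y t)) t) :
    y b = y 0 * Complex.exp (-∫ t in (0 : ℝ)..b, a t) := by
  have hA : ContinuousOn (fun t => ∫ τ in (0 : ℝ)..t, a τ) (Icc 0 b) := by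
    have := intervalIntegral.continuousOn_primitive_interval (f := a) (μ := volume) (a := 0) (b := b)
      (by rw [uIcc_of_le hb]; exact ha.integrableOn_Icc)
    rwa [uIcc_of_le hb] at this
  have hd : ∀ t ∈ Ioo 0 b, HasDerivAt (fun t => ∫ τ in (0 : ℝ)..t, a τ) (a t) t := by
    intro t ht
    refine intervalIntegral.integral_hasDerivAt_right ?_ ?_ ?_
    · exact (ha.mono (Icc_subset_Icc_right ht.2.le)).intervalIntegrable_of_Icc ht.1.le
    · exact (ha.mono Ioo_subset_Icc_self).stronglyMeasurableAtFilter isOpen_Ioo t ht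
    · exact ha.continuousAt (Icc_mem_nhds ht.1 ht.2)
  have key := intervalIntegral.integral_eq_sub_of_hasDerivAt_of_le hb
    (f := fun t => y t * Complex.exp (∫ τ in (0 : ℝ)..t, a τ)) (f' := fun _ => 0)
    (hy.mul hA.cexp) (fun t ht => ((h t ht).fun_mul (hd t ht).cexp).congr_deriv (by ring))
    intervalIntegrable_const
  simp only [intervalIntegral.integral_zero, intervalIntegral.integral_same, Complex.exp_zero,
    mul_one] at key
  rw [← sub_eq_zero.mp key.symm, mul_assoc, ← Complex.exp_add]
  simp

section Family

variable {r r' : ℂ → ℝ → ℂ} {J : Set ℝ} {C : ℝ}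

theorem lipschitzOnWith_ball_of_hasDerivAt {f f' : ℂ → ℂ}
    (hr : ∀ z ∈ Metric.ball (0 : ℂ) 1, HasDerivAt f (f' z) z)
    (hC : ∀ z ∈ Metric.ball (0 : ℂ) 1, ‖f' z‖ ≤ C) :
    LipschitzOnWith C.toNNReal f (Metric.ball 0 1) :=
  (convex_ball 0 1).lipschitzOnWith_of_nnnorm_hasDerivWithin_le
    (fun z hz => (hr z hz).hasDerivWithinAt) fun z hz => by
      rw [← NNReal.coe_le_coe]
      exact (hC z hz).trans (Real.le_coe_toNNReal C)

/-- For a family of functions on the disk with uniformly bounded derivatives, continuous in the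
parameter, the derivative is continuous in the parameter too. -/
theorem continuousOn_deriv_param
    (hr : ∀ t ∈ J, ∀ z ∈ Metric.ball (0 : ℂ) 1, HasDerivAt (fun x => r x t) (r' z t) z)
    (hC : ∀ z ∈ Metric.ball (0 : ℂ) 1, ∀ t ∈ J, ‖r' z t‖ ≤ C)
    (hrt : ∀ z ∈ Metric.ball (0 : ℂ) 1, ContinuousOn (r z) J) :
    ∀ z ∈ Metric.ball (0 : ℂ) 1, ContinuousOn (r' z) J := by
  intro z hz t ht
  have hlip := fun t (ht : t ∈ J) =>
    lipschitzOnWith_ball_of_hasDerivAt (hr t ht) (fun z hz => hC z hz t ht)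
  have hloc : TendstoLocallyUniformlyOn (fun (τ : ℝ) x => r x τ) (fun x => r x t) (𝓝[J] t)
      (Metric.ball 0 1) := by
    rw [Metric.tendstoLocallyUniformlyOn_iff]
    intro ε hε x hx
    set K : ℝ := (C.toNNReal : ℝ)
    have hK : 0 ≤ K := NNReal.coe_nonneg _
    have hδ : 0 < ε / (3 * (K + 1)) := by positivity
    refine ⟨Metric.ball x (ε / (3 * (K + 1))) ∩ Metric.ball 0 1,
      inter_mem (mem_nhdsWithin_of_mem_nhds (Metric.ball_mem_nhds _ hδ)) self_mem_nhdsWithin, ?_⟩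
    filter_upwards [Metric.tendsto_nhds.mp (hrt x hx t ht) (ε / 3) (by positivity),
      self_mem_nhdsWithin] with τ hτ hτJ y hy
    have hyx : K * dist y x ≤ ε / 3 := by
      calc K * dist y x ≤ (K + 1) * (ε / (3 * (K + 1))) := by
            gcongr
            · linarith
            · exact (Metric.mem_ball.mp hy.1).le
        _ = ε / 3 := by field_simp
    have h1 := (hlip t ht).dist_le_mul y hy.2 x hx
    have h2 := (hlip τ hτJ).dist_le_mul x hx y hy.2
    rw [dist_comm x y] at h2
    rw [dist_comm] at hτ
    calc dist (r y t) (r y τ) ≤ dist (r y t) (r x t) + dist (r x t) (r x τ)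
          + dist (r x τ) (r y τ) := dist_triangle4 _ _ _ _
      _ < ε := by linarith
  have hev : ∀ᶠ τ in 𝓝[J] t, DifferentiableOn ℂ (fun x => r x τ) (Metric.ball 0 1) :=
    eventually_mem_nhdsWithin.mono fun τ hτ x hx =>
      (hr τ hτ x hx).differentiableAt.differentiableWithinAt
  have hder := (hloc.deriv hev Metric.isOpen_ball).tendsto_at hz
  rw [(hr t ht z hz).deriv] at hder
  refine hder.congr' (eventually_mem_nhdsWithin.mono fun τ hτ => ?_)
  exact (hr τ hτ z hz).deriv

/-- Evaluating such a family along a continuous curve in the disk gives a continuous function. -/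
theorem continuousOn_comp_curve
    (hr : ∀ t ∈ J, ∀ z ∈ Metric.ball (0 : ℂ) 1, HasDerivAt (fun x => r x t) (r' z t) z)
    (hC : ∀ z ∈ Metric.ball (0 : ℂ) 1, ∀ t ∈ J, ‖r' z t‖ ≤ C)
    (hrt : ∀ z ∈ Metric.ball (0 : ℂ) 1, ContinuousOn (r z) J)
    {γ : ℝ → ℂ} (hγ : ContinuousOn γ J) (hγm : ∀ t ∈ J, γ t ∈ Metric.ball (0 : ℂ) 1) :
    ContinuousOn (fun t => r (γ t) t) J := by
  have hj : ContinuousOn (fun w : ℂ × ℝ => r w.1 w.2) (Metric.ball 0 1 ×ˢ J) :=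
    continuousOn_prod_of_continuousOn_lipschitzOnWith _ C.toNNReal hrt fun t ht =>
      lipschitzOnWith_ball_of_hasDerivAt (hr t ht) (fun z hz => hC z hz t ht)
  exact hj.comp (hγ.prodMk continuousOn_id) fun t ht => ⟨hγm t ht, ht⟩

variable {h hd : ℂ → ℝ → ℂ} {s : ℝ}

/-- Differentiation of `∫ r (h ζ τ) τ` in `ζ`, for a family of holomorphic self-maps `h` of the
disk. -/
theorem hasDerivAt_integral_comp_flow
    (hr : ∀ t ∈ Icc 0 s, ∀ z ∈ Metric.ball (0 : ℂ) 1, HasDerivAt (fun x => r x t) (r' z t) z)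
    (hC : ∀ z ∈ Metric.ball (0 : ℂ) 1, ∀ t ∈ Icc 0 s, ‖r' z t‖ ≤ C)
    (hrt : ∀ z ∈ Metric.ball (0 : ℂ) 1, ContinuousOn (r z) (Icc 0 s))
    (hmem : ∀ ζ ∈ Metric.ball (0 : ℂ) 1, ∀ t ∈ Icc 0 s, h ζ t ∈ Metric.ball (0 : ℂ) 1)
    (hcont : ∀ ζ ∈ Metric.ball (0 : ℂ) 1, ContinuousOn (h ζ) (Icc 0 s))
    (hhd : ∀ t ∈ Icc 0 s, ∀ ζ ∈ Metric.ball (0 : ℂ) 1, HasDerivAt (fun x => h x t) (hd ζ t) ζ)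
    {ζ : ℂ} (hζ : ζ ∈ Metric.ball (0 : ℂ) 1) {b : ℝ} (hb : b ∈ Icc 0 s) :
    IntervalIntegrable (fun t => r' (h ζ t) t * hd ζ t) volume 0 b ∧
      HasDerivAt (fun x => ∫ t in (0 : ℝ)..b, r (h x t) t)
        (∫ t in (0 : ℝ)..b, r' (h ζ t) t * hd ζ t) ζ := by
  have hsub : Icc 0 b ⊆ Icc 0 s := Icc_subset_Icc_right hb.2
  have hioc : uIoc 0 b ⊆ Icc 0 b := by rw [uIoc_of_le hb.1]; exact Ioc_subset_Icc_self
  have hioc' := hioc.trans hsub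
  have hF : ∀ x ∈ Metric.ball (0 : ℂ) 1, ContinuousOn (fun t => r (h x t) t) (Icc 0 s) :=
    fun x hx => continuousOn_comp_curve hr hC hrt (hcont x hx) (hmem x hx)
  have hFm : ∀ x ∈ Metric.ball (0 : ℂ) 1,
      AEStronglyMeasurable (fun t => r (h x t) t) (volume.restrict (uIoc 0 b)) := fun x hx =>
    ((hF x hx).mono hioc').aestronglyMeasurable measurableSet_uIoc
  have hF' : ∀ t ∈ Icc 0 s, ∀ x ∈ Metric.ball (0 : ℂ) 1,
      HasDerivAt (fun x => r (h x t) t) (r' (h x t) t * hd x t) x := fun t ht x hx =>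
    HasDerivAt.comp (h₂ := fun z => r z t) x (hr t ht _ (hmem x hx t ht)) (hhd t ht x hx)
  set R : ℝ := (1 - ‖ζ‖) / 2 with hR
  have hζ1 : ‖ζ‖ < 1 := by simpa using hζ
  have hR0 : 0 < R := by rw [hR]; linarith
  have hball : ∀ x ∈ Metric.ball ζ R, Metric.closedBall x R ⊆ Metric.ball (0 : ℂ) 1 := by
    intro x hx y hy
    rw [mem_ball_zero_iff]
    have h1 := Metric.mem_ball.mp hx
    have h2 := Metric.mem_closedBall.mp hy
    rw [hR] at h1 h2
    have h4 := dist_triangle y x ζ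
    have h5 : ‖y‖ ≤ dist y ζ + ‖ζ‖ := by simpa using dist_triangle y ζ 0
    linarith
  have hin : ∀ x ∈ Metric.ball ζ R, x ∈ Metric.ball (0 : ℂ) 1 := fun x hx =>
    hball x hx (Metric.mem_closedBall_self hR0.le)
  have hdb : ∀ t ∈ Icc 0 s, ∀ x ∈ Metric.ball ζ R, ‖hd x t‖ ≤ 1 / R := by
    intro t ht x hx
    rw [← (hhd t ht x (hin x hx)).deriv]
    refine Complex.norm_deriv_le_of_forall_mem_sphere_norm_le hR0 ?_ ?_
    · refine DifferentiableOn.diffContOnCl_ball (U := Metric.ball (0 : ℂ) 1) ?_ (hball x hx)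
      exact fun y hy => (hhd t ht y hy).differentiableAt.differentiableWithinAt
    · intro y hy
      have := hmem y (hball x hx (Metric.sphere_subset_closedBall hy)) t ht
      exact (mem_ball_zero_iff.mp this).le
  refine intervalIntegral.hasDerivAt_integral_of_dominated_loc_of_deriv_le
    (F' := fun x t => r' (h x t) t * hd x t) (bound := fun _ => C * (1 / R))
    (Metric.ball_mem_nhds ζ hR0) ?_ ?_ ?_ ?_ ?_ ?_
  · filter_upwards [Metric.ball_mem_nhds ζ hR0] with x hx using hFm x (hin x hx)
  · exact ((hF ζ hζ).mono hsub).intervalIntegrable_of_Icc hb.1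
  · have hε : ∀ n : ℕ, 0 < R / (n + 2) := fun n => by positivity
    have hlim : Tendsto (fun n : ℕ => ζ + ((R / (n + 2) : ℝ) : ℂ)) atTop (𝓝[≠] ζ) := by
      refine tendsto_nhdsWithin_iff.mpr ⟨?_, Eventually.of_forall fun n => ?_⟩
      · have h0 : Tendsto (fun n : ℕ => R / ((n : ℝ) + 2)) atTop (𝓝 0) :=
          tendsto_const_nhds.div_atTop
            (tendsto_atTop_add_const_right _ _ tendsto_natCast_atTop_atTop)
        have := ((Complex.continuous_ofReal.tendsto 0).comp h0).const_add ζ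
        simpa using this
      · have := (hε n).ne'
        simpa only [mem_compl_iff, mem_singleton_iff, add_eq_left, Complex.ofReal_eq_zero]
          using this
    refine aestronglyMeasurable_of_tendsto_ae atTop
      (f := fun (n : ℕ) t => slope (fun x => r (h x t) t) ζ (ζ + ((R / (n + 2) : ℝ) : ℂ))) ?_ ?_
    · intro n
      simp only [slope_def_module]
      refine ((hFm _ (hin _ ?_)).fun_sub (hFm ζ hζ)).fun_const_smul _
      rw [Metric.mem_ball, dist_eq_norm, add_sub_cancel_left, Complex.norm_real,
        Real.norm_of_nonneg (hε n).le]
      exact div_lt_self hR0 (by linarith [(Nat.cast_nonneg n : (0 : ℝ) ≤ n)])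
    · filter_upwards [ae_restrict_mem measurableSet_uIoc] with t ht
      exact (hF' t (hioc' ht) ζ hζ).tendsto_slope.comp hlim
  · refine Eventually.of_forall fun t ht x hx => ?_
    rw [norm_mul]
    have hc := hC _ (hmem x (hin x hx) t (hioc' ht)) t (hioc' ht)
    exact mul_le_mul hc (hdb t (hioc' ht) x hx) (norm_nonneg _) ((norm_nonneg _).trans hc)
  · simp
  · exact Eventually.of_forall fun t ht x hx => hF' t (hioc' ht) x (hin x hx)

/-- The spatial derivative of the flow of `dh/dt = -r(h, t)` satisfies the variational equation,
in its integrated form. -/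
theorem hasDerivAt_flow_eq_exp {r'' : ℂ → ℝ → ℂ} {C' : ℝ}
    (hr : ∀ t ∈ Icc 0 s, ∀ z ∈ Metric.ball (0 : ℂ) 1, HasDerivAt (fun x => r x t) (r' z t) z)
    (hC : ∀ z ∈ Metric.ball (0 : ℂ) 1, ∀ t ∈ Icc 0 s, ‖r' z t‖ ≤ C)
    (hrt : ∀ z ∈ Metric.ball (0 : ℂ) 1, ContinuousOn (r z) (Icc 0 s))
    (hr' : ∀ t ∈ Icc 0 s, ∀ z ∈ Metric.ball (0 : ℂ) 1, HasDerivAt (fun x => r' x t) (r'' z t) z)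
    (hC' : ∀ z ∈ Metric.ball (0 : ℂ) 1, ∀ t ∈ Icc 0 s, ‖r'' z t‖ ≤ C')
    (hinit : ∀ ζ ∈ Metric.ball (0 : ℂ) 1, h ζ 0 = ζ)
    (hmem : ∀ ζ ∈ Metric.ball (0 : ℂ) 1, ∀ t ∈ Icc 0 s, h ζ t ∈ Metric.ball (0 : ℂ) 1)
    (hode : ∀ ζ ∈ Metric.ball (0 : ℂ) 1, ∀ t ∈ Icc 0 s,
      HasDerivWithinAt (h ζ) (-r (h ζ t) t) (Icc 0 s) t)
    (hhd : ∀ t ∈ Icc 0 s, ∀ ζ ∈ Metric.ball (0 : ℂ) 1, HasDerivAt (fun x => h x t) (hd ζ t) ζ)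
    (hs : 0 ≤ s) {ζ : ℂ} (hζ : ζ ∈ Metric.ball (0 : ℂ) 1) :
    ContinuousOn (hd ζ) (Icc 0 s) ∧
      hd ζ s = Complex.exp (-∫ t in (0 : ℝ)..s, r' (h ζ t) t) := by
  have hcont : ∀ ζ ∈ Metric.ball (0 : ℂ) 1, ContinuousOn (h ζ) (Icc 0 s) := fun ζ hζ t ht =>
    (hode ζ hζ t ht).continuousWithinAt
  have hflow : ∀ b ∈ Icc 0 s, ∀ x ∈ Metric.ball (0 : ℂ) 1,
      h x b = x - ∫ t in (0 : ℝ)..b, r (h x t) t := by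
    intro b hb x hx
    have hsub : Icc 0 b ⊆ Icc 0 s := Icc_subset_Icc_right hb.2
    have hF := (continuousOn_comp_curve hr hC hrt (hcont x hx) (hmem x hx)).mono hsub
    have := intervalIntegral.integral_eq_sub_of_hasDerivAt_of_le hb.1 ((hcont x hx).mono hsub)
      (fun t ht => (hode x hx t (hsub (Ioo_subset_Icc_self ht))).hasDerivAt
        (Icc_mem_nhds ht.1 (ht.2.trans_le hb.2))) (hF.neg.intervalIntegrable_of_Icc hb.1)
    rw [intervalIntegral.integral_neg, hinit x hx] at this
    linear_combination -this
  have hI := fun b (hb : b ∈ Icc 0 s) =>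
    hasDerivAt_integral_comp_flow hr hC hrt hmem hcont hhd hζ hb
  have hvar : ∀ b ∈ Icc 0 s, hd ζ b = 1 - ∫ t in (0 : ℝ)..b, r' (h ζ t) t * hd ζ t := by
    intro b hb
    refine (hhd b hb ζ hζ).unique (((hasDerivAt_id ζ).sub (hI b hb).2).congr_of_eventuallyEq ?_)
    filter_upwards [Metric.isOpen_ball.mem_nhds hζ] with x hx using hflow b hb x hx
  have hs' : s ∈ Icc 0 s := ⟨hs, le_rfl⟩
  have hhdc : ContinuousOn (hd ζ) (Icc 0 s) := by
    refine ContinuousOn.congr (continuousOn_const.sub ?_) hvar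
    have := intervalIntegral.continuousOn_primitive_interval
      (f := fun t => r' (h ζ t) t * hd ζ t) (μ := volume) (a := 0) (b := s) (by
        rw [uIcc_of_le hs, integrableOn_Icc_iff_integrableOn_Ioc]
        exact (intervalIntegrable_iff_integrableOn_Ioc_of_le hs).mp (hI s hs').1)
    rwa [uIcc_of_le hs] at this
  have hr'c : ContinuousOn (fun t => r' (h ζ t) t) (Icc 0 s) :=
    continuousOn_comp_curve hr' hC' (continuousOn_deriv_param hr hC hrt) (hcont ζ hζ) (hmem ζ hζ)
  have hprod := hr'c.mul hhdc
  refine ⟨hhdc, ?_⟩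
  rw [eq_mul_exp_neg_integral_of_hasDerivAt hs hhdc hr'c, hvar 0 ⟨le_rfl, hs⟩]
  · simp
  · intro t ht
    have hder : HasDerivAt (fun b => 1 - ∫ t in (0 : ℝ)..b, r' (h ζ t) t * hd ζ t)
        (-(r' (h ζ t) t * hd ζ t)) t := by
      refine HasDerivAt.const_sub 1 (intervalIntegral.integral_hasDerivAt_right ?_ ?_ ?_)
      · exact (hI t (Ioo_subset_Icc_self ht)).1
      · exact (hprod.mono Ioo_subset_Icc_self).stronglyMeasurableAtFilter isOpen_Ioo t ht
      · exact hprod.continuousAt (Icc_mem_nhds ht.1 ht.2)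
    refine hder.congr_of_eventuallyEq ?_
    filter_upwards [Icc_mem_nhds ht.1 ht.2] with b hb using hvar b hb

end Family

end LoewnerFlow


/- STATEMENT 11: For the time-reversed flow `h(ζ,t)` with spatial derivative
`h'`, whose value at time `s` is `f(ζ,s) = h(ζ,s)`, `f' = h'(·,s)`, and second
spatial derivative `f''`, one has on 𝔻:
`ζ·f''(ζ,s)/f'(ζ,s) = ζ·f'(ζ,s)/f(ζ,s) - 1
   - ∫₀ˢ (ζ·h'(ζ,t)·p'(h(ζ,t),s-t) + ζ·h(ζ,t)·h'(ζ,t)·p''(h(ζ,t),s-t)) dt`. -/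
theorem loewner_kufarev_zf''_over_f'_identity
    (T : ℝ) (hT : 0 < T) (p p' p'' : ℂ → ℝ → ℂ)
    -- Carathéodory class driving function
    (hp_hol : ∀ t ∈ Set.Ico (0:ℝ) T,
      DifferentiableOn ℂ (fun z => p z t) (Metric.ball (0:ℂ) 1))
    (hp_cont : ∀ t ∈ Set.Ico (0:ℝ) T,
      ContinuousOn (fun z => p z t) (Metric.closedBall (0:ℂ) 1))
    (hp_one : ∀ t ∈ Set.Ico (0:ℝ) T, p 0 t = 1)
    (hp_re : ∀ t ∈ Set.Ico (0:ℝ) T, ∀ z ∈ Metric.ball (0:ℂ) 1, 0 < (p z t).re)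
    -- p(·,t) is C² on 𝔻̄, continuous in t, with p, p', p'' bounded
    (hp' : ∀ t ∈ Set.Ico (0:ℝ) T, ∀ z ∈ Metric.ball (0:ℂ) 1,
      HasDerivAt (fun x => p x t) (p' z t) z)
    (hp'' : ∀ t ∈ Set.Ico (0:ℝ) T, ∀ z ∈ Metric.ball (0:ℂ) 1,
      HasDerivAt (fun x => p' x t) (p'' z t) z)
    (hp'_cont : ∀ t ∈ Set.Ico (0:ℝ) T,
      ContinuousOn (fun z => p' z t) (Metric.closedBall (0:ℂ) 1))
    (hp''_cont : ∀ t ∈ Set.Ico (0:ℝ) T,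
      ContinuousOn (fun z => p'' z t) (Metric.closedBall (0:ℂ) 1))
    (hp_t : ∀ z ∈ Metric.closedBall (0:ℂ) 1, ContinuousOn (fun t => p z t) (Set.Ico 0 T))
    (M M' M'' : ℝ)
    (hp_bdd : ∀ z ∈ Metric.closedBall (0:ℂ) 1, ∀ t ∈ Set.Ico (0:ℝ) T, ‖p z t‖ ≤ M)
    (hp'_bdd : ∀ z ∈ Metric.closedBall (0:ℂ) 1, ∀ t ∈ Set.Ico (0:ℝ) T, ‖p' z t‖ ≤ M')
    (hp''_bdd : ∀ z ∈ Metric.closedBall (0:ℂ) 1, ∀ t ∈ Set.Ico (0:ℝ) T, ‖p'' z t‖ ≤ M'')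
    -- fixed time s, the time-reversed flow h with spatial derivative hd,
    -- and hdd = second spatial derivative of h(·,s) (= f''(·,s))
    (s : ℝ) (hs : s ∈ Set.Ico (0:ℝ) T)
    (h hd : ℂ → ℝ → ℂ) (hdd : ℂ → ℂ)
    (hh_init : ∀ ζ ∈ Metric.ball (0:ℂ) 1, h ζ 0 = ζ)
    (hh_mem : ∀ ζ ∈ Metric.ball (0:ℂ) 1, ∀ t ∈ Set.Icc (0:ℝ) s,
      h ζ t ∈ Metric.ball (0:ℂ) 1)
    (hh_ode : ∀ ζ ∈ Metric.ball (0:ℂ) 1, ∀ t ∈ Set.Icc (0:ℝ) s,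
      HasDerivWithinAt (h ζ) (-(h ζ t * p (h ζ t) (s - t))) (Set.Icc 0 s) t)
    (hhd : ∀ t ∈ Set.Icc (0:ℝ) s, ∀ ζ ∈ Metric.ball (0:ℂ) 1,
      HasDerivAt (fun x => h x t) (hd ζ t) ζ)
    (hhdd : ∀ ζ ∈ Metric.ball (0:ℂ) 1,
      HasDerivAt (fun x => hd x s) (hdd ζ) ζ) :
    ∀ ζ ∈ Metric.ball (0:ℂ) 1, ζ ≠ 0 →
      ζ * hdd ζ / hd ζ s =
        ζ * hd ζ s / h ζ s - 1 -
          ∫ t in (0:ℝ)..s,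
            (ζ * hd ζ t * p' (h ζ t) (s - t) +
             ζ * h ζ t * hd ζ t * p'' (h ζ t) (s - t)) := by
  obtain ⟨hs0, hsT⟩ := hs
  have hJ : ∀ t ∈ Set.Icc (0:ℝ) s, s - t ∈ Set.Ico (0:ℝ) T := fun t ht =>
    ⟨by linarith [ht.2], by linarith [ht.1]⟩
  have hcl : ∀ z ∈ Metric.ball (0:ℂ) 1, z ∈ Metric.closedBall (0:ℂ) 1 := fun z hz =>
    Metric.ball_subset_closedBall hz
  have hnorm : ∀ z ∈ Metric.ball (0:ℂ) 1, ‖z‖ ≤ 1 := fun z hz => (mem_ball_zero_iff.mp hz).le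
  have hPt : ∀ z ∈ Metric.ball (0:ℂ) 1,
      ContinuousOn (fun t => p z (s - t)) (Set.Icc 0 s) := fun z hz =>
    (hp_t z (hcl z hz)).comp (continuousOn_const.sub continuousOn_id) hJ
  have hP : ∀ t ∈ Set.Icc (0:ℝ) s, ∀ z ∈ Metric.ball (0:ℂ) 1,
      HasDerivAt (fun x => p x (s - t)) (p' z (s - t)) z := fun t ht => hp' _ (hJ t ht)
  have hP' : ∀ t ∈ Set.Icc (0:ℝ) s, ∀ z ∈ Metric.ball (0:ℂ) 1,
      HasDerivAt (fun x => p' x (s - t)) (p'' z (s - t)) z := fun t ht => hp'' _ (hJ t ht)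
  have hPb : ∀ z ∈ Metric.ball (0:ℂ) 1, ∀ t ∈ Set.Icc (0:ℝ) s, ‖p' z (s - t)‖ ≤ M' :=
    fun z hz t ht => hp'_bdd z (hcl z hz) _ (hJ t ht)
  have hQ : ∀ t ∈ Set.Icc (0:ℝ) s, ∀ z ∈ Metric.ball (0:ℂ) 1,
      HasDerivAt (fun x => x * p x (s - t)) (p z (s - t) + z * p' z (s - t)) z := by
    intro t ht z hz
    simpa using (hasDerivAt_id' z).fun_mul (hP t ht z hz)
  have hQ' : ∀ t ∈ Set.Icc (0:ℝ) s, ∀ z ∈ Metric.ball (0:ℂ) 1,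
      HasDerivAt (fun x => p x (s - t) + x * p' x (s - t))
        (2 * p' z (s - t) + z * p'' z (s - t)) z := by
    intro t ht z hz
    exact ((hP t ht z hz).fun_add ((hasDerivAt_id' z).fun_mul (hP' t ht z hz))).congr_deriv (by ring)
  have hQb : ∀ z ∈ Metric.ball (0:ℂ) 1, ∀ t ∈ Set.Icc (0:ℝ) s,
      ‖p z (s - t) + z * p' z (s - t)‖ ≤ M + M' := by
    intro z hz t ht
    refine (norm_add_le _ _).trans (add_le_add (hp_bdd z (hcl z hz) _ (hJ t ht)) ?_)
    rw [norm_mul]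
    exact (mul_le_of_le_one_left (norm_nonneg _) (hnorm z hz)).trans (hPb z hz t ht)
  have hQb' : ∀ z ∈ Metric.ball (0:ℂ) 1, ∀ t ∈ Set.Icc (0:ℝ) s,
      ‖2 * p' z (s - t) + z * p'' z (s - t)‖ ≤ 2 * M' + M'' := by
    intro z hz t ht
    refine (norm_add_le _ _).trans (add_le_add ?_ ?_)
    · rw [norm_mul, Complex.norm_two]
      exact mul_le_mul_of_nonneg_left (hPb z hz t ht) zero_le_two
    · rw [norm_mul]
      exact (mul_le_of_le_one_left (norm_nonneg _) (hnorm z hz)).trans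
        (hp''_bdd z (hcl z hz) _ (hJ t ht))
  have hQt : ∀ z ∈ Metric.ball (0:ℂ) 1,
      ContinuousOn (fun t => z * p z (s - t)) (Set.Icc 0 s) := fun z hz =>
    continuousOn_const.mul (hPt z hz)
  have hcont : ∀ ζ ∈ Metric.ball (0:ℂ) 1, ContinuousOn (h ζ) (Set.Icc 0 s) := fun ζ hζ t ht =>
    (hh_ode ζ hζ t ht).continuousWithinAt
  have hs' : s ∈ Set.Icc 0 s := ⟨hs0, le_rfl⟩
  have hexp : ∀ x ∈ Metric.ball (0:ℂ) 1, ContinuousOn (hd x) (Set.Icc 0 s) ∧ hd x s =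
      Complex.exp (-∫ t in (0:ℝ)..s, (p (h x t) (s - t) + h x t * p' (h x t) (s - t))) :=
    fun x hx => hasDerivAt_flow_eq_exp (r := fun z t => z * p z (s - t))
      (r' := fun z t => p z (s - t) + z * p' z (s - t))
      (r'' := fun z t => 2 * p' z (s - t) + z * p'' z (s - t))
      hQ hQb hQt hQ' hQb' hh_init hh_mem hh_ode hhd hs0 hx
  have hflow : ∀ x ∈ Metric.ball (0:ℂ) 1,
      h x s = x * Complex.exp (-∫ t in (0:ℝ)..s, p (h x t) (s - t)) := by
    intro x hx
    conv_rhs => rw [← hh_init x hx]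
    refine (eq_mul_exp_neg_integral_of_hasDerivAt hs0 (hcont x hx)
      (continuousOn_comp_curve (r := fun z t => p z (s - t)) hP hPb hPt (hcont x hx)
        (hh_mem x hx)) fun t ht => ?_).trans ?_
    · rw [mul_comm]
      exact (hh_ode x hx t (Set.Ioo_subset_Icc_self ht)).hasDerivAt (Icc_mem_nhds ht.1 ht.2)
    · rw [hh_init x hx]
  intro ζ hζ hζ0
  obtain ⟨hiP, hdP⟩ := hasDerivAt_integral_comp_flow (r := fun z t => p z (s - t))
    (r' := fun z t => p' z (s - t)) hP hPb hPt hh_mem hcont hhd hζ hs'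
  obtain ⟨hiQ, hdQ⟩ := hasDerivAt_integral_comp_flow
    (r := fun z t => p z (s - t) + z * p' z (s - t))
    (r' := fun z t => 2 * p' z (s - t) + z * p'' z (s - t))
    hQ' hQb' (continuousOn_deriv_param (r := fun z t => z * p z (s - t)) hQ hQb hQt)
    hh_mem hcont hhd hζ hs'
  have hd_eq : hd ζ s = h ζ s / ζ - h ζ s * ∫ t in (0:ℝ)..s, p' (h ζ t) (s - t) * hd ζ t := by
    refine (hhd s hs' ζ hζ).unique ?_
    have := ((hasDerivAt_id' ζ).fun_mul hdP.fun_neg.cexp).congr_of_eventuallyEq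
      (f₁ := fun x => h x s) (by
        filter_upwards [Metric.isOpen_ball.mem_nhds hζ] with x hx using hflow x hx)
    refine this.congr_deriv ?_
    rw [hflow ζ hζ]
    field_simp
    ring
  have hdd_eq : hdd ζ = -(hd ζ s * ∫ t in (0:ℝ)..s,
      (2 * p' (h ζ t) (s - t) + h ζ t * p'' (h ζ t) (s - t)) * hd ζ t) := by
    refine (hhdd ζ hζ).unique ?_
    have := hdQ.fun_neg.cexp.congr_of_eventuallyEq (f₁ := fun x => hd x s) (by
        filter_upwards [Metric.isOpen_ball.mem_nhds hζ] with x hx using (hexp x hx).2)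
    refine this.congr_deriv ?_
    rw [(hexp ζ hζ).2]
    ring
  have hh0 : h ζ s ≠ 0 := by
    rw [hflow ζ hζ]
    exact mul_ne_zero hζ0 (Complex.exp_ne_zero _)
  have hhd0 : hd ζ s ≠ 0 := by
    rw [(hexp ζ hζ).2]
    exact Complex.exp_ne_zero _
  have hlhs : ζ * hdd ζ / hd ζ s = -(ζ * ∫ t in (0:ℝ)..s,
      (2 * p' (h ζ t) (s - t) + h ζ t * p'' (h ζ t) (s - t)) * hd ζ t) := by
    rw [hdd_eq]
    field_simp
  have hrhs : ζ * hd ζ s / h ζ s - 1 =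
      -(ζ * ∫ t in (0:ℝ)..s, p' (h ζ t) (s - t) * hd ζ t) := by
    rw [hd_eq]
    field_simp
    ring
  have hint : ∫ t in (0:ℝ)..s, (ζ * hd ζ t * p' (h ζ t) (s - t) +
        ζ * h ζ t * hd ζ t * p'' (h ζ t) (s - t)) =
      ζ * ((∫ t in (0:ℝ)..s,
        (2 * p' (h ζ t) (s - t) + h ζ t * p'' (h ζ t) (s - t)) * hd ζ t) -
        ∫ t in (0:ℝ)..s, p' (h ζ t) (s - t) * hd ζ t) := by
    rw [← intervalIntegral.integral_sub hiQ hiP, ← intervalIntegral.integral_const_mul]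
    congr 1 with t
    ring
  rw [hlhs, hrhs, hint]
  ring
end
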